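/- arXiv:1705.04609 — 2 statements merged into one kernel-verified Lean document; each statement's English description precedes it below -/
import Mathlib

section
/- For all integers ℓ ≥ 2 and τ, d ≥ 0 there is an integer c ≥ 0 with the following property. Let G be a graph such that χ^8(G) ≤ τ, and such that every induced subgraph J of G with ω(J) < ω(G) has chromatic number at most τ. If χ(G) > c, then for every integer r with 0 ≤ r < ℓ there is a d-peripheral hole in G whose length is congruent to r modulo ℓ. -/
open SimpleGraph

/-- The set of vertices at `G`-distance at most `ρ` from `v`. -/
def closedNbhd {V : Type*} (G : SimpleGraph V) (v : V) (ρ : ℕ) : Set V :=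
  {u | G.Reachable v u ∧ G.dist v u ≤ ρ}

/-- `χ^ρ(G)`. -/
noncomputable def chiRho {V : Type*} (G : SimpleGraph V) (ρ : ℕ) : ℕ∞ :=
  ⨆ v : V, (G.induce (closedNbhd G v ρ)).chromaticNumber

/-- The set of vertices of `G` not in the range of `f` and with no neighbour in it. -/
def periphSet {V : Type*} {W : Type*} (G : SimpleGraph V) (f : W → V) : Set V :=
  {v | v ∉ Set.range f ∧ ∀ u ∈ Set.range f, ¬ G.Adj v u}

/-- `G` has a `d`-peripheral hole of length `n`. -/
def HasPeriphHole {V : Type*} (G : SimpleGraph V) (d n : ℕ) : Prop :=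
  4 ≤ n ∧ ∃ f : cycleGraph n ↪g G,
    (d : ℕ∞) < (G.induce (periphSet G f)).chromaticNumber


/-- `G[S]` has a proper colouring with colours `0, …, n - 1`. -/
def ColOn {V : Type*} (G : SimpleGraph V) (S : Set V) (n : ℕ) : Prop :=
  ∃ f : V → ℕ, (∀ v ∈ S, f v < n) ∧ ∀ u ∈ S, ∀ v ∈ S, G.Adj u v → f u ≠ f v

/-- The spanning subgraph of `G` whose edges are those with both ends in `S`. -/
def within {V : Type*} (G : SimpleGraph V) (S : Set V) : SimpleGraph V where
  Adj a b := G.Adj a b ∧ a ∈ S ∧ b ∈ S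
  symm := ⟨fun _ _ h => ⟨h.1.symm, h.2.2, h.2.1⟩⟩
  loopless := ⟨fun _ h => h.1.ne rfl⟩

/-- `G[S]` is connected or empty. -/
def ConnOn {V : Type*} (G : SimpleGraph V) (S : Set V) : Prop :=
  ∀ u ∈ S, ∀ v ∈ S, (within G S).Reachable u v

section Coloring

variable {V : Type*} {G : SimpleGraph V}

theorem ColOn.mono {S T : Set V} {n m : ℕ} (h : ColOn G T n) (hST : S ⊆ T) (hnm : n ≤ m) :
    ColOn G S m := by
  obtain ⟨f, h1, h2⟩ := h
  exact ⟨f, fun v hv => (h1 v (hST hv)).trans_le hnm,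
    fun u hu v hv => h2 u (hST hu) v (hST hv)⟩

theorem ColOn.union {S T : Set V} {n m : ℕ} (hS : ColOn G S n) (hT : ColOn G T m) :
    ColOn G (S ∪ T) (n + m) := by
  classical
  obtain ⟨f, f1, f2⟩ := hS
  obtain ⟨g, g1, g2⟩ := hT
  refine ⟨fun v => if v ∈ S then f v else n + g v, ?_, ?_⟩
  · rintro v hv
    by_cases h : v ∈ S
    · simp only [h, if_true]; have := f1 v h; omega
    · simp only [h, if_false]; have := g1 v (hv.resolve_left h); omega
  · rintro u hu v hv huv
    by_cases h : u ∈ S <;> by_cases h' : v ∈ S <;> simp only [h, h', if_true, if_false]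
    · exact f2 u h v h' huv
    · have := f1 u h; omega
    · have := f1 v h'; omega
    · have := g2 u (hu.resolve_left h) v (hv.resolve_left h') huv; omega

theorem colOn_of_fibers {ι : Type*} {S : Set V} {n : ℕ} (g : V → ι)
    (hg : ∀ u ∈ S, ∀ v ∈ S, G.Adj u v → g u = g v)
    (h : ∀ i, ColOn G {v | v ∈ S ∧ g v = i} n) : ColOn G S n := by
  choose f h1 h2 using h
  refine ⟨fun v => f (g v) v, fun v hv => h1 _ v ⟨hv, rfl⟩, fun u hu v hv huv => ?_⟩
  have e := hg u hu v hv huv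
  simp only [e]
  exact h2 (g v) u ⟨hu, e⟩ v ⟨hv, rfl⟩ huv

theorem colOn_mul {S : Set V} {a b : ℕ} (g : V → ℕ) (hg : ∀ v ∈ S, g v < b)
    (h : ∀ i < b, ColOn G {v | v ∈ S ∧ g v = i} a) : ColOn G S (a * b) := by
  choose! f h1 h2 using h
  have hlt : ∀ v ∈ S, f (g v) v < a := fun v hv => h1 _ (hg v hv) v ⟨hv, rfl⟩
  refine ⟨fun v => f (g v) v + a * g v, fun v hv => ?_, fun u hu v hv huv heq => ?_⟩
  · have h3 := hlt v hv
    have h4 := Nat.mul_le_mul_left a (hg v hv)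
    rw [Nat.mul_succ] at h4
    show f (g v) v + a * g v < a * b
    omega
  · have ha : 0 < a := (Nat.zero_le _).trans_lt (hlt v hv)
    have e : g u = g v := by
      have := congrArg (· / a) heq
      simpa [Nat.add_mul_div_left _ _ ha, Nat.div_eq_of_lt (hlt u hu),
        Nat.div_eq_of_lt (hlt v hv)] using this
    simp only [e] at heq
    exact h2 (g v) (hg v hv) u ⟨hu, e⟩ v ⟨hv, rfl⟩ huv (by omega)

theorem colOn_levels {S : Set V} {n : ℕ} (δ : V → ℕ)
    (hδ : ∀ u ∈ S, ∀ v ∈ S, G.Adj u v → δ v ≤ δ u + 1)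
    (h : ∀ i, ColOn G {v | v ∈ S ∧ δ v = i} n) : ColOn G S (n * 2) := by
  refine colOn_mul (fun v => δ v % 2) (fun v _ => Nat.mod_lt _ (by norm_num)) fun i _ => ?_
  refine colOn_of_fibers δ (fun u hu v hv huv => ?_) fun j => (h j).mono ?_ le_rfl
  · have h1 := hδ u hu.1 v hv.1 huv
    have h2 := hδ v hv.1 u hu.1 huv.symm
    have h3 : δ u % 2 = i := hu.2
    have h4 : δ v % 2 = i := hv.2
    omega
  · rintro v ⟨hv, e⟩
    exact ⟨hv.1, e⟩

theorem colOn_empty (n : ℕ) : ColOn G (∅ : Set V) n := ⟨fun _ => 0, by simp, by simp⟩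

theorem nonempty_of_not_colOn {S : Set V} {n : ℕ} (h : ¬ ColOn G S n) : S.Nonempty := by
  rw [Set.nonempty_iff_ne_empty]
  rintro rfl
  exact h (colOn_empty n)

theorem within_mono {S T : Set V} (h : S ⊆ T) : within G S ≤ within G T :=
  fun _ _ hab => ⟨hab.1, h hab.2.1, h hab.2.2⟩

theorem connOn_insert {F : Set V} {k x : V} (hF : ConnOn G F) (hx : x ∈ F) (hk : G.Adj k x) :
    ConnOn G (insert k F) := by
  have key : ∀ u ∈ insert k F, (within G (insert k F)).Reachable u x := by
    rintro u (rfl | hu)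
    · exact Adj.reachable ⟨hk, Set.mem_insert _ _, Set.mem_insert_of_mem _ hx⟩
    · exact (hF u hu x hx).mono (within_mono (Set.subset_insert _ _))
  exact fun u hu v hv => (key u hu).trans (key v hv).symm

theorem exists_component {S : Set V} {n : ℕ} (h : ¬ ColOn G S n) :
    ∃ C ⊆ S, ConnOn G C ∧ ¬ ColOn G C n ∧ ∀ v ∈ C, ∀ x ∈ S, G.Adj v x → x ∈ C := by
  by_contra hcon
  push Not at hcon
  have hsub : ∀ a b, (within G S).Reachable a b →
      (within G {v | v ∈ S ∧ (within G S).connectedComponentMk v =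
        (within G S).connectedComponentMk a}).Reachable a b := by
    rintro a b ⟨w⟩
    induction w with
    | nil => exact Reachable.refl _
    | @cons x y z hxy w ih =>
      have e : (within G S).connectedComponentMk y = (within G S).connectedComponentMk x :=
        ConnectedComponent.sound hxy.symm.reachable
      rw [e] at ih
      exact (Adj.reachable (G := within G {v | v ∈ S ∧ (within G S).connectedComponentMk v =
        (within G S).connectedComponentMk x}) ⟨hxy.1, ⟨hxy.2.1, rfl⟩, ⟨hxy.2.2, e⟩⟩).trans ih
  refine h (colOn_of_fibers (fun v => (within G S).connectedComponentMk v)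
    (fun u hu v hv huv => ConnectedComponent.sound (Adj.reachable ⟨huv, hu, hv⟩)) fun i => ?_)
  by_contra hi
  obtain ⟨v, hv, x, hx, hvx, hxn⟩ := hcon _ (fun v hv => hv.1) (fun u hu v hv => by
    have := hsub u v (ConnectedComponent.exact (hu.2.trans hv.2.symm))
    rwa [hu.2] at this) hi
  have hadj : (within G S).Adj x v := ⟨hvx.symm, hx, hv.1⟩
  exact hxn ⟨hx, (ConnectedComponent.sound hadj.reachable).trans hv.2⟩

theorem ConnOn.exists_crossing {F A : Set V} (hF : ConnOn G F) (hA : A ⊆ F) {a b : V}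
    (ha : a ∈ A) (hb : b ∈ F) (hbA : b ∉ A) : ∃ v ∈ A, ∃ x ∈ F, x ∉ A ∧ G.Adj v x := by
  obtain ⟨w⟩ := hF a (hA ha) b hb
  obtain ⟨d, _, h1, h2⟩ := w.exists_boundary_dart A ha hbA
  exact ⟨d.fst, h1, d.snd, d.adj.2.2, h2, d.adj.1⟩

theorem ConnOn.exists_levels {S : Set V} (hS : ConnOn G S) {t : V} (ht : t ∈ S) :
    ∃ δ : V → ℕ, (∀ v ∈ S, δ v = 0 → v = t) ∧
      (∀ u ∈ S, ∀ v ∈ S, G.Adj u v → δ v ≤ δ u + 1) ∧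
      ∀ v ∈ S, ∀ n, δ v = n + 1 → ∃ u ∈ S, G.Adj v u ∧ δ u = n := by
  have lip : ∀ u ∈ S, ∀ v ∈ S, G.Adj u v →
      (within G S).dist v t ≤ (within G S).dist u t + 1 := by
    intro u hu v hv huv
    obtain ⟨w, hw⟩ := (hS u hu t ht).exists_walk_length_eq_dist
    have h : (within G S).Adj v u := ⟨huv.symm, hv, hu⟩
    simpa [hw] using (within G S).dist_le (Walk.cons h w)
  refine ⟨fun v => (within G S).dist v t, fun v hv h => ?_, lip, fun v hv n h => ?_⟩
  · exact (hS v hv t ht).dist_eq_zero_iff.1 h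
  · obtain ⟨w, hw⟩ := (hS v hv t ht).exists_walk_length_eq_dist
    cases w with
    | nil => simp at h
    | @cons _ u _ hvu w =>
      refine ⟨u, hvu.2.2, hvu.1, ?_⟩
      have h1 := (within G S).dist_le w
      have h2 := lip u hvu.2.2 v hv hvu.1.symm
      simp only [Walk.length_cons] at hw
      replace h : (within G S).dist v t = n + 1 := h
      show (within G S).dist u t = n
      omega

end Coloring

section Timeline

variable {V : Type*} {G : SimpleGraph V}

/-- The vertices of `X` all of whose neighbours in `N` come before time `i`. -/
def freeBefore (G : SimpleGraph V) (X N : Set V) (a : V → ℕ) (i : ℕ) : Set V :=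
  {x | x ∈ X ∧ ∀ q ∈ N, G.Adj q x → a q < i}

theorem freeBefore_mono {X N : Set V} {a : V → ℕ} {i j : ℕ} (h : i ≤ j) :
    freeBefore G X N a i ⊆ freeBefore G X N a j :=
  fun _ hx => ⟨hx.1, fun q hq hqx => (hx.2 q hq hqx).trans_le h⟩

/-- `z` has a neighbour in a connected subset of `freeBefore G X N a i` that is not
`c`-colourable. -/
def Touches (G : SimpleGraph V) (X N : Set V) (a : V → ℕ) (c i : ℕ) (z : V) : Prop :=
  ∃ F ⊆ freeBefore G X N a i, ConnOn G F ∧ ¬ ColOn G F c ∧ ∃ x ∈ F, G.Adj z x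

theorem colOn_untouched [Fintype V] {X N : Set V} {a : V → ℕ} {τ c : ℕ}
    (hX : ∀ x ∈ X, ∃ p ∈ N, G.Adj p x)
    (ha : ∀ i, ColOn G {w | ∃ p ∈ N, a p = i ∧ G.Adj p w} τ) :
    ColOn G {z | z ∈ X ∧ ∀ i, Touches G X N a c i z → z ∈ freeBefore G X N a i} (τ + c) := by
  set big : ℕ → V → Prop := fun i u =>
    ∃ F ⊆ freeBefore G X N a i, ConnOn G F ∧ ¬ ColOn G F c ∧ u ∈ F with hbig
  have hNB : ∀ i, ColOn G {u | u ∈ freeBefore G X N a i ∧ ¬ big i u} c := by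
    intro i
    by_contra hcon
    obtain ⟨C, hC, hconn, hcol, -⟩ := exists_component hcon
    obtain ⟨u, hu⟩ := nonempty_of_not_colOn hcol
    exact (hC hu).2 ⟨C, fun v hv => (hC hv).1, hconn, hcol, hu⟩
  have step : ∀ u v, v ∈ X → (∀ i, Touches G X N a c i v → v ∈ freeBefore G X N a i) →
      G.Adj u v → ∀ i, big i u → big i v := by
    rintro u v - hv huv i ⟨F, hF, hconn, hcol, hu⟩
    have hvf := hv i ⟨F, hF, hconn, hcol, u, hu, huv.symm⟩
    exact ⟨insert v F, Set.insert_subset hvf hF, connOn_insert hconn hu huv.symm,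
      fun h => hcol (h.mono (Set.subset_insert _ _) le_rfl), Set.mem_insert _ _⟩
  refine colOn_of_fibers (fun u => {i | big i u}) (fun u hu v hv huv => ?_) fun κ => ?_
  · ext i
    exact ⟨step u v hv.1 hv.2 huv i, step v u hu.1 hu.2 huv.symm i⟩
  rcases Set.eq_empty_or_nonempty κ with rfl | hκ
  · refine (hNB (Finset.univ.sup a + 1)).mono ?_ (Nat.le_add_left _ _)
    rintro v ⟨hv, e⟩
    refine ⟨⟨hv.1, fun q _ _ => Nat.lt_succ_of_le (Finset.le_sup (Finset.mem_univ q))⟩, ?_⟩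
    exact fun h => (Set.eq_empty_iff_forall_notMem.1 e) _ h
  · have hmem : sInf κ ∈ κ := Nat.sInf_mem hκ
    rcases hi : sInf κ with _ | j
    · refine (colOn_empty _).mono ?_ le_rfl
      rintro v ⟨hv, rfl⟩
      rw [hi] at hmem
      obtain ⟨F, hF, -, -, hvF⟩ := hmem
      obtain ⟨p, hp, hpv⟩ := hX v hv.1
      exact absurd ((hF hvF).2 p hp hpv) (Nat.not_lt_zero _)
    · refine ((ha j).union (hNB j)).mono ?_ le_rfl
      rintro v ⟨hv, rfl⟩
      rw [hi] at hmem
      obtain ⟨F, hF, -, -, hvF⟩ := hmem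
      have hj : ¬ big j v := fun h => by
        have : sInf {i | big i v} ≤ j := Nat.sInf_le h
        omega
      by_cases hvj : v ∈ freeBefore G X N a j
      · exact Or.inr ⟨hvj, hj⟩
      · left
        have : ∃ q ∈ N, G.Adj q v ∧ j ≤ a q := by
          by_contra hcon
          push Not at hcon
          exact hvj ⟨hv.1, hcon⟩
        obtain ⟨q, hq, hqv, hjq⟩ := this
        have := (hF hvF).2 q hq hqv
        exact ⟨q, hq, by omega, hqv⟩

/-- The connected, not `c`-colourable subsets of `freeBefore G X N a i` with no neighbour of `z`. -/
def missed (G : SimpleGraph V) (X N : Set V) (a : V → ℕ) (c i : ℕ) (z : V) : Set (Set V) :=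
  {F | F ⊆ freeBefore G X N a i ∧ ConnOn G F ∧ ¬ ColOn G F c ∧ ∀ x ∈ F, ¬ G.Adj z x}

theorem colOn_of_missed_eq {X N : Set V} {a : V → ℕ} {τ c i : ℕ}
    (hN : ∀ x, ColOn G {w | G.Adj x w} τ) {z₀ : V} (hz₀ : Touches G X N a (c + τ) i z₀) :
    ColOn G {z | z ∉ freeBefore G X N a i ∧ Touches G X N a (c + τ) i z ∧
      missed G X N a c i z = missed G X N a c i z₀} τ := by
  obtain ⟨F, hF, hconn, hcol, x₀, hx₀, hzx₀⟩ := hz₀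
  have h1 : ¬ ColOn G {v | v ∈ F ∧ ¬ G.Adj z₀ v} c := by
    intro h
    refine hcol ((h.union (hN z₀)).mono (fun v hv => ?_) le_rfl)
    by_cases hzv : G.Adj z₀ v
    · exact Or.inr hzv
    · exact Or.inl ⟨hv, hzv⟩
  obtain ⟨A, hA, hAconn, hAcol, hAcl⟩ := exists_component h1
  obtain ⟨a₀, ha₀⟩ := nonempty_of_not_colOn hAcol
  obtain ⟨v, hv, x, hx, hxA, hvx⟩ := hconn.exists_crossing (fun v hv => (hA hv).1) ha₀ hx₀
    fun h => (hA h).2 hzx₀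
  have hzx : G.Adj z₀ x := by
    by_contra h
    exact hxA (hAcl v hv x ⟨hx, h⟩ hvx)
  refine (hN x).mono ?_ le_rfl
  rintro z ⟨-, -, hz⟩
  have hAz : A ∈ missed G X N a c i z := by
    rw [hz]
    exact ⟨fun u hu => hF (hA hu).1, hAconn, hAcol, fun u hu => (hA hu).2⟩
  have hins : insert x A ∉ missed G X N a c i z := by
    rw [hz]
    exact fun h => h.2.2.2 x (Set.mem_insert _ _) hzx
  by_contra hzx'
  refine hins ⟨Set.insert_subset (hF hx) hAz.1, connOn_insert hAconn hv hvx.symm,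
    fun h => hAcol (h.mono (Set.subset_insert _ _) le_rfl), ?_⟩
  rintro u (rfl | hu)
  · exact fun h => hzx' h.symm
  · exact hAz.2.2.2 u hu

theorem exists_gadget [Fintype V] {X N : Set V} {a : V → ℕ} {τ₁ τ c : ℕ}
    (hN : ∀ x, ColOn G {w | G.Adj x w} τ)
    (hclq : ∀ S : Set V, ¬ ColOn G S τ →
      ∃ K : Finset V, ↑K ⊆ S ∧ G.IsClique K ∧ ∀ p, ∃ k ∈ K, ¬ G.Adj p k)
    (hX : ∀ x ∈ X, ∃ p ∈ N, G.Adj p x)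
    (ha : ∀ i, ColOn G {w | ∃ p ∈ N, a p = i ∧ G.Adj p w} τ₁)
    (hcol : ¬ ColOn G X ((τ₁ + (c + τ)) + τ * τ)) :
    ∃ F ⊆ X, ConnOn G F ∧ ¬ ColOn G F c ∧ ∃ k ∈ X, ∃ k' ∈ X, k ∉ F ∧ k' ∉ F ∧ G.Adj k k' ∧
      (∃ x ∈ F, G.Adj k x) ∧ (∀ x ∈ F, ¬ G.Adj k' x) ∧
      ∃ p ∈ N, ∃ p' ∈ N, G.Adj p k ∧ G.Adj p' k' ∧ ¬ G.Adj p' k ∧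
        ∀ x ∈ F, ∀ q ∈ N, G.Adj q x → a q < a p ∧ a q < a p' := by
  classical
  set Fr := freeBefore G X N a with hFr
  set T := Touches G X N a (c + τ) with hT
  set X₁ : Set V := {z | z ∈ X ∧ ∃ i, z ∉ Fr i ∧ T i z} with hX₁
  set bd : V → ℕ := fun z => sInf {i | T i z} with hbd
  set 𝒜 : V → Set (Set V) := fun z => missed G X N a c (bd z) z with h𝒜
  have hbdT : ∀ z ∈ X₁, T (bd z) z := by
    rintro z ⟨-, i, -, hi⟩
    exact Nat.sInf_mem (s := {i | T i z}) ⟨i, hi⟩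
  have hbdlt : ∀ z i, i < bd z → ¬ T i z := fun z i hi h => Nat.notMem_of_lt_sInf hi h
  have hbdF : ∀ z ∈ X₁, z ∉ Fr (bd z) := by
    rintro z ⟨-, i, hz, hi⟩ h
    exact hz (freeBefore_mono (Nat.sInf_le hi) h)
  have hlate : ∀ z ∈ X₁, ∃ p ∈ N, G.Adj p z ∧ bd z ≤ a p := by
    intro z hz
    by_contra hcon
    push Not at hcon
    exact hbdF z hz ⟨hz.1, hcon⟩
  have h1 : ¬ ColOn G X₁ (τ * τ) := by
    intro h
    refine hcol (((colOn_untouched (c := c + τ) hX ha).union h).mono (fun z hz => ?_) le_rfl)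
    by_cases hz1 : z ∈ X₁
    · exact Or.inr hz1
    · refine Or.inl ⟨hz, fun i hi => ?_⟩
      by_contra hzi
      exact hz1 ⟨hz, i, hzi, hi⟩
  have hclass : ∀ κ : ℕ × Set (Set V), ColOn G {z | z ∈ X₁ ∧ (bd z, 𝒜 z) = κ} τ := by
    intro κ
    rcases Set.eq_empty_or_nonempty {z | z ∈ X₁ ∧ (bd z, 𝒜 z) = κ} with he | ⟨z₀, hz₀, rfl⟩
    · rw [he]; exact colOn_empty _
    · refine (colOn_of_missed_eq hN (hbdT z₀ hz₀)).mono ?_ le_rfl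
      rintro z ⟨hz, e⟩
      obtain ⟨e1, e2⟩ := Prod.mk.inj e
      have := hbdF z hz
      have h2 := hbdT z hz
      simp only [h𝒜] at e2
      rw [e1] at this h2 e2
      exact ⟨this, h2, e2⟩
  choose f hf1 hf2 using hclass
  have h2 : ∃ i < τ, ¬ ColOn G {z | z ∈ X₁ ∧ f (bd z, 𝒜 z) z = i} τ := by
    by_contra hcon
    push Not at hcon
    exact h1 (colOn_mul (fun z => f (bd z, 𝒜 z) z) (fun z hz => hf1 _ z ⟨hz, rfl⟩) hcon)
  obtain ⟨i, -, hi⟩ := h2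
  obtain ⟨K, hK, hKc, hKp⟩ := hclq _ hi
  obtain ⟨v₀, -⟩ := nonempty_of_not_colOn hi
  have hKne : K.Nonempty := (hKp v₀).imp fun _ h => h.1
  obtain ⟨k', hk', hmax⟩ := K.exists_max_image (fun k => toLex (bd k, (𝒜 k).ncard)) hKne
  have hk'X := (hK hk').1
  obtain ⟨p', hp', hpk', hbp'⟩ := hlate k' hk'X
  obtain ⟨k, hk, hpk⟩ := hKp p'
  have hkX := (hK hk).1
  obtain ⟨p, hp, hpk2, hbp⟩ := hlate k hkX
  have hkk : G.Adj k k' := hKc hk hk' fun h => hpk (h ▸ hpk')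
  have hFrX : ∀ j, Fr j ⊆ X := fun j x hx => hx.1
  rcases Prod.Lex.toLex_le_toLex.1 (hmax k hk) with hlt | ⟨heq, hcard⟩
  · obtain ⟨F, hF, hconn, hFcol, hx⟩ := hbdT k hkX
    refine ⟨F, hF.trans (hFrX _), hconn,
      fun h => hFcol (h.mono subset_rfl (Nat.le_add_right _ _)), k, hkX.1, k', hk'X.1,
      fun h => hbdF k hkX (hF h),
      fun h => hbdF k' hk'X (freeBefore_mono (le_of_lt hlt) (hF h)), hkk, hx,
      fun x hx h => hbdlt k' _ hlt ⟨F, hF, hconn, hFcol, x, hx, h⟩, p, hp, p', hp', hpk2, hpk',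
      hpk, fun x hx q hq hqx => ?_⟩
    have := (hF hx).2 q hq hqx
    have hlt' : bd k < bd k' := hlt
    exact ⟨by omega, by omega⟩
  · have heq' : bd k = bd k' := heq
    by_cases hex : ∃ F ∈ 𝒜 k', ∃ x ∈ F, G.Adj k x
    · obtain ⟨F, ⟨hF, hconn, hFcol, hkF⟩, hx⟩ := hex
      refine ⟨F, hF.trans (hFrX _), hconn, hFcol, k, hkX.1, k', hk'X.1,
        fun h => hbdF k hkX (heq' ▸ hF h), fun h => hbdF k' hk'X (hF h), hkk, hx, hkF, p, hp,
        p', hp', hpk2, hpk', hpk, fun x hx q hq hqx => ?_⟩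
      have := (hF hx).2 q hq hqx
      exact ⟨by omega, by omega⟩
    · push Not at hex
      have hsub : 𝒜 k' ⊆ 𝒜 k := fun F hF =>
        ⟨by rw [heq']; exact hF.1, hF.2.1, hF.2.2.1, hex F hF⟩
      have he : 𝒜 k' = 𝒜 k := Set.eq_of_subset_of_ncard_le hsub hcard
      have e1 := (hK hk).2
      have e2 := (hK hk').2
      have e3 := hf2 (bd k, 𝒜 k) k ⟨hkX, rfl⟩ k' ⟨hk'X, by rw [heq', he]⟩ hkk
      rw [← heq', he] at e2
      exact absurd (e1.trans e2.symm) e3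

end Timeline

section Lists

variable {V : Type*} {G : SimpleGraph V}

/-- The list is the vertex sequence of an induced path of `G`. -/
def IsIP (G : SimpleGraph V) : List V → Prop
  | [] => True
  | [_] => True
  | a :: b :: l => G.Adj a b ∧ (∀ x ∈ l, ¬ G.Adj a x ∧ a ≠ x) ∧ IsIP G (b :: l)

theorem isIP_cons {a b : V} {l : List V} (hl : IsIP G l) (hb : l.head? = some b)
    (hab : G.Adj a b) (h : ∀ x ∈ l, a ≠ x ∧ (G.Adj a x → x = b)) (hnd : l.Nodup) :
    IsIP G (a :: l) := by
  cases l with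
  | nil => trivial
  | cons c l =>
    obtain rfl : c = b := by simpa using hb
    refine ⟨hab, fun x hx => ⟨fun hax => ?_, (h x (List.mem_cons_of_mem _ hx)).1⟩, hl⟩
    obtain rfl := (h x (List.mem_cons_of_mem _ hx)).2 hax
    exact (List.nodup_cons.1 hnd).1 hx

theorem IsIP.nodup : ∀ {l : List V}, IsIP G l → l.Nodup
  | [], _ => List.nodup_nil
  | [_], _ => List.nodup_singleton _
  | a :: b :: l, h => by
    refine List.nodup_cons.2 ⟨fun ha => ?_, h.2.2.nodup⟩
    rcases List.mem_cons.1 ha with e | e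
    · exact h.1.ne e
    · exact (h.2.1 a e).2 rfl

theorem IsIP.append {a b : V} : ∀ {l₁ l₂ : List V}, IsIP G l₁ → IsIP G l₂ →
    l₁.getLast? = some a → l₂.head? = some b → G.Adj a b →
    (∀ x ∈ l₁, ∀ y ∈ l₂, x ≠ y ∧ (G.Adj x y → x = a ∧ y = b)) → IsIP G (l₁ ++ l₂)
  | [], _, _, h₂, _, _, _, _ => h₂
  | [x], l₂, _, h₂, ha, hb, hab, h => by
    obtain rfl : x = a := by simpa using ha
    exact isIP_cons h₂ hb hab (fun y hy => ⟨(h x (by simp) y hy).1,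
      fun hxy => ((h x (by simp) y hy).2 hxy).2⟩) h₂.nodup
  | x :: y :: l, l₂, h₁, h₂, ha, hb, hab, h => by
    refine ⟨h₁.1, fun z hz => ?_, IsIP.append (l₁ := y :: l) h₁.2.2 h₂ (by simpa using ha) hb hab
      fun u hu => h u (List.mem_cons_of_mem _ hu)⟩
    rcases List.mem_append.1 hz with hz | hz
    · exact h₁.2.1 z hz
    · refine ⟨fun hxz => ?_, (h x (by simp) z hz).1⟩
      obtain ⟨rfl, -⟩ := (h x (by simp) z hz).2 hxz
      refine (List.nodup_cons.1 h₁.nodup).1 (List.mem_of_getLast? (by simpa using ha))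

/-- The list is a path of `G` along which `δ` decreases by one at each step, down to zero. -/
def Desc (G : SimpleGraph V) (δ : V → ℕ) : List V → Prop
  | [] => False
  | [x] => δ x = 0
  | x :: y :: l => G.Adj x y ∧ δ x = δ y + 1 ∧ Desc G δ (y :: l)

theorem Desc.length {δ : V → ℕ} : ∀ {x : V} {l : List V}, Desc G δ (x :: l) → l.length = δ x
  | _, [], h => by simpa [Desc, eq_comm] using h
  | x, y :: l, h => by
    have := Desc.length h.2.2
    have := h.2.1
    simp only [List.length_cons]
    omega

theorem Desc.lt {δ : V → ℕ} : ∀ {x : V} {l : List V}, Desc G δ (x :: l) → ∀ u ∈ l, δ u < δ x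
  | _, [], _, u, hu => by simp at hu
  | x, y :: l, h, u, hu => by
    have := h.2.1
    rcases List.mem_cons.1 hu with rfl | hu
    · omega
    · have := Desc.lt h.2.2 u hu
      omega

theorem Desc.inj {δ : V → ℕ} : ∀ {l : List V}, Desc G δ l → ∀ u ∈ l, ∀ v ∈ l, δ u = δ v → u = v
  | [], h, _, _, _, _, _ => h.elim
  | [x], _, u, hu, v, hv, _ => by
    rw [List.mem_singleton.1 hu, List.mem_singleton.1 hv]
  | x :: y :: l, h, u, hu, v, hv, e => by
    rcases List.mem_cons.1 hu with rfl | hu' <;> rcases List.mem_cons.1 hv with rfl | hv'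
    · rfl
    · have := Desc.lt h v hv'
      omega
    · have := Desc.lt h u hu'
      omega
    · exact Desc.inj h.2.2 u hu' v hv' e

theorem Desc.of_append {δ : V → ℕ} {x : V} {l₂ : List V} :
    ∀ {l₁ : List V}, Desc G δ (l₁ ++ x :: l₂) → Desc G δ (x :: l₂)
  | [], h => h
  | [_], h => h.2.2
  | _ :: z :: l, h => Desc.of_append (l₁ := z :: l) h.2.2

theorem Desc.isIP {δ : V → ℕ} {S : Set V}
    (hδ : ∀ u ∈ S, ∀ v ∈ S, G.Adj u v → δ v ≤ δ u + 1) :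
    ∀ {l : List V}, Desc G δ l → (∀ x ∈ l, x ∈ S) → IsIP G l
  | [], _, _ => trivial
  | [_], _, _ => trivial
  | x :: y :: l, h, hS => by
    refine ⟨h.1, fun u hu => ?_, Desc.isIP hδ h.2.2 fun z hz => hS z (List.mem_cons_of_mem _ hz)⟩
    have h1 := Desc.lt h.2.2 u hu
    have h2 := h.2.1
    refine ⟨fun hxu => ?_, fun e => ?_⟩
    · have := hδ u (hS u (by simp [hu])) x (hS x (by simp)) hxu.symm
      omega
    · rw [e] at h2
      omega

theorem exists_desc {δ : V → ℕ} {S : Set V} {t : V} (h0 : ∀ v ∈ S, δ v = 0 → v = t)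
    (hp : ∀ v ∈ S, ∀ n, δ v = n + 1 → ∃ u ∈ S, G.Adj v u ∧ δ u = n) :
    ∀ n, ∀ v ∈ S, δ v = n → ∃ l, Desc G δ (v :: l) ∧ (∀ u ∈ v :: l, u ∈ S) ∧
      (v :: l).getLast? = some t
  | 0, v, hv, hn => ⟨[], hn, by simpa using hv, by simpa using h0 v hv hn⟩
  | n + 1, v, hv, hn => by
    obtain ⟨u, hu, hvu, hun⟩ := hp v hv n hn
    obtain ⟨l, h1, h2, h3⟩ := exists_desc h0 hp n u hu hun
    refine ⟨u :: l, ⟨hvu, by omega, h1⟩, ?_, by simpa using h3⟩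
    rintro x hx
    rcases List.mem_cons.1 hx with rfl | hx
    · exact hv
    · exact h2 x hx

theorem Desc.colOn_nbhd {δ : V → ℕ} {S : Set V} {τ : ℕ} {π : List V} (hπ : Desc G δ π)
    (hS : ∀ x ∈ π, x ∈ S) (hδ : ∀ u ∈ S, ∀ v ∈ S, G.Adj u v → δ v ≤ δ u + 1)
    (hB : ∀ x, ColOn G {v | v = x ∨ G.Adj x v} τ) :
    ColOn G {v | v ∈ S ∧ ∃ x ∈ π, v = x ∨ G.Adj x v} ((τ + τ + τ) * 2) := by
  have hU : ∀ j, ColOn G {v | ∃ x ∈ π, δ x = j ∧ (v = x ∨ G.Adj x v)} τ := by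
    intro j
    by_cases h : ∃ x ∈ π, δ x = j
    · obtain ⟨x, hx, rfl⟩ := h
      refine (hB x).mono ?_ le_rfl
      rintro v ⟨y, hy, e, hv⟩
      rwa [hπ.inj y hy x hx e] at hv
    · refine (colOn_empty τ).mono ?_ le_rfl
      rintro v ⟨y, hy, e, -⟩
      exact h ⟨y, hy, e⟩
  refine colOn_levels δ (fun u hu v hv => hδ u hu.1 v hv.1) fun i => ?_
  refine (((hU (i - 1)).union (hU i)).union (hU (i + 1))).mono ?_ le_rfl
  rintro v ⟨⟨hv, x, hx, hxv⟩, rfl⟩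
  have h1 : δ x ≤ δ v + 1 ∧ δ v ≤ δ x + 1 := by
    rcases hxv with rfl | hxv
    · omega
    · exact ⟨hδ v hv x (hS x hx) hxv.symm, hδ x (hS x hx) v hv hxv⟩
  rcases (by omega : δ x = δ v - 1 ∨ δ x = δ v ∨ δ x = δ v + 1) with e | e | e
  · exact Or.inl (Or.inl ⟨x, hx, e, hxv⟩)
  · exact Or.inl (Or.inr ⟨x, hx, e, hxv⟩)
  · exact Or.inr ⟨x, hx, e, hxv⟩

end Lists

section Showers

variable {V : Type*} {G : SimpleGraph V}

/-- The set of vertices at distance at most three from `v`. -/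
def ballThree (G : SimpleGraph V) (v : V) : Set V :=
  {w | ∃ a b, (a = v ∨ G.Adj v a) ∧ (b = a ∨ G.Adj a b) ∧ (w = b ∨ G.Adj b w)}

theorem colOn_ball {τ : ℕ} (hB : ∀ v, ColOn G (ballThree G v) τ) (x : V) :
    ColOn G {w | w = x ∨ G.Adj x w} τ :=
  (hB x).mono (fun _ hw => ⟨x, x, Or.inl rfl, Or.inl rfl, hw⟩) le_rfl

theorem colOn_nbhd {τ : ℕ} (hB : ∀ v, ColOn G (ballThree G v) τ) (x : V) :
    ColOn G {w | G.Adj x w} τ :=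
  (colOn_ball hB x).mono (fun _ hw => Or.inr hw) le_rfl

theorem colOn_second_nbhd {τ : ℕ} (hB : ∀ v, ColOn G (ballThree G v) τ) (x : V) :
    ColOn G {w | ∃ y, G.Adj y x ∧ G.Adj y w} τ :=
  (hB x).mono (fun _ ⟨y, hy, hw⟩ => ⟨x, y, Or.inl rfl, Or.inr hy.symm, Or.inr hw⟩) le_rfl

/-- Every `y ∈ Y` comes with an induced path `leg y` from `ro` to `y` that avoids `C` and of which
only `y` may have neighbours in `C`; the vertices dominated by those `y` whose leg comes close to
a given member of `Y` can be coloured with `τ` colours. -/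
def IsShower (G : SimpleGraph V) (τ : ℕ) (ro : V) (leg : V → List V) (Y C : Set V) : Prop :=
  (∀ y ∈ Y, IsIP G (leg y) ∧ (leg y).head? = some ro ∧ (leg y).getLast? = some y ∧
    ∀ v ∈ leg y, v ∉ C ∧ (v ≠ y → ∀ x ∈ C, ¬ G.Adj v x)) ∧
  ∀ p ∈ Y, ColOn G {w | ∃ y ∈ Y, G.Adj y w ∧ ∃ v ∈ leg y, v = p ∨ G.Adj v p} τ

theorem IsShower.mono {τ : ℕ} {ro : V} {leg : V → List V} {Y C Y' C' : Set V}
    (h : IsShower G τ ro leg Y C) (hY : Y' ⊆ Y) (hC : C' ⊆ C) : IsShower G τ ro leg Y' C' := by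
  refine ⟨fun y hy => ?_, fun p hp => (h.2 p (hY hp)).mono ?_ le_rfl⟩
  · obtain ⟨h1, h2, h3, h4⟩ := h.1 y (hY hy)
    exact ⟨h1, h2, h3, fun v hv => ⟨fun hvC => (h4 v hv).1 (hC hvC),
      fun hne x hx => (h4 v hv).2 hne x (hC hx)⟩⟩
  · rintro w ⟨y, hy, hw⟩
    exact ⟨y, hY hy, hw⟩

theorem IsShower.mem_leg {τ : ℕ} {ro : V} {leg : V → List V} {Y C : Set V}
    (h : IsShower G τ ro leg Y C) {y : V} (hy : y ∈ Y) : y ∈ leg y :=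
  List.mem_of_getLast? (h.1 y hy).2.2.1

theorem IsShower.notMem {τ : ℕ} {ro : V} {leg : V → List V} {Y C : Set V}
    (h : IsShower G τ ro leg Y C) {y v : V} (hy : y ∈ Y) (hv : v ∈ leg y) : v ∉ C :=
  ((h.1 y hy).2.2.2 v hv).1

theorem IsShower.eq_of_adj {τ : ℕ} {ro : V} {leg : V → List V} {Y C : Set V}
    (h : IsShower G τ ro leg Y C) {y v x : V} (hy : y ∈ Y) (hv : v ∈ leg y) (hx : x ∈ C)
    (hvx : G.Adj v x) : v = y := by
  by_contra hne
  exact ((h.1 y hy).2.2.2 v hv).2 hne x hx hvx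

/-- `P` is an induced path from `ro` to `t` in the shower that leaves a subset of `C` of chromatic
number more than `d` untouched. -/
def IsJet (G : SimpleGraph V) (d : ℕ) (ro : V) (leg : V → List V) (Y C : Set V) (t : V)
    (P : List V) : Prop :=
  IsIP G P ∧ P.head? = some ro ∧ P.getLast? = some t ∧
    (∀ v ∈ P, v ∈ C ∨ ∃ y ∈ Y, v ∈ leg y) ∧
    ∃ Z ⊆ C, ¬ ColOn G Z d ∧ ∀ z ∈ Z, ∀ v ∈ P, v ≠ z ∧ ¬ G.Adj v z

/-- There are jets in the shower whose lengths cover `m + 1` consecutive residues modulo `ℓ`. -/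
def HasJets (G : SimpleGraph V) (ℓ d : ℕ) (ro : V) (leg : V → List V) (Y C : Set V) (t : V)
    (m : ℕ) : Prop :=
  ∃ e, ∀ i ≤ m, ∃ P, IsJet G d ro leg Y C t P ∧ P.length ≡ e + i [MOD ℓ]

theorem HasJets.mono {ℓ d : ℕ} {ro : V} {leg : V → List V} {Y C Y' : Set V} {t : V} {m : ℕ}
    (h : HasJets G ℓ d ro leg Y' C t m) (hY : Y' ⊆ Y) : HasJets G ℓ d ro leg Y C t m := by
  obtain ⟨e, he⟩ := h
  refine ⟨e, fun i hi => ?_⟩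
  obtain ⟨P, ⟨h1, h2, h3, h4, h5⟩, h6⟩ := he i hi
  exact ⟨P, ⟨h1, h2, h3, fun v hv => (h4 v hv).imp_right fun ⟨y, hy, hvy⟩ => ⟨y, hY hy, hvy⟩, h5⟩,
    h6⟩

theorem hasJets_zero {ℓ d τ : ℕ} {ro : V} {leg : V → List V} {Y C : Set V} {t : V}
    (hB : ∀ v, ColOn G (ballThree G v) τ) (hS : IsShower G τ ro leg Y C) (hC : ConnOn G C)
    (ht : t ∈ C) (hX : ¬ ColOn G {w | w ∈ C ∧ ∃ y ∈ Y, G.Adj y w} ((τ + τ + τ) * 2 + τ + d)) :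
    HasJets G ℓ d ro leg Y C t 0 := by
  obtain ⟨δ, h0, hlip, hpar⟩ := hC.exists_levels ht
  obtain ⟨w, ⟨hwC, y, hy, hyw⟩, hmin⟩ :
      ∃ w ∈ {w | w ∈ C ∧ ∃ y ∈ Y, G.Adj y w}, ∀ v ∈ {w | w ∈ C ∧ ∃ y ∈ Y, G.Adj y w}, δ w ≤ δ v :=
    ⟨_, Function.argminOn_mem δ _ (nonempty_of_not_colOn hX),
      fun v hv => Function.argminOn_le δ _ hv⟩
  obtain ⟨l, hl, hlC, hlt⟩ := exists_desc h0 hpar _ w hwC rfl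
  obtain ⟨hy1, hy2, hy3, -⟩ := hS.1 y hy
  refine ⟨(leg y ++ w :: l).length, fun i hi => ⟨leg y ++ w :: l, ⟨?_, ?_, ?_, ?_, ?_⟩, ?_⟩⟩
  · refine hy1.append (hl.isIP hlip hlC) hy3 rfl hyw fun x hx u hu => ⟨?_, fun hxu => ?_⟩
    · rintro rfl
      exact hS.notMem hy hx (hlC _ hu)
    · obtain rfl := hS.eq_of_adj hy hx (hlC _ hu) hxu
      refine ⟨rfl, ?_⟩
      rcases List.mem_cons.1 hu with e | hu'
      · exact e
      · have h1 := hl.lt u hu'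
        have h2 := hmin u ⟨hlC u hu, _, hy, hxu⟩
        omega
  · simp [List.head?_append, hy2]
  · simp only [List.getLast?_append, hlt, Option.some_or]
  · intro v hv
    rcases List.mem_append.1 hv with hv | hv
    · exact Or.inr ⟨y, hy, hv⟩
    · exact Or.inl (hlC v hv)
  · refine ⟨{v | v ∈ C ∧ ¬ (∃ x ∈ w :: l, v = x ∨ G.Adj x v) ∧ ¬ G.Adj y v}, fun v hv => hv.1,
      fun hcol => hX ?_, ?_⟩
    · refine (((hl.colOn_nbhd hlC hlip (colOn_ball hB)).union (colOn_nbhd hB y)).union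
        hcol).mono (fun v hv => ?_) le_rfl
      by_cases h1 : ∃ x ∈ w :: l, v = x ∨ G.Adj x v
      · exact Or.inl (Or.inl ⟨hv.1, h1⟩)
      · by_cases h2 : G.Adj y v
        · exact Or.inl (Or.inr h2)
        · exact Or.inr ⟨hv.1, h1, h2⟩
    · rintro z ⟨hzC, hz1, hz2⟩ v hv
      rcases List.mem_append.1 hv with hv | hv
      · refine ⟨?_, fun hvz => ?_⟩
        · rintro rfl
          exact hS.notMem hy hv hzC
        · obtain rfl := hS.eq_of_adj hy hv hzC hvz
          exact hz2 hvz
      · push Not at hz1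
        exact ⟨(hz1 v hv).1.symm, (hz1 v hv).2⟩
  · rw [Nat.le_zero.1 hi]
    rfl

/-- `Q` is an induced path from `b` to `t` that can be appended to each jet ending in `k` of the
shower on `Y'` and `C'`. -/
def IsTail (G : SimpleGraph V) (leg : V → List V) (Y C Y' C' : Set V) (k b t : V)
    (Q : List V) : Prop :=
  IsIP G Q ∧ Q.head? = some b ∧ Q.getLast? = some t ∧ (∀ v ∈ Q, v ∈ C ∨ ∃ y ∈ Y, v ∈ leg y) ∧
    ∀ x ∈ Q, ∀ w, (w ∈ C' ∨ ∃ y ∈ Y', w ∈ leg y) → w ≠ x ∧ (G.Adj w x → w = k ∧ x = b)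

theorem IsJet.append {d : ℕ} {ro : V} {leg : V → List V} {Y C Y' C' : Set V} {k b t : V}
    {P Q : List V} (hP : IsJet G d ro leg Y' C' k P) (hY : Y' ⊆ Y) (hC : C' ⊆ C)
    (hQ : IsTail G leg Y C Y' C' k b t Q) (hkb : G.Adj k b) :
    IsJet G d ro leg Y C t (P ++ Q) := by
  obtain ⟨h1, h2, h3, h4, Z, hZ, hZd, hZP⟩ := hP
  obtain ⟨q1, q2, q3, q4, q5⟩ := hQ
  refine ⟨h1.append q1 h3 q2 hkb fun x hx y hy => q5 y hy x (h4 x hx), ?_, ?_, ?_, Z,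
    hZ.trans hC, hZd, ?_⟩
  · simp [List.head?_append, h2]
  · simp only [List.getLast?_append, q3, Option.some_or]
  · intro v hv
    rcases List.mem_append.1 hv with hv | hv
    · exact (h4 v hv).imp (fun h => hC h) fun ⟨y, hy, hvy⟩ => ⟨y, hY hy, hvy⟩
    · exact q4 v hv
  · intro z hz v hv
    rcases List.mem_append.1 hv with hv | hv
    · exact hZP z hz v hv
    · obtain ⟨e1, e2⟩ := q5 v hv z (Or.inl (hZ hz))
      exact ⟨e1.symm, fun h => (hZP z hz k (List.mem_of_getLast? h3)).1 (e2 h.symm).1.symm⟩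

theorem HasJets.succ {ℓ d : ℕ} {ro : V} {leg : V → List V} {Y C Y' C' : Set V} {k b₁ b₂ t : V}
    {m : ℕ} {Q₁ Q₂ : List V} (h : HasJets G ℓ d ro leg Y' C' k m) (hY : Y' ⊆ Y) (hC : C' ⊆ C)
    (h₁ : IsTail G leg Y C Y' C' k b₁ t Q₁) (hb₁ : G.Adj k b₁)
    (h₂ : IsTail G leg Y C Y' C' k b₂ t Q₂) (hb₂ : G.Adj k b₂)
    (hlen : Q₂.length ≡ Q₁.length + 1 [MOD ℓ]) : HasJets G ℓ d ro leg Y C t (m + 1) := by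
  obtain ⟨e, he⟩ := h
  refine ⟨e + Q₁.length, fun i hi => ?_⟩
  rcases Nat.lt_or_ge m i with him | him
  · obtain rfl : i = m + 1 := by omega
    obtain ⟨P, hP, hl⟩ := he m le_rfl
    refine ⟨P ++ Q₂, hP.append hY hC h₂ hb₂, ?_⟩
    rw [List.length_append, show e + Q₁.length + (m + 1) = (e + m) + (Q₁.length + 1) by ring]
    exact hl.add hlen
  · obtain ⟨P, hP, hl⟩ := he i him
    refine ⟨P ++ Q₁, hP.append hY hC h₁ hb₁, ?_⟩
    rw [List.length_append, show e + Q₁.length + i = (e + i) + Q₁.length by ring]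
    exact hl.add_right _

end Showers

section Steps

variable {V : Type*} {G : SimpleGraph V}

/-- Every shower in which `Y` dominates a subset of `C` that is not `c`-colourable has jets whose
lengths cover `m + 1` consecutive residues modulo `ℓ`. -/
def ForcesJets (G : SimpleGraph V) (τ ℓ d : ℕ) (ro : V) (leg : V → List V) (m c : ℕ) : Prop :=
  ∀ (Y C : Set V) (t : V), IsShower G τ ro leg Y C → ConnOn G C → t ∈ C →
    ¬ ColOn G {w | w ∈ C ∧ ∃ y ∈ Y, G.Adj y w} c → HasJets G ℓ d ro leg Y C t m

/-- The number of colours that `exists_gadget` requires. -/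
def gadgetBound (τ c : ℕ) : ℕ := (τ + (c + τ)) + τ * τ

/-- The number of colours that `hasJets_of_touching` requires. -/
def touchBound (τ ℓ c : ℕ) : ℕ := (τ + τ + τ) * 2 + gadgetBound τ (c + (τ + τ + τ)) * ℓ

theorem hasJets_of_touching [Fintype V] {ℓ d τ m c : ℕ} {ro : V} {leg : V → List V}
    {Y C X : Set V} {t : V} {δ : V → ℕ} {π : List V} (hℓ : 0 < ℓ)
    (hB : ∀ v, ColOn G (ballThree G v) τ)
    (hclq : ∀ S : Set V, ¬ ColOn G S τ →
      ∃ K : Finset V, ↑K ⊆ S ∧ G.IsClique K ∧ ∀ p, ∃ k ∈ K, ¬ G.Adj p k)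
    (hJ : ForcesJets G τ ℓ d ro leg m c) (hS : IsShower G τ ro leg Y C)
    (hlip : ∀ u ∈ C, ∀ v ∈ C, G.Adj u v → δ v ≤ δ u + 1) (hπ : Desc G δ π)
    (hπC : ∀ x ∈ π, x ∈ C) (hπt : π.getLast? = some t) (hXC : X ⊆ C)
    (hXY : ∀ w ∈ X, ∃ y ∈ Y, G.Adj y w)
    (htouch : ∀ w ∈ X, ∀ y ∈ Y, G.Adj y w → ∃ x ∈ π, G.Adj y x)
    (hcol : ¬ ColOn G X (touchBound τ ℓ c)) : HasJets G ℓ d ro leg Y C t (m + 1) := by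
  classical
  set X₁ : Set V := {v | v ∈ X ∧ ¬ ∃ x ∈ π, v = x ∨ G.Adj x v} with hX₁
  have hX₁col : ¬ ColOn G X₁ (gadgetBound τ (c + (τ + τ + τ)) * ℓ) := by
    intro h
    refine hcol (((hπ.colOn_nbhd hπC hlip (colOn_ball hB)).union h).mono (fun v hv => ?_) le_rfl)
    by_cases h1 : ∃ x ∈ π, v = x ∨ G.Adj x v
    · exact Or.inl ⟨hXC hv, h1⟩
    · exact Or.inr ⟨hv, h1⟩
  set b : V → ℕ := fun y => sInf {i | ∃ x ∈ π, G.Adj y x ∧ δ x = i} with hb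
  have hb1 : ∀ y, (∃ x ∈ π, G.Adj y x) → ∃ x ∈ π, G.Adj y x ∧ δ x = b y := by
    rintro y ⟨x, hx, hyx⟩
    exact Nat.sInf_mem (s := {i | ∃ x ∈ π, G.Adj y x ∧ δ x = i}) ⟨_, x, hx, hyx, rfl⟩
  have hb2 : ∀ y, ∀ x ∈ π, G.Adj y x → b y ≤ δ x := fun y x hx hyx =>
    Nat.sInf_le ⟨x, hx, hyx, rfl⟩
  choose! par hpar1 hpar2 using hXY
  have hres : ∃ ρ < ℓ, ¬ ColOn G {w | w ∈ X₁ ∧ b (par w) % ℓ = ρ}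
      (gadgetBound τ (c + (τ + τ + τ))) := by
    by_contra hcon
    push Not at hcon
    exact hX₁col (colOn_mul _ (fun v _ => Nat.mod_lt _ hℓ) hcon)
  obtain ⟨ρ, -, hρ⟩ := hres
  set N : Set V := {y | y ∈ Y ∧ (∃ x ∈ π, G.Adj y x) ∧ b y % ℓ = ρ} with hN
  set R := Finset.univ.sup δ with hR
  have hbR : ∀ y ∈ N, b y ≤ R := by
    rintro y ⟨-, hy, -⟩
    obtain ⟨x, -, -, hx⟩ := hb1 y hy
    exact hx ▸ Finset.le_sup (Finset.mem_univ x)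
  obtain ⟨F, hFX, hFconn, hFcol, k, hk, k', hk', hkF, hk'F, hkk', hkx, hk'a, p, hp, p', hp', hpk,
      hpk', hp'k, hlate⟩ := exists_gadget (a := fun y => R - b y) (N := N) (colOn_nbhd hB) hclq
    (fun w hw => ⟨par w, ⟨hpar1 w hw.1.1,
      htouch w hw.1.1 _ (hpar1 w hw.1.1) (hpar2 w hw.1.1), hw.2⟩, hpar2 w hw.1.1⟩)
    (fun i => by
      by_cases hi : ∃ x ∈ π, R - δ x = i ∧ δ x ≤ R
      · obtain ⟨x, hx, rfl, hxR⟩ := hi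
        refine (colOn_second_nbhd hB x).mono ?_ le_rfl
        rintro w ⟨q, hq, e, hqw⟩
        obtain ⟨x', hx', hqx', e'⟩ := hb1 q hq.2.1
        have := hbR q hq
        obtain rfl := hπ.inj x' hx' x hx (by omega)
        exact ⟨q, hqx', hqw⟩
      · refine (colOn_empty τ).mono ?_ le_rfl
        rintro w ⟨q, hq, rfl, -⟩
        obtain ⟨x', hx', -, e'⟩ := hb1 q hq.2.1
        have := hbR q hq
        exact hi ⟨x', hx', by omega, by omega⟩) hρ
  have hlate' : ∀ x ∈ F, ∀ q ∈ N, G.Adj q x → b p < b q ∧ b p' < b q := fun x hx q hq hqx => by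
    have := hlate x hx q hq hqx
    have := hbR q hq
    omega
  have htail : ∀ q ∈ N, ∃ l, IsIP G (q :: l) ∧ (q :: l).getLast? = some t ∧
      (∀ u ∈ l, u ∈ π ∧ δ u ≤ b q) ∧ l.length = b q + 1 := by
    rintro q ⟨hqY, hq, -⟩
    obtain ⟨x, hx, hqx, hxb⟩ := hb1 q hq
    obtain ⟨l₁, l₂, rfl⟩ := List.append_of_mem hx
    have hd := hπ.of_append
    refine ⟨x :: l₂, ?_, ?_, ?_, ?_⟩
    · have hip : IsIP G (x :: l₂) := hd.isIP hlip fun u hu => hπC u (List.mem_append_right _ hu)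
      refine isIP_cons hip rfl hqx (fun u hu => ⟨?_, fun hqu => ?_⟩) hip.nodup
      · rintro rfl
        exact hS.notMem hqY (hS.mem_leg hqY) (hπC _ (List.mem_append_right _ hu))
      · rcases List.mem_cons.1 hu with e | hu'
        · exact e
        · have := hd.lt u hu'
          have := hb2 q u (List.mem_append_right _ hu) hqu
          omega
    · simpa [List.getLast?_append] using hπt
    · intro u hu
      refine ⟨List.mem_append_right _ hu, ?_⟩
      rcases List.mem_cons.1 hu with rfl | hu'
      · exact hxb.le
      · have := hd.lt u hu'
        omega
    · rw [List.length_cons, hd.length, hxb]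
  set Y' : Set V := {y | y ∈ N ∧ b p < b y ∧ b p' < b y ∧
    (∀ v ∈ leg y, v ≠ p ∧ ¬ G.Adj v p) ∧ (∀ v ∈ leg y, v ≠ p' ∧ ¬ G.Adj v p') ∧
    ¬ G.Adj y k'} with hY'
  have hY'Y : Y' ⊆ Y := fun y hy => hy.1.1
  have hC' : insert k F ⊆ C := Set.insert_subset (hXC hk.1.1) fun x hx => hXC (hFX hx).1.1
  have hnear : ∀ w ∈ insert k F, ∀ u ∈ π, w ≠ u ∧ ¬ G.Adj w u := by
    have h1 : insert k F ⊆ X₁ := Set.insert_subset hk.1 fun x hx => (hFX hx).1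
    intro w hw u hu
    have h2 := (h1 hw).2
    push Not at h2
    exact ⟨(h2 u hu).1, fun h => (h2 u hu).2 h.symm⟩
  have hsub : HasJets G ℓ d ro leg Y' (insert k F) k m := by
    obtain ⟨x, hx, hkx⟩ := hkx
    refine hJ Y' _ k (hS.mono hY'Y hC') (connOn_insert hFconn hx hkx) (Set.mem_insert _ _) ?_
    intro h
    refine hFcol ((h.union (((hS.2 p hp.1).union (hS.2 p' hp'.1)).union
      (colOn_second_nbhd hB k'))).mono (fun w hw => ?_) le_rfl)
    have hwX := hFX hw
    have hpw := hpar1 w hwX.1.1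
    have hpw2 := hpar2 w hwX.1.1
    have hpN : par w ∈ N := ⟨hpw, htouch w hwX.1.1 _ hpw hpw2, hwX.2⟩
    by_cases h1 : ∃ v ∈ leg (par w), v = p ∨ G.Adj v p
    · exact Or.inr (Or.inl (Or.inl ⟨_, hpw, hpw2, h1⟩))
    by_cases h2 : ∃ v ∈ leg (par w), v = p' ∨ G.Adj v p'
    · exact Or.inr (Or.inl (Or.inr ⟨_, hpw, hpw2, h2⟩))
    by_cases h3 : G.Adj (par w) k'
    · exact Or.inr (Or.inr ⟨_, h3, hpw2⟩)
    push Not at h1 h2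
    obtain ⟨h4, h5⟩ := hlate' w hw _ hpN hpw2
    exact Or.inl ⟨Or.inr hw, _, ⟨hpN, h4, h5, h1, h2, h3⟩, hpw2⟩
  obtain ⟨l, hl1, hl2, hl3, hl4⟩ := htail p hp
  obtain ⟨l', hl'1, hl'2, hl'3, hl'4⟩ := htail p' hp'
  have hpC : p ∉ C := hS.notMem hp.1 (hS.mem_leg hp.1)
  have hp'C : p' ∉ C := hS.notMem hp'.1 (hS.mem_leg hp'.1)
  have hcross : ∀ u ∈ π, (δ u ≤ b p ∨ δ u ≤ b p') →
      ∀ w, (w ∈ insert k F ∨ ∃ y ∈ Y', w ∈ leg y) → w ≠ u ∧ ¬ G.Adj w u := by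
    rintro u hu hub w (hw | ⟨y, hy, hw⟩)
    · exact hnear w hw u hu
    · refine ⟨?_, fun hwu => ?_⟩
      · rintro rfl
        exact hS.notMem hy.1.1 hw (hπC _ hu)
      · obtain rfl := hS.eq_of_adj hy.1.1 hw (hπC _ hu) hwu
        have := hb2 w u hu hwu
        have := hy.2.1
        have := hy.2.2.1
        omega
  have hlk' : ∀ u ∈ p' :: l', k' ≠ u ∧ (G.Adj k' u → u = p') := by
    intro u hu
    rcases List.mem_cons.1 hu with rfl | hu
    · exact ⟨fun e => hp'C (e ▸ hXC hk'.1.1), fun _ => rfl⟩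
    · have h2 := hk'.1.2
      push Not at h2
      obtain ⟨h3, h4⟩ := h2 u (hl'3 u hu).1
      exact ⟨h3, fun h => absurd h.symm h4⟩
  refine hsub.succ (Q₁ := p :: l) (Q₂ := k' :: p' :: l') hY'Y hC'
    ⟨hl1, rfl, hl2, ?_, ?_⟩ hpk.symm
    ⟨isIP_cons hl'1 rfl hpk'.symm hlk' hl'1.nodup, rfl, by simpa using hl'2, ?_, ?_⟩ hkk' ?_
  · intro v hv
    rcases List.mem_cons.1 hv with rfl | hv
    · exact Or.inr ⟨v, hp.1, hS.mem_leg hp.1⟩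
    · exact Or.inl (hπC v (hl3 v hv).1)
  · intro u hu w hw
    rcases List.mem_cons.1 hu with rfl | hu
    · rcases hw with (rfl | hw) | ⟨y, hy, hw⟩
      · exact ⟨fun e => hpC (e ▸ hXC hk.1.1), fun _ => ⟨rfl, rfl⟩⟩
      · exact ⟨fun e => hpC (e ▸ hC' (Or.inr hw)),
          fun h => absurd (hlate' w hw u hp h.symm).1 (lt_irrefl _)⟩
      · exact ⟨(hy.2.2.2.1 w hw).1, fun h => absurd h (hy.2.2.2.1 w hw).2⟩
    · obtain ⟨h1, h2⟩ := hcross u (hl3 u hu).1 (Or.inl (hl3 u hu).2) w hw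
      exact ⟨h1, fun h => absurd h h2⟩
  · intro v hv
    rcases List.mem_cons.1 hv with rfl | hv
    · exact Or.inl (hXC hk'.1.1)
    rcases List.mem_cons.1 hv with rfl | hv
    · exact Or.inr ⟨v, hp'.1, hS.mem_leg hp'.1⟩
    · exact Or.inl (hπC v (hl'3 v hv).1)
  · intro u hu w hw
    rcases List.mem_cons.1 hu with rfl | hu
    · rcases hw with (rfl | hw) | ⟨y, hy, hw⟩
      · exact ⟨hkk'.ne, fun _ => ⟨rfl, rfl⟩⟩
      · exact ⟨fun e => hk'F (e ▸ hw), fun h => absurd h.symm (hk'a w hw)⟩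
      · refine ⟨fun e => hS.notMem hy.1.1 hw (e ▸ hXC hk'.1.1), fun h => ?_⟩
        obtain rfl := hS.eq_of_adj hy.1.1 hw (hXC hk'.1.1) h
        exact absurd h hy.2.2.2.2.2
    rcases List.mem_cons.1 hu with rfl | hu
    · rcases hw with (rfl | hw) | ⟨y, hy, hw⟩
      · exact ⟨fun e => hp'C (e ▸ hXC hk.1.1), fun h => absurd h.symm hp'k⟩
      · exact ⟨fun e => hp'C (e ▸ hC' (Or.inr hw)),
          fun h => absurd (hlate' w hw u hp' h.symm).2 (lt_irrefl _)⟩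
      · exact ⟨(hy.2.2.2.2.1 w hw).1, fun h => absurd h (hy.2.2.2.2.1 w hw).2⟩
    · obtain ⟨h1, h2⟩ := hcross u (hl'3 u hu).1 (Or.inr (hl'3 u hu).2) w hw
      exact ⟨h1, fun h => absurd h h2⟩
  · have e : b p' ≡ b p [MOD ℓ] := hp'.2.2.trans hp.2.2.symm
    simp only [List.length_cons, hl4, hl'4]
    exact e.add_right 3

/-- The number of colours that `ForcesJets.succ` requires. -/
def stepBound (τ ℓ c : ℕ) : ℕ :=
  gadgetBound τ (touchBound τ ℓ c + touchBound τ ℓ c + c) * 2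

theorem ForcesJets.succ [Fintype V] {ℓ d τ m c : ℕ} {ro : V} {leg : V → List V} (hℓ : 0 < ℓ)
    (hB : ∀ v, ColOn G (ballThree G v) τ)
    (hclq : ∀ S : Set V, ¬ ColOn G S τ →
      ∃ K : Finset V, ↑K ⊆ S ∧ G.IsClique K ∧ ∀ p, ∃ k ∈ K, ¬ G.Adj p k)
    (hJ : ForcesJets G τ ℓ d ro leg m c) :
    ForcesJets G τ ℓ d ro leg (m + 1) (stepBound τ ℓ c) := by
  intro Y C t hS hC ht hX
  obtain ⟨δ, h0, hlip, hpar⟩ := hC.exists_levels ht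
  have hlev : ∃ j, ¬ ColOn G {v | v ∈ {w | w ∈ C ∧ ∃ y ∈ Y, G.Adj y w} ∧ δ v = j}
      (gadgetBound τ (touchBound τ ℓ c + touchBound τ ℓ c + c)) := by
    by_contra hcon
    push Not at hcon
    exact hX (colOn_levels δ (fun u hu v hv => hlip u hu.1 v hv.1) hcon)
  obtain ⟨j, hj⟩ := hlev
  cases j with
  | zero =>
    refine absurd ((colOn_ball hB t).mono ?_ ?_) hj
    · rintro v ⟨⟨hv, -⟩, hv0⟩
      exact Or.inl (h0 v hv hv0)
    · unfold gadgetBound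
      omega
  | succ j =>
  obtain ⟨F, hFX, hFconn, hFcol, k, hk, k', hk', hkF, hk'F, hkk', hkx, hk'a, p, hp, p', hp', hpk,
      hpk', hp'k, hlate⟩ := exists_gadget (a := fun v => (Fintype.equivFin V v : ℕ))
    (N := {v | v ∈ C ∧ δ v = j}) (colOn_nbhd hB) hclq
    (fun w hw => by
      obtain ⟨u, hu, hwu, huj⟩ := hpar w hw.1.1 j hw.2
      exact ⟨u, ⟨hu, huj⟩, hwu.symm⟩)
    (fun i => by
      by_cases hi : ∃ q, (Fintype.equivFin V q : ℕ) = i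
      · obtain ⟨q, rfl⟩ := hi
        refine (colOn_nbhd hB q).mono ?_ le_rfl
        rintro w ⟨q', -, e, hqw⟩
        obtain rfl := (Fintype.equivFin V).injective (Fin.ext e)
        exact hqw
      · refine (colOn_empty τ).mono ?_ le_rfl
        rintro w ⟨q, -, e, -⟩
        exact hi ⟨q, e⟩) hj
  obtain ⟨l, hl, hlC, hlt⟩ := exists_desc h0 hpar _ p hp.1 rfl
  obtain ⟨l', hl', hl'C, hl't⟩ := exists_desc h0 hpar _ p' hp'.1 rfl
  have hπ₁ : Desc G δ (k :: p :: l) := ⟨hpk.symm, by rw [hk.2, hp.2], hl⟩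
  have hπ₂ : Desc G δ (k' :: p' :: l') := ⟨hpk'.symm, by rw [hk'.2, hp'.2], hl'⟩
  have hπ₁C : ∀ x ∈ k :: p :: l, x ∈ C := List.forall_mem_cons.2 ⟨hk.1.1, hlC⟩
  have hπ₂C : ∀ x ∈ k' :: p' :: l', x ∈ C := List.forall_mem_cons.2 ⟨hk'.1.1, hl'C⟩
  have hFC : F ⊆ C := fun x hx => (hFX hx).1.1
  set Y₁ : Set V := {y | y ∈ Y ∧ ∀ x ∈ k :: p :: l, ¬ G.Adj y x} with hY₁
  set Y₂ : Set V := {y | y ∈ Y₁ ∧ ∀ x ∈ k' :: p' :: l', ¬ G.Adj y x} with hY₂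
  have hY₁Y : Y₁ ⊆ Y := fun y hy => hy.1
  have hY₂Y : Y₂ ⊆ Y := fun y hy => hy.1.1
  by_cases hA₁ : ColOn G {w | w ∈ F ∧ ¬ ∃ y ∈ Y₁, G.Adj y w} (touchBound τ ℓ c)
  swap
  · refine hasJets_of_touching hℓ hB hclq hJ hS hlip hπ₁ hπ₁C (by simpa using hlt)
      (fun w hw => hFC hw.1) (fun w hw => (hFX hw.1).1.2) (fun w hw y hy hyw => ?_) hA₁
    by_contra hcon
    push Not at hcon
    exact hw.2 ⟨y, ⟨hy, hcon⟩, hyw⟩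
  by_cases hA₂ : ColOn G {w | (w ∈ F ∧ ∃ y ∈ Y₁, G.Adj y w) ∧ ¬ ∃ y ∈ Y₂, G.Adj y w}
      (touchBound τ ℓ c)
  swap
  · refine (hasJets_of_touching hℓ hB hclq hJ (hS.mono hY₁Y subset_rfl) hlip hπ₂ hπ₂C
      (by simpa using hl't) (fun w hw => hFC hw.1.1) (fun w hw => hw.1.2)
      (fun w hw y hy hyw => ?_) hA₂).mono hY₁Y
    by_contra hcon
    push Not at hcon
    exact hw.2 ⟨y, ⟨hy, hcon⟩, hyw⟩
  have hC' : insert k F ⊆ C := Set.insert_subset hk.1.1 hFC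
  have hsub : HasJets G ℓ d ro leg Y₂ (insert k F) k m := by
    obtain ⟨x, hx, hkx⟩ := hkx
    refine hJ Y₂ _ k (hS.mono hY₂Y hC') (connOn_insert hFconn hx hkx) (Set.mem_insert _ _) ?_
    intro h
    refine hFcol (((hA₁.union hA₂).union h).mono (fun w hw => ?_) le_rfl)
    by_cases h1 : ∃ y ∈ Y₁, G.Adj y w
    · by_cases h2 : ∃ y ∈ Y₂, G.Adj y w
      · exact Or.inr ⟨Or.inr hw, h2⟩
      · exact Or.inl (Or.inr ⟨⟨hw, h1⟩, h2⟩)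
    · exact Or.inl (Or.inl ⟨hw, h1⟩)
  have hlow : ∀ q r, Desc G δ (q :: r) → δ q = j → (∀ u ∈ q :: r, u ∈ C) → ∀ u ∈ q :: r,
      ∀ w ∈ C, δ w = j + 1 → w ≠ u ∧ (G.Adj w u → u = q) := by
    intro q r hd hq hqC u hu w hw hwj
    have hcase : u = q ∨ δ u < j := by
      rcases List.mem_cons.1 hu with e | hu
      · exact Or.inl e
      · exact Or.inr (hq ▸ hd.lt u hu)
    refine ⟨?_, fun hwu => ?_⟩
    · rintro rfl
      rcases hcase with rfl | h <;> omega
    · have := hlip u (hqC u hu) w hw hwu.symm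
      exact hcase.resolve_right (by omega)
  have hleg : ∀ u ∈ C, (u ∈ k :: p :: l ∨ u ∈ k' :: p' :: l') → ∀ w, (∃ y ∈ Y₂, w ∈ leg y) →
      w ≠ u ∧ ¬ G.Adj w u := by
    rintro u huC hu w ⟨y, hy, hw⟩
    refine ⟨?_, fun hwu => ?_⟩
    · rintro rfl
      exact hS.notMem (hY₂Y hy) hw huC
    · obtain rfl := hS.eq_of_adj (hY₂Y hy) hw huC hwu
      exact hu.elim (fun h => hy.1.2 u h hwu) fun h => hy.2 u h hwu
  have hanti : ∀ q, q = p ∨ q = p' → δ q = j → q ∈ C → ∀ w ∈ F, ¬ G.Adj q w := by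
    rintro q hq hqj hqC w hw hqw
    have := hlate w hw q ⟨hqC, hqj⟩ hqw
    rcases hq with rfl | rfl <;> omega
  refine hsub.succ (Q₁ := p :: l) (Q₂ := k' :: p' :: l') hY₂Y hC'
    ⟨hl.isIP hlip hlC, rfl, hlt, fun v hv => Or.inl (hlC v hv), ?_⟩ hpk.symm
    ⟨hπ₂.isIP hlip hπ₂C, rfl, by simpa using hl't, fun v hv => Or.inl (hπ₂C v hv), ?_⟩ hkk' ?_
  · rintro u hu w ((rfl | hw) | hw)
    · obtain ⟨h1, h2⟩ := hlow p l hl hp.2 hlC u hu w hk.1.1 hk.2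
      exact ⟨h1, fun h => ⟨rfl, h2 h⟩⟩
    · obtain ⟨h1, h2⟩ := hlow p l hl hp.2 hlC u hu w (hFC hw) (hFX hw).2
      refine ⟨h1, fun h => ?_⟩
      obtain rfl := h2 h
      exact absurd h.symm (hanti u (Or.inl rfl) hp.2 hp.1 w hw)
    · obtain ⟨h1, h2⟩ := hleg u (hlC u hu) (Or.inl (List.mem_cons_of_mem _ hu)) w hw
      exact ⟨h1, fun h => absurd h h2⟩
  · rintro u hu w ((rfl | hw) | hw)
    · rcases List.mem_cons.1 hu with rfl | hu
      · exact ⟨hkk'.ne, fun _ => ⟨rfl, rfl⟩⟩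
      · obtain ⟨h1, h2⟩ := hlow p' l' hl' hp'.2 hl'C u hu w hk.1.1 hk.2
        refine ⟨h1, fun h => ?_⟩
        obtain rfl := h2 h
        exact absurd h.symm hp'k
    · rcases List.mem_cons.1 hu with rfl | hu
      · exact ⟨fun e => hk'F (e ▸ hw), fun h => absurd h.symm (hk'a w hw)⟩
      · obtain ⟨h1, h2⟩ := hlow p' l' hl' hp'.2 hl'C u hu w (hFC hw) (hFX hw).2
        refine ⟨h1, fun h => ?_⟩
        obtain rfl := h2 h
        exact absurd h.symm (hanti u (Or.inr rfl) hp'.2 hp'.1 w hw)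
    · obtain ⟨h1, h2⟩ := hleg u (hπ₂C u hu) (Or.inr hu) w hw
      exact ⟨h1, fun h => absurd h h2⟩
  · simp only [List.length_cons, hl.length, hl'.length, hp.2, hp'.2]
    rfl

theorem exists_forcesJets (ℓ d τ : ℕ) (hℓ : 0 < ℓ) (m : ℕ) :
    ∃ c, ∀ (V : Type*) [Fintype V] (G : SimpleGraph V) (ro : V) (leg : V → List V),
      (∀ v, ColOn G (ballThree G v) τ) →
      (∀ S : Set V, ¬ ColOn G S τ →
        ∃ K : Finset V, ↑K ⊆ S ∧ G.IsClique K ∧ ∀ p, ∃ k ∈ K, ¬ G.Adj p k) →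
      ForcesJets G τ ℓ d ro leg m c := by
  induction m with
  | zero =>
    exact ⟨_, fun V _ G ro leg hB _ Y C t hS hC ht hX => hasJets_zero hB hS hC ht hX⟩
  | succ m ih =>
    obtain ⟨c, hc⟩ := ih
    exact ⟨_, fun V _ G ro leg hB hclq => (hc V G ro leg hB hclq).succ hℓ hB hclq⟩

end Steps

section Hole

variable {V : Type*} {G : SimpleGraph V}

theorem IsIP.getElem : ∀ {l : List V}, IsIP G l → ∀ (i j : ℕ) (hij : i < j) (hj : j < l.length),
    l[i] ≠ l[j] ∧ (G.Adj l[i] l[j] ↔ j = i + 1)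
  | [], _, i, j, _, hj => by simp at hj
  | [_], _, i, j, _, hj => by simp at hj; omega
  | a :: b :: l, h, i, 0, hij, hj => by omega
  | a :: b :: l, h, 0, 1, hij, hj => by simp [h.1, h.1.ne]
  | a :: b :: l, h, 0, j + 2, hij, hj => by
    have hj' : j < l.length := by simpa using hj
    have := h.2.1 l[j] (List.getElem_mem hj')
    simp [this]
  | a :: b :: l, h, i + 1, j + 1, hij, hj => by
    have := IsIP.getElem (l := b :: l) h.2.2 i j (by omega) (by simpa using hj)
    simpa using this

theorem IsIP.exists_hole {P : List V} {a b y : V} (hP : IsIP G P) (ha : P.head? = some a)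
    (hb : P.getLast? = some b) (hne : a ≠ b) (hab : ¬ G.Adj a b) (hya : G.Adj y a)
    (hyb : G.Adj y b) (hy : ∀ v ∈ P, y ≠ v ∧ (G.Adj y v → v = a ∨ v = b)) :
    4 ≤ P.length + 1 ∧ ∃ f : cycleGraph (P.length + 1) ↪g G, Set.range f = {v | v ∈ y :: P} := by
  rw [List.head?_eq_getElem?] at ha
  rw [List.getLast?_eq_getElem?] at hb
  obtain ⟨h0, ha⟩ := List.getElem?_eq_some_iff.1 ha
  obtain ⟨h1, hb⟩ := List.getElem?_eq_some_iff.1 hb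
  have hlen : 3 ≤ P.length := by
    by_contra hlt
    rcases (by omega : P.length = 1 ∨ P.length = 2) with e | e
    · exact hne (by rw [← ha, ← hb]; simp [e])
    · refine hab ?_
      have := (hP.getElem 0 1 (by omega) (by omega)).2.2 rfl
      rw [ha] at this
      rw [← hb]
      simpa [e] using this
  have key : ∀ i j : ℕ, ∀ (hij : i < j) (hj : j < (y :: P).length),
      (y :: P)[i] ≠ (y :: P)[j] ∧
        (G.Adj (y :: P)[i] (y :: P)[j] ↔ j = i + 1 ∨ (i = 0 ∧ j = P.length)) := by
    intro i j hij hj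
    obtain ⟨j, rfl⟩ : ∃ j', j = j' + 1 := ⟨j - 1, by omega⟩
    have hj' : j < P.length := by simpa using hj
    cases i with
    | zero =>
      obtain ⟨h2, h3⟩ := hy P[j] (List.getElem_mem hj')
      refine ⟨by simpa using h2, ?_⟩
      simp only [List.getElem_cons_zero, List.getElem_cons_succ, true_and]
      constructor
      · intro h
        rcases h3 h with e | e
        · left
          rw [← ha] at e
          have := (hP.nodup.getElem_inj_iff).1 e
          omega
        · right
          rw [← hb] at e
          have := (hP.nodup.getElem_inj_iff).1 e
          omega
      · rintro (e | e)
        · obtain rfl : j = 0 := by omega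
          rw [ha]
          exact hya
        · obtain rfl : j = P.length - 1 := by omega
          rw [hb]
          exact hyb
    | succ i =>
      have := hP.getElem i j (by omega) hj'
      simp only [List.getElem_cons_succ]
      refine ⟨this.1, this.2.trans ?_⟩
      omega
  have hcyc : ∀ u v : Fin (P.length + 1), u < v →
      ((cycleGraph (P.length + 1)).Adj u v ↔
        (v : ℕ) = u + 1 ∨ ((u : ℕ) = 0 ∧ (v : ℕ) = P.length)) := by
    intro u v huv
    have huv' : (u : ℕ) < v := huv
    have hv := v.isLt
    rw [cycleGraph_adj', Fin.coe_sub_iff_lt.2 huv, Fin.coe_sub_iff_le.2 huv.le]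
    omega
  have hadj : ∀ u v : Fin (P.length + 1),
      G.Adj ((y :: P).get u) ((y :: P).get v) ↔ (cycleGraph (P.length + 1)).Adj u v := by
    intro u v
    rcases lt_trichotomy u v with h | rfl | h
    · exact (key u v h v.isLt).2.trans (hcyc u v h).symm
    · simp
    · rw [G.adj_comm, (cycleGraph _).adj_comm]
      exact (key v u h u.isLt).2.trans (hcyc v u h).symm
  have hinj : Function.Injective (y :: P).get := by
    intro u v huv
    rcases lt_trichotomy u v with h | h | h
    · exact absurd huv (key u v h v.isLt).1
    · exact h
    · exact absurd huv.symm (key v u h u.isLt).1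
  refine ⟨by omega, ⟨⟨(y :: P).get, hinj⟩, hadj _ _⟩, ?_⟩
  ext v
  exact (List.mem_iff_get (l := y :: P)).symm

theorem Desc.reachable {δ : V → ℕ} {W : Set V} {z : V} : ∀ {l : List V}, Desc G δ l →
    (∀ u ∈ l, u ∈ W) → l.getLast? = some z → ∀ u ∈ l, (within G W).Reachable u z
  | [], h, _, _, _, _ => h.elim
  | [x], _, _, hz, u, hu => by
    obtain rfl := List.mem_singleton.1 hu
    obtain rfl : u = z := by simpa using hz
    exact Reachable.refl _
  | x :: y :: l, h, hW, hz, u, hu => by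
    have ih := Desc.reachable h.2.2 (fun v hv => hW v (List.mem_cons_of_mem _ hv))
      (by simpa using hz)
    rcases List.mem_cons.1 hu with rfl | hu
    · have hadj : (within G W).Adj u y := ⟨h.1, hW u (by simp), hW y (by simp)⟩
      exact hadj.reachable.trans (ih y (by simp))
    · exact ih u hu

theorem exists_leg {δ : V → ℕ} {S : Set V} {z : V} (h0 : ∀ v ∈ S, δ v = 0 → v = z)
    (hp : ∀ v ∈ S, ∀ n, δ v = n + 1 → ∃ u ∈ S, G.Adj v u ∧ δ u = n) {j : ℕ} {r y : V}
    (hr : r ∈ S) (hrj : δ r = j) (hy : y ∈ S) (hyj : δ y = j + 1) :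
    ∃ L : List V, IsIP G L ∧ L.head? = some r ∧ L.getLast? = some y ∧
      ∀ v ∈ L, v ∈ S ∧ (v = y ∨ (δ v ≤ j ∧ (G.Adj y v ∨ v = r ∨ δ v < j))) := by
  obtain ⟨l, hl, hlS, hlz⟩ := exists_desc h0 hp j r hr hrj
  obtain ⟨u, hu, hyu, huj⟩ := hp y hy j hyj
  obtain ⟨l', hl', hl'S, hl'z⟩ := exists_desc h0 hp j u hu huj
  have hyl : Desc G δ (y :: u :: l') := ⟨hyu, by omega, hl'⟩
  set W : Set V := {v | v ∈ y :: u :: l' ∨ v ∈ r :: l} with hW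
  have hreach : ∀ v ∈ W, (within G W).Reachable v z := by
    rintro v (hv | hv)
    · exact hyl.reachable (fun w hw => Or.inl hw) (by simpa using hl'z) v hv
    · exact hl.reachable (fun w hw => Or.inr hw) hlz v hv
  have hconn : ConnOn G W := fun v hv w hw => (hreach v hv).trans (hreach w hw).symm
  obtain ⟨δ', h0', hlip', hp'⟩ := hconn.exists_levels (t := y) (Or.inl (by simp))
  obtain ⟨L, hL, hLW, hLy⟩ := exists_desc h0' hp' _ r (Or.inr (by simp)) rfl
  refine ⟨r :: L, hL.isIP hlip' hLW, rfl, hLy, fun v hv => ?_⟩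
  rcases hLW v hv with hv | hv
  · rcases List.mem_cons.1 hv with rfl | hv
    · exact ⟨hy, Or.inl rfl⟩
    · refine ⟨hl'S v hv, Or.inr ?_⟩
      rcases List.mem_cons.1 hv with rfl | hv
      · exact ⟨huj.le, Or.inl hyu⟩
      · have := hl'.lt v hv
        exact ⟨by omega, Or.inr (Or.inr (by omega))⟩
  · refine ⟨hlS v hv, Or.inr ?_⟩
    rcases List.mem_cons.1 hv with rfl | hv
    · exact ⟨hrj.le, Or.inr (Or.inl rfl)⟩
    · have := hl.lt v hv
      exact ⟨by omega, Or.inr (Or.inr (by omega))⟩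

theorem exists_jets {τ ℓ d m c : ℕ} (hB : ∀ v, ColOn G (ballThree G v) τ)
    (hJ : ∀ (ro : V) (leg : V → List V), ForcesJets G τ ℓ d ro leg m c)
    (hcol : ¬ ColOn G Set.univ ((c + τ + τ) * 2)) :
    ∃ (y₀ ro t : V) (leg : V → List V) (Y C : Set V), HasJets G ℓ d ro leg Y C t m ∧
      ro ≠ t ∧ ¬ G.Adj ro t ∧ G.Adj y₀ ro ∧ G.Adj y₀ t ∧
      (∀ v ∈ C, y₀ ≠ v ∧ (G.Adj y₀ v → v = t)) ∧
      ∀ y ∈ Y, ∀ v ∈ leg y, y₀ ≠ v ∧ (G.Adj y₀ v → v = ro) := by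
  obtain ⟨S, -, hS, hScol, -⟩ := exists_component hcol
  obtain ⟨z, hz⟩ := nonempty_of_not_colOn hScol
  obtain ⟨δ, h0, hlip, hpar⟩ := hS.exists_levels hz
  have hlev : ∃ j, ¬ ColOn G {v | v ∈ S ∧ δ v = j} (c + τ + τ) := by
    by_contra hcon
    push Not at hcon
    exact hScol (colOn_levels δ hlip hcon)
  obtain ⟨j, hj⟩ := hlev
  obtain ⟨j, rfl⟩ : ∃ i, j = i + 2 := by
    refine ⟨j - 2, ?_⟩
    by_contra hlt
    refine hj ((colOn_ball hB z).mono ?_ (Nat.le_add_left _ _))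
    rintro v ⟨hv, rfl⟩
    rcases (by omega : δ v = 0 ∨ δ v = 0 + 1) with e | e
    · exact Or.inl (h0 v hv e)
    · obtain ⟨u, hu, hvu, e'⟩ := hpar v hv 0 e
      obtain rfl := h0 u hu e'
      exact Or.inr hvu.symm
  obtain ⟨C₀, hC₀, hC₀conn, hC₀col, -⟩ := exists_component hj
  obtain ⟨v₁, hv₁⟩ := nonempty_of_not_colOn hC₀col
  obtain ⟨y₀, hy₀, hvy, hy₀j⟩ := hpar v₁ (hC₀ hv₁).1 (j + 1) (hC₀ hv₁).2
  obtain ⟨ro, hro, hyro, hroj⟩ := hpar y₀ hy₀ j hy₀j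
  have hcut : ¬ ColOn G {v | v ∈ C₀ ∧ ¬ G.Adj y₀ v} (c + τ) := by
    intro h
    refine hC₀col ((h.union (colOn_nbhd hB y₀)).mono (fun v hv => ?_) le_rfl)
    by_cases hyv : G.Adj y₀ v
    · exact Or.inr hyv
    · exact Or.inl ⟨hv, hyv⟩
  obtain ⟨C₁, hC₁, hC₁conn, hC₁col, hC₁cl⟩ := exists_component hcut
  obtain ⟨a, ha⟩ := nonempty_of_not_colOn hC₁col
  obtain ⟨v, hv, t, ht, htC₁, hvt⟩ := hC₀conn.exists_crossing (fun v hv => (hC₁ hv).1) ha hv₁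
    fun h => (hC₁ h).2 hvy.symm
  have hyt : G.Adj y₀ t := by
    by_contra h
    exact htC₁ (hC₁cl v hv t ⟨ht, h⟩ hvt)
  have hC : ∀ x ∈ insert t C₁, x ∈ S ∧ δ x = j + 2 := by
    rintro x (rfl | hx)
    · exact hC₀ ht
    · exact hC₀ (hC₁ hx).1
  set Y : Set V := {y | y ∈ S ∧ δ y = j + 1 ∧ y ≠ y₀ ∧ ¬ G.Adj y₀ y ∧
    ∀ u, G.Adj y₀ u → ¬ G.Adj u y} with hY
  have hleg := fun y (hy : y ∈ Y) => exists_leg h0 hpar hro hroj hy.1 hy.2.1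
  choose! leg hleg₁ hleg₂ hleg₃ hleg₄ using hleg
  have hnear : ∀ q ∈ S, δ q = j + 1 → ∀ w ∈ S, δ w < j → ¬ G.Adj w q := by
    intro q hq hqj w hw hwj h
    have := hlip w hw q hq h
    omega
  have hsh : IsShower G τ ro leg Y (insert t C₁) := by
    refine ⟨fun y hy => ⟨hleg₁ y hy, hleg₂ y hy, hleg₃ y hy, fun v hv => ⟨fun hvC => ?_,
      fun hne x hx hvx => ?_⟩⟩, fun p hp => (hB p).mono ?_ le_rfl⟩
    · have h1 := (hC v hvC).2
      rcases (hleg₄ y hy v hv).2 with rfl | h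
      · have := hy.2.1
        omega
      · omega
    · obtain ⟨hvS, hv'⟩ := hleg₄ y hy v hv
      have h1 := hlip v hvS x (hC x hx).1 hvx
      have h2 := (hC x hx).2
      rcases hv' with rfl | h
      · exact hne rfl
      · omega
    · rintro w ⟨y, hy, hyw, v, hv, hvp⟩
      obtain ⟨hvS, rfl | ⟨hvj, hv'⟩⟩ := hleg₄ y hy v hv
      · exact ⟨v, v, hvp.imp_right fun h => h.symm, Or.inl rfl, Or.inr hyw⟩
      · have hpv : G.Adj v p := hvp.resolve_left fun e => by
          have := hp.2.1
          rw [e] at hvj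
          omega
        rcases hv' with h | rfl | h
        · exact ⟨v, y, Or.inr hpv.symm, Or.inr h.symm, Or.inr hyw⟩
        · exact absurd hpv (hp.2.2.2.2 v hyro)
        · exact absurd hpv (hnear p hp.1 hp.2.1 v hvS h)
  refine ⟨y₀, ro, t, leg, Y, insert t C₁, hJ ro leg Y _ t hsh (connOn_insert hC₁conn hv hvt.symm)
    (Set.mem_insert _ _) fun h => hC₁col ?_, ?_, fun h => ?_, hyro, hyt, fun x hx => ⟨?_, ?_⟩,
    fun y hy x hx => ?_⟩
  · refine (h.union (hB y₀)).mono (fun w hw => ?_) le_rfl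
    obtain ⟨hwS, hwj⟩ := hC w (Or.inr hw)
    obtain ⟨y, hy, hwy, hyj⟩ := hpar w hwS (j + 1) hwj
    by_cases hyY : y ∈ Y
    · exact Or.inl ⟨Or.inr hw, y, hyY, hwy.symm⟩
    · right
      by_contra hcon
      refine hyY ⟨hy, hyj, fun e => hcon ?_, fun e => hcon ?_, fun u hu huy => hcon ?_⟩
      · exact ⟨y₀, y₀, Or.inl rfl, Or.inl rfl, Or.inr (e ▸ hwy.symm)⟩
      · exact ⟨y, y, Or.inr e, Or.inl rfl, Or.inr hwy.symm⟩
      · exact ⟨u, y, Or.inr hu, Or.inr huy, Or.inr hwy.symm⟩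
  · rintro rfl
    have := (hC₀ ht).2
    omega
  · have := hlip ro hro t (hC₀ ht).1 h
    have := (hC₀ ht).2
    omega
  · rintro rfl
    have := (hC y₀ hx).2
    omega
  · rcases hx with rfl | hx
    · exact fun _ => rfl
    · exact fun h => absurd h (hC₁ hx).2
  · obtain ⟨hxS, rfl | ⟨hxj, hx'⟩⟩ := hleg₄ y hy x hx
    · exact ⟨hy.2.2.1.symm, fun h => absurd h hy.2.2.2.1⟩
    · refine ⟨?_, fun h => ?_⟩
      · rintro rfl
        omega
      · rcases hx' with h' | h' | h'
        · exact absurd h'.symm (hy.2.2.2.2 x h)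
        · exact h'
        · exact absurd h.symm (hnear y₀ hy₀ hy₀j x hxS h')

end Hole

section Chromatic

variable {V : Type*} {G : SimpleGraph V}

theorem colOn_iff_chromaticNumber_le {S : Set V} {n : ℕ} :
    ColOn G S n ↔ (G.induce S).chromaticNumber ≤ (n : ℕ∞) := by
  classical
  rw [chromaticNumber_le_iff_colorable, colorable_iff_exists_bdd_nat_coloring]
  constructor
  · rintro ⟨f, h1, h2⟩
    exact ⟨Coloring.mk (fun v => f v) fun {u v} huv => h2 u u.2 v v.2 huv, fun v => h1 v v.2⟩
  · rintro ⟨f, hf⟩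
    refine ⟨fun v => if h : v ∈ S then f ⟨v, h⟩ else 0, fun v hv => ?_, fun u hu v hv huv => ?_⟩
    · simpa [hv] using hf ⟨v, hv⟩
    · simp only [hu, hv, dif_pos]
      exact f.valid (v := ⟨u, hu⟩) (w := ⟨v, hv⟩) huv

theorem chromaticNumber_le_of_colOn_univ {n : ℕ} (h : ColOn G Set.univ n) :
    G.chromaticNumber ≤ (n : ℕ∞) := by
  rw [chromaticNumber_le_iff_colorable, colorable_iff_exists_bdd_nat_coloring]
  obtain ⟨f, h1, h2⟩ := h
  exact ⟨Coloring.mk f fun {u v} huv => h2 u trivial v trivial huv, fun v => h1 v trivial⟩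

theorem colOn_ballThree {τ : ℕ} (h : chiRho G 8 ≤ (τ : ℕ∞)) (v : V) :
    ColOn G (ballThree G v) τ := by
  have h1 : ColOn G (closedNbhd G v 8) τ :=
    colOn_iff_chromaticNumber_le.2
      ((le_iSup (fun v => (G.induce (closedNbhd G v 8)).chromaticNumber) v).trans h)
  have hw : ∀ x y, (y = x ∨ G.Adj x y) → ∃ p : G.Walk x y, p.length ≤ 1 := by
    rintro x y (rfl | hxy)
    · exact ⟨Walk.nil, by simp⟩
    · exact ⟨hxy.toWalk, by simp⟩
  refine h1.mono ?_ le_rfl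
  rintro w ⟨a, b, ha, hb, hw'⟩
  obtain ⟨p, hp⟩ := hw v a ha
  obtain ⟨q, hq⟩ := hw a b hb
  obtain ⟨r, hr⟩ := hw b w hw'
  have h2 := G.dist_le ((p.append q).append r)
  simp only [Walk.length_append] at h2
  exact ⟨((p.append q).append r).reachable, by omega⟩

theorem exists_clique_of_not_colOn [Fintype V] {τ : ℕ}
    (h : ∀ X : Set V, (G.induce X).cliqueNum < G.cliqueNum →
      (G.induce X).chromaticNumber ≤ (τ : ℕ∞)) {S : Set V} (hS : ¬ ColOn G S τ) :
    ∃ K : Finset V, ↑K ⊆ S ∧ G.IsClique K ∧ ∀ p, ∃ k ∈ K, ¬ G.Adj p k := by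
  classical
  have h1 : G.cliqueNum ≤ (G.induce S).cliqueNum := by
    by_contra hlt
    exact hS (colOn_iff_chromaticNumber_le.2 (h S (not_le.1 hlt)))
  obtain ⟨K, hK⟩ := (G.induce S).exists_isNClique_cliqueNum
  have hK' : G.IsClique (K.map (Function.Embedding.subtype _) : Finset V) := by
    rintro u hu v hv huv
    obtain ⟨u, huK, rfl⟩ := Finset.mem_map.1 hu
    obtain ⟨v, hvK, rfl⟩ := Finset.mem_map.1 hv
    exact hK.isClique huK hvK fun e => huv (by rw [e])
  refine ⟨K.map (Function.Embedding.subtype _), fun v hv => ?_, hK', fun p => ?_⟩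
  · obtain ⟨v, -, rfl⟩ := Finset.mem_map.1 hv
    exact v.2
  · by_contra hcon
    push Not at hcon
    have h2 : G.IsClique (insert p (K.map (Function.Embedding.subtype _)) : Finset V) := by
      rw [Finset.coe_insert]
      exact hK'.insert fun k hk _ => hcon k hk
    have h3 := h2.card_le_cliqueNum
    rw [Finset.card_insert_of_notMem fun hp => (hcon p hp).ne rfl, Finset.card_map,
      hK.card_eq] at h3
    omega

end Chromatic

theorem stmt5 (ℓ : ℕ) (hℓ : 2 ≤ ℓ) (τ d : ℕ) :
    ∃ c : ℕ, ∀ (V : Type) [Fintype V] (G : SimpleGraph V),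
      chiRho G 8 ≤ (τ : ℕ∞) →
      (∀ X : Set V, (G.induce X).cliqueNum < G.cliqueNum →
        (G.induce X).chromaticNumber ≤ (τ : ℕ∞)) →
      (c : ℕ∞) < G.chromaticNumber →
      ∀ r : ℕ, r < ℓ → ∃ n : ℕ, n ≡ r [MOD ℓ] ∧ HasPeriphHole G d n := by
  obtain ⟨c, hc⟩ := exists_forcesJets ℓ d τ (by omega) (ℓ - 1)
  refine ⟨(c + τ + τ) * 2, fun V _ G hρ hclq hχ r _ => ?_⟩
  have hB := colOn_ballThree hρ
  obtain ⟨y₀, ro, t, leg, Y, C, ⟨e, he⟩, hne, hnadj, hyro, hyt, hyC, hyleg⟩ :=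
    exists_jets hB
      (fun ro leg => hc V G ro leg hB fun _ hS => exists_clique_of_not_colOn hclq hS)
      fun h => absurd (chromaticNumber_le_of_colOn_univ h) (not_le.2 hχ)
  obtain ⟨P, ⟨hP, hP1, hP2, hP3, Z, hZ, hZd, hZP⟩, hlen⟩ :=
    he ((r + (ℓ - 1) * (e + 1)) % ℓ) (Nat.le_sub_one_of_lt (Nat.mod_lt _ (by omega)))
  obtain ⟨h4, f, hf⟩ := hP.exists_hole hP1 hP2 hne hnadj hyro hyt fun v hv => by
    rcases hP3 v hv with hvC | ⟨y, hy, hvy⟩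
    · exact ⟨(hyC v hvC).1, fun h => Or.inr ((hyC v hvC).2 h)⟩
    · exact ⟨(hyleg y hy v hvy).1, fun h => Or.inl ((hyleg y hy v hvy).2 h)⟩
  refine ⟨P.length + 1, ?_, h4, f, ?_⟩
  · have h1 : e + (r + (ℓ - 1) * (e + 1)) % ℓ + 1 ≡ e + (r + (ℓ - 1) * (e + 1)) + 1 [MOD ℓ] :=
      ((Nat.mod_modEq _ _).add_left e).add_right 1
    obtain ⟨k, rfl⟩ : ∃ k, ℓ = k + 1 := ⟨ℓ - 1, by omega⟩
    refine ((hlen.add_right 1).trans h1).trans ?_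
    rw [Nat.add_sub_cancel, show e + (r + k * (e + 1)) + 1 = r + (k + 1) * (e + 1) by ring]
    simp [Nat.ModEq]
  · by_contra hcon
    refine hZd ((colOn_iff_chromaticNumber_le.2 (not_lt.1 hcon)).mono (fun z hz => ?_) le_rfl)
    have htz := hZP z hz t (List.mem_of_getLast? hP2)
    obtain ⟨h5, h6⟩ := hyC z (hZ hz)
    have key : ∀ u ∈ Set.range f, u ≠ z ∧ ¬ G.Adj u z := by
      intro u hu
      rw [hf] at hu
      rcases List.mem_cons.1 hu with rfl | hu
      · exact ⟨h5, fun h => htz.1 (h6 h).symm⟩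
      · exact hZP z hz u hu
    exact ⟨fun h => (key z h).1 rfl, fun u hu h => (key u hu).2 h.symm⟩
end

section
/- For every integer k ≥ 0 there exists an integer c ≥ 0 such that χ(G) ≤ c for every k-balanced graph G. -/
open SimpleGraph

/-- `G` is `k`-balanced: for every induced subgraph (given by a finite set `X` of
vertices), the number of stable subsets of `X` of even cardinality differs by at
most `k` from the number of stable subsets of odd cardinality. -/
def KBalanced {V : Type*} [DecidableEq V] (G : SimpleGraph V) [DecidableRel G.Adj]
    (k : ℕ) : Prop :=
  ∀ X : Finset V,
    |((X.powerset.filter fun s => (∀ u ∈ s, ∀ v ∈ s, ¬ G.Adj u v) ∧ Even s.card).card : ℤ) -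
      ((X.powerset.filter fun s => (∀ u ∈ s, ∀ v ∈ s, ¬ G.Adj u v) ∧ Odd s.card).card : ℤ)|
    ≤ (k : ℤ)

namespace Balanced

section

variable {V : Type} {G : SimpleGraph V}

/-- `a` and `x` are distinct and nonadjacent. -/
def Far (G : SimpleGraph V) (a x : V) : Prop := a ≠ x ∧ ¬ G.Adj a x

lemma Far.symm {a x : V} (h : Far G a x) : Far G x a :=
  ⟨h.1.symm, fun h' => h.2 h'.symm⟩

/-- The subgraph induced on `S` is `n`-colourable. -/
def Col (G : SimpleGraph V) (S : Set V) (n : ℕ) : Prop :=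
  ∃ f : V → ℕ, (∀ v ∈ S, f v < n) ∧ ∀ u ∈ S, ∀ v ∈ S, G.Adj u v → f u ≠ f v

lemma Col.mono {S T : Set V} {m n : ℕ} (h : Col G T m) (hST : S ⊆ T) (hmn : m ≤ n) :
    Col G S n := by
  obtain ⟨f, h1, h2⟩ := h
  exact ⟨f, fun v hv => (h1 v (hST hv)).trans_le hmn,
    fun u hu v hv => h2 u (hST hu) v (hST hv)⟩

lemma col_union {S T : Set V} {m n : ℕ} (hS : Col G S m) (hT : Col G T n) :
    Col G (S ∪ T) (m + n) := by
  classical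
  obtain ⟨f, f1, f2⟩ := hS
  obtain ⟨g, g1, g2⟩ := hT
  refine ⟨fun v => if v ∈ S then f v else m + g v, ?_, ?_⟩
  · intro v hv
    by_cases h : v ∈ S
    · have := f1 v h
      simp only [h, if_true]; omega
    · have := g1 v (hv.resolve_left h)
      simp only [h, if_false]; omega
  · intro u hu v hv huv
    by_cases h : u ∈ S <;> by_cases h' : v ∈ S <;> simp only [h, h', if_true, if_false]
    · exact f2 u h v h' huv
    · have := f1 u h
      omega
    · have := f1 v h'
      omega
    · have := g2 u (hu.resolve_left h) v (hv.resolve_left h') huv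
      omega

lemma col_one {S : Set V} (h : ∀ u ∈ S, ∀ v ∈ S, ¬ G.Adj u v) : Col G S 1 :=
  ⟨fun _ => 0, fun _ _ => one_pos, fun u hu v hv huv => absurd huv (h u hu v hv)⟩

lemma col_singleton (a : V) : Col G {a} 1 :=
  col_one (by rintro u rfl v rfl; exact G.loopless.irrefl _)

/-- Removing an `m`-colourable set from a set that is not `(n + m)`-colourable. -/
lemma not_col_of_cover {S T U : Set V} {m n : ℕ} (hS : ¬ Col G S (n + m)) (hU : Col G U m)
    (h : S ⊆ T ∪ U) : ¬ Col G T n :=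
  fun hT => hS ((col_union hT hU).mono h le_rfl)

lemma col_classes {S : Set V} {k n : ℕ} (f : V → ℕ) (hf : ∀ v ∈ S, f v < k)
    (h : ∀ j < k, Col G {v | v ∈ S ∧ f v = j} n) : Col G S (k * n) := by
  choose! c h1 h2 using h
  refine ⟨fun v => f v * n + c (f v) v, fun v hv => ?_, fun u hu v hv huv heq => ?_⟩
  · have := h1 (f v) (hf v hv) v ⟨hv, rfl⟩
    have h3 := Nat.mul_le_mul_right n (hf v hv)
    simp only [Nat.succ_eq_add_one] at h3
    nlinarith
  · have hcu := h1 (f u) (hf u hu) u ⟨hu, rfl⟩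
    have hcv := h1 (f v) (hf v hv) v ⟨hv, rfl⟩
    have hn : 0 < n := by omega
    have hfe : f u = f v := by
      have := congrArg (· / n) heq
      simp only [mul_comm (f _) n, Nat.mul_add_div hn, Nat.div_eq_of_lt hcu,
        Nat.div_eq_of_lt hcv] at this
      omega
    refine h2 (f u) (hf u hu) u ⟨hu, rfl⟩ v ⟨hv, hfe.symm⟩ huv ?_
    simp only [hfe] at heq ⊢
    omega

lemma exists_class {S : Set V} {k n : ℕ} (f : V → ℕ) (hf : ∀ v ∈ S, f v < k)
    (h : ¬ Col G S (k * n)) : ∃ j < k, ¬ Col G {v | v ∈ S ∧ f v = j} n := by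
  by_contra! hc
  exact h (col_classes f hf hc)

lemma col_levels {S : Set V} {n : ℕ} (lev : V → ℕ)
    (hlev : ∀ u ∈ S, ∀ v ∈ S, G.Adj u v → lev v ≤ lev u + 1)
    (h : ∀ j, Col G {v | v ∈ S ∧ lev v = j} n) : Col G S (2 * n) := by
  choose c h1 h2 using h
  refine col_classes (fun v => lev v % 2) (fun v _ => Nat.mod_lt _ two_pos) fun j _ =>
    ⟨fun v => c (lev v) v, fun v hv => h1 _ v ⟨hv.1, rfl⟩, fun u hu v hv huv => ?_⟩
  have e1 := hlev u hu.1 v hv.1 huv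
  have e2 := hlev v hv.1 u hu.1 huv.symm
  have e3 := hu.2
  have e4 := hv.2
  have e : lev v = lev u := by omega
  simp only [e]
  exact h2 _ u ⟨hu.1, rfl⟩ v ⟨hv.1, e⟩ huv

lemma exists_level {S : Set V} {n : ℕ} (lev : V → ℕ)
    (hlev : ∀ u ∈ S, ∀ v ∈ S, G.Adj u v → lev v ≤ lev u + 1)
    (h : ¬ Col G S (2 * n)) : ∃ j, ¬ Col G {v | v ∈ S ∧ lev v = j} n := by
  by_contra! hc
  exact h (col_levels lev hlev hc)

/-- The graph on the same vertices keeping the edges inside `S`. -/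
def restr (G : SimpleGraph V) (S : Set V) : SimpleGraph V where
  Adj u v := G.Adj u v ∧ u ∈ S ∧ v ∈ S
  symm := ⟨fun _ _ h => ⟨h.1.symm, h.2.2, h.2.1⟩⟩
  loopless := ⟨fun _ h => G.loopless.irrefl _ h.1⟩

/-- `S` induces a connected (or empty) subgraph. -/
def Conn (G : SimpleGraph V) (S : Set V) : Prop :=
  ∀ x ∈ S, ∀ y ∈ S, (restr G S).Reachable x y

lemma Conn.exists_edge {S A : Set V} (h : Conn G S) {x y : V} (hx : x ∈ S) (hy : y ∈ S)
    (hxA : x ∈ A) (hyA : y ∉ A) : ∃ u ∈ S, ∃ v ∈ S, u ∈ A ∧ v ∉ A ∧ G.Adj u v := by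
  obtain ⟨p⟩ := h x hx y hy
  obtain ⟨d, -, h1, h2⟩ := p.exists_boundary_dart A hxA hyA
  exact ⟨d.fst, d.adj.2.1, d.snd, d.adj.2.2, h1, h2, d.adj.1⟩

lemma conn_insert {S : Set V} (h : Conn G S) {a b : V} (hb : b ∈ S) (hab : G.Adj a b) :
    Conn G (insert a S) := by
  have key : ∀ x ∈ S, (restr G (insert a S)).Reachable x b := fun x hx =>
    (h x hx b hb).mono (show restr G S ≤ restr G (insert a S) from
      fun _ _ huv => ⟨huv.1, Or.inr huv.2.1, Or.inr huv.2.2⟩)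
  have ka : (restr G (insert a S)).Reachable a b :=
    SimpleGraph.Adj.reachable ⟨hab, Or.inl rfl, Or.inr hb⟩
  have all : ∀ x ∈ insert a S, (restr G (insert a S)).Reachable x b := by
    rintro x (rfl | hx)
    · exact ka
    · exact key x hx
  exact fun x hx y hy => (all x hx).trans (all y hy).symm

lemma reachable_restr {S Z : Set V} (hcl : ∀ z ∈ Z, ∀ y ∈ S, G.Adj z y → y ∈ Z) {x y : V}
    (hx : x ∈ Z) (h : (restr G S).Reachable x y) : y ∈ Z ∧ (restr G Z).Reachable x y := by
  rw [SimpleGraph.reachable_iff_reflTransGen] at h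
  induction h with
  | refl => exact ⟨hx, SimpleGraph.Reachable.refl _⟩
  | tail _ hbc ih =>
    have := hcl _ ih.1 _ hbc.2.2 hbc.1
    exact ⟨this, ih.2.trans (SimpleGraph.Adj.reachable ⟨hbc.1, ih.1, this⟩)⟩

lemma exists_comp {S : Set V} {n : ℕ} (h : ¬ Col G S n) :
    ∃ Z ⊆ S, Z.Nonempty ∧ Conn G Z ∧ ¬ Col G Z n ∧
      ∀ z ∈ Z, ∀ y ∈ S, G.Adj z y → y ∈ Z := by
  by_contra! hc
  have key : ∀ C : (restr G S).ConnectedComponent,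
      Col G {v | v ∈ S ∧ (restr G S).connectedComponentMk v = C} n := by
    intro C
    by_contra hC
    obtain ⟨x, hx⟩ : {v | v ∈ S ∧ (restr G S).connectedComponentMk v = C}.Nonempty := by
      by_contra hne
      rw [Set.not_nonempty_iff_eq_empty] at hne
      rw [hne] at hC
      exact hC ⟨fun _ => 0, by simp, by simp⟩
    have hcl : ∀ z ∈ {v | v ∈ S ∧ (restr G S).connectedComponentMk v = C}, ∀ y ∈ S,
        G.Adj z y → y ∈ {v | v ∈ S ∧ (restr G S).connectedComponentMk v = C} := by
      intro z hz y hy hzy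
      refine ⟨hy, ?_⟩
      rw [← hz.2, SimpleGraph.ConnectedComponent.eq]
      exact SimpleGraph.Adj.reachable ⟨hzy.symm, hy, hz.1⟩
    obtain ⟨z, hz, y, hy, hzy, hn⟩ := hc _ (fun v hv => hv.1) ⟨x, hx⟩ (fun u hu v hv =>
      (reachable_restr hcl hu (SimpleGraph.ConnectedComponent.eq.1 (hu.2.trans hv.2.symm))).2) hC
    exact hn (hcl z hz y hy hzy)
  choose c h1 h2 using key
  refine h ⟨fun v => c ((restr G S).connectedComponentMk v) v, fun v hv => h1 _ v ⟨hv, rfl⟩,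
    fun u hu v hv huv => ?_⟩
  have e : (restr G S).connectedComponentMk v = (restr G S).connectedComponentMk u := by
    rw [SimpleGraph.ConnectedComponent.eq]
    exact SimpleGraph.Adj.reachable ⟨huv.symm, hv, hu⟩
  simp only [e]
  exact h2 _ u ⟨hu, rfl⟩ v ⟨hv, e⟩ huv

lemma nonempty_of_not_col {S : Set V} {n : ℕ} (h : ¬ Col G S n) : S.Nonempty := by
  by_contra hne
  rw [Set.not_nonempty_iff_eq_empty] at hne
  rw [hne] at h
  exact h ⟨fun _ => 0, by simp, by simp⟩

lemma exists_mem_notMem {S T : Set V} {n : ℕ} (hS : ¬ Col G S n) (hT : Col G T n) :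
    ∃ x ∈ S, x ∉ T := by
  by_contra! h
  exact hS (hT.mono h le_rfl)

/-- There is no triangle. -/
def TriFree (G : SimpleGraph V) : Prop := ∀ a b c, G.Adj a b → G.Adj b c → ¬ G.Adj a c

lemma TriFree.col_nbr (h : TriFree G) (v : V) : Col G {x | G.Adj x v} 1 :=
  col_one fun a ha b hb hab => h a b v hab hb ha

def Ball2 (G : SimpleGraph V) (w : V) : Set V := {x | ∃ t, G.Adj x t ∧ G.Adj t w}

def Ball3 (G : SimpleGraph V) (w : V) : Set V :=
  {x | ∃ t s, G.Adj x t ∧ G.Adj t s ∧ G.Adj s w}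

/-- The list is an induced path (in this order). -/
def IndPath (G : SimpleGraph V) : List V → Prop
  | [] => True
  | [_] => True
  | a :: b :: l => G.Adj a b ∧ (∀ x ∈ l, Far G a x) ∧ IndPath G (b :: l)

lemma IndPath.tail {a : V} {l : List V} (h : IndPath G (a :: l)) : IndPath G l := by
  cases l with
  | nil => trivial
  | cons b l => exact h.2.2

lemma IndPath.glue {A B : List V} {x : V} (hA : IndPath G (A ++ [x]))
    (hB : IndPath G (x :: B)) (h : ∀ a ∈ A, ∀ b ∈ B, Far G a b) :
    IndPath G (A ++ x :: B) := by
  induction A with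
  | nil => exact hB
  | cons a A ih =>
    have ih' := ih hA.tail fun a' ha' => h a' (List.mem_cons_of_mem _ ha')
    cases A with
    | nil => exact ⟨hA.1, fun b hb => h a (List.mem_cons_self ..) b hb, ih'⟩
    | cons a2 A =>
      refine ⟨hA.1, fun y hy => ?_, ih'⟩
      rcases List.mem_append.1 hy with hy | hy
      · exact hA.2.1 y (List.mem_append_left _ hy)
      · rcases List.mem_cons.1 hy with rfl | hy
        · exact hA.2.1 y (by simp)
        · exact h a (List.mem_cons_self ..) y hy

lemma IndPath.snoc {A : List V} {x y : V} (hA : IndPath G (A ++ [x])) (hxy : G.Adj x y)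
    (h : ∀ a ∈ A, Far G a y) : IndPath G (A ++ [x, y]) :=
  hA.glue ⟨hxy, by simp, trivial⟩ (by simpa using h)

/-- `lev` is the distance from `a` inside `S`. -/
structure IsBfs (G : SimpleGraph V) (S : Set V) (a : V) (lev : V → ℕ) : Prop where
  zero : lev a = 0
  eq_of_zero : ∀ x ∈ S, lev x = 0 → x = a
  step : ∀ x ∈ S, ∀ y ∈ S, G.Adj x y → lev y ≤ lev x + 1
  pred : ∀ x ∈ S, x ≠ a → ∃ y ∈ S, G.Adj x y ∧ lev x = lev y + 1

lemma exists_bfs {S : Set V} {a : V} (h : Conn G S) (ha : a ∈ S) :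
    ∃ lev, IsBfs G S a lev := by
  refine ⟨fun x => (restr G S).dist a x, by simp, fun x hx h0 => ?_, fun x hx y hy hxy => ?_,
    fun x hx hxa => ?_⟩
  · exact ((h a ha x hx).dist_eq_zero_iff.1 h0).symm
  · obtain ⟨p, hp⟩ := (h a ha x hx).exists_walk_length_eq_dist
    have hxy' : (restr G S).Adj x y := ⟨hxy, hx, hy⟩
    have := SimpleGraph.dist_le (p.concat hxy')
    simpa [hp] using this
  · obtain ⟨p, hp⟩ := (h x hx a ha).exists_walk_length_eq_dist
    cases p with
    | nil => exact absurd rfl hxa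
    | @cons _ y _ hxy q =>
      refine ⟨y, hxy.2.2, hxy.1, ?_⟩
      have h1 := SimpleGraph.dist_le q
      obtain ⟨q', hq'⟩ := (h y hxy.2.2 a ha).exists_walk_length_eq_dist
      have h2 := SimpleGraph.dist_le (SimpleGraph.Walk.cons hxy q')
      simp only [SimpleGraph.Walk.length_cons] at h2 hp
      rw [SimpleGraph.dist_comm (u := a), SimpleGraph.dist_comm (u := a)]
      omega

lemma IsBfs.far {S : Set V} {a : V} {lev : V → ℕ} (h : IsBfs G S a lev) {x y : V}
    (hx : x ∈ S) (hy : y ∈ S) (hxy : lev x + 2 ≤ lev y) : Far G x y := by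
  refine ⟨?_, fun hadj => ?_⟩
  · rintro rfl; omega
  · have := h.step x hx y hy hadj
    omega

lemma IsBfs.geo {S : Set V} {a : V} {lev : V → ℕ} (h : IsBfs G S a lev) (ha : a ∈ S) {x : V}
    (hx : x ∈ S) (hxa : x ≠ a) : ∃ l : List V, IndPath G (a :: (l ++ [x])) ∧
      (∀ y ∈ l, y ∈ S ∧ 0 < lev y ∧ lev y < lev x) ∧
      (∀ y ∈ l, ∀ z ∈ l, lev y = lev z → y = z) ∧ l.length + 1 = lev x := by
  obtain ⟨n, hn⟩ : ∃ n, lev x = n := ⟨_, rfl⟩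
  induction n using Nat.strong_induction_on generalizing x with
  | _ n ih =>
    obtain ⟨y, hy, hxy, hl⟩ := h.pred x hx hxa
    by_cases hya : y = a
    · subst hya
      have := h.zero
      exact ⟨[], ⟨hxy.symm, by simp, trivial⟩, by simp, by simp, by simp; omega⟩
    · obtain ⟨l, h1, h2, h3, h4⟩ := ih (lev y) (by omega) hy hya rfl
      have hy0 : lev y ≠ 0 := fun h0 => hya (h.eq_of_zero y hy h0)
      refine ⟨l ++ [y], ?_, ?_, ?_, by simp; omega⟩
      · have : IndPath G ((a :: l) ++ [y, x]) := by
          refine IndPath.snoc (by simpa using h1) hxy.symm ?_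
          intro b hb
          rcases List.mem_cons.1 hb with rfl | hb
          · exact h.far ha hx (by have := h.zero; omega)
          · exact h.far (h2 b hb).1 hx (by have := (h2 b hb).2; omega)
        simpa using this
      · intro z hz
        rcases List.mem_append.1 hz with hz | hz
        · exact ⟨(h2 z hz).1, (h2 z hz).2.1, by have := (h2 z hz).2; omega⟩
        · obtain rfl := List.mem_singleton.1 hz
          exact ⟨hy, by omega, by omega⟩
      · intro z hz w hw hzw
        simp only [List.mem_append, List.mem_singleton] at hz hw
        rcases hz with hz | rfl <;> rcases hw with hw | rfl
        · exact h3 z hz w hw hzw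
        · have := (h2 z hz).2
          omega
        · have := (h2 w hw).2
          omega
        · rfl

end

section

variable {V : Type} {G : SimpleGraph V}

/-- Conclusion of the grading lemma: an edge `ab` of `X`, private neighbours `ca`, `cb` in `T`
and a connected set `O ⊆ X` seen by `b` but not by `a`, all of whose neighbours in `T` are ranked
above `ca` and `cb`. -/
structure Grading (G : SimpleGraph V) (X T : Set V) (rank : V → ℕ) (n : ℕ)
    (a b ca cb : V) (O : Set V) : Prop where
  a_mem : a ∈ X
  b_mem : b ∈ X
  ca_mem : ca ∈ T
  cb_mem : cb ∈ T
  sub : O ⊆ X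
  ab : G.Adj a b
  a_ca : G.Adj a ca
  b_cb : G.Adj b cb
  conn : Conn G O
  big : ¬ Col G O n
  b_O : ∃ o ∈ O, G.Adj b o
  a_O : ∀ o ∈ O, ¬ G.Adj a o
  rank_lt : ∀ o ∈ O, ∀ t ∈ T, G.Adj o t → rank ca < rank t ∧ rank cb < rank t

lemma exists_low_vertex {X : Set V} {idx : V → ℕ}
    (hne : ∀ x ∈ X, ∀ y ∈ X, G.Adj x y → idx x ≠ idx y) {n : ℕ} (h : ¬ Col G X (n + 2)) :
    ∃ γ ∈ X, ∃ u ∈ X, G.Adj γ u ∧ idx u < idx γ ∧ ∃ Z ⊆ X, Conn G Z ∧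
      (∀ z ∈ Z, idx γ < idx z) ∧ (∃ z ∈ Z, G.Adj γ z) ∧ ¬ Col G Z n := by
  have hA : ¬ Col G {v | v ∈ X ∧ ∃ u ∈ X, G.Adj v u ∧ idx u < idx v} (n + 1) := by
    refine not_col_of_cover (U := {v | v ∈ X ∧ ¬ ∃ u ∈ X, G.Adj v u ∧ idx u < idx v})
      (n := n + 1) (m := 1) h (col_one ?_) ?_
    · rintro u ⟨hu, hu'⟩ v ⟨hv, hv'⟩ huv
      rcases lt_or_gt_of_ne (hne u hu v hv huv) with h1 | h1
      · exact hv' ⟨u, hu, huv.symm, h1⟩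
      · exact hu' ⟨v, hv, huv, h1⟩
    · intro v hv
      by_cases h' : ∃ u ∈ X, G.Adj v u ∧ idx u < idx v
      · exact Or.inl ⟨hv, h'⟩
      · exact Or.inr ⟨hv, h'⟩
  obtain ⟨Z, hZA, hZne, hZc, hZ, -⟩ := exists_comp hA
  obtain ⟨z0, hz0, hmin⟩ : ∃ z0 ∈ Z, ∀ z ∈ Z, idx z0 ≤ idx z := by
    obtain ⟨z0, hz0, h0⟩ := exists_minimalFor_of_wellFoundedLT (· ∈ Z) idx hZne
    exact ⟨z0, hz0, fun z hz => by
      rcases le_total (idx z0) (idx z) with h | h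
      · exact h
      · exact h0 hz h⟩
  have hD : ¬ Col G {z | z ∈ Z ∧ idx z ≠ idx z0} n := by
    refine not_col_of_cover (U := {z | z ∈ Z ∧ idx z = idx z0}) hZ (col_one ?_) ?_
    · rintro u ⟨hu, hu'⟩ v ⟨hv, hv'⟩ huv
      exact hne u (hZA hu).1 v (hZA hv).1 huv (hu'.trans hv'.symm)
    · intro v hv
      by_cases h' : idx v = idx z0
      · exact Or.inr ⟨hv, h'⟩
      · exact Or.inl ⟨hv, h'⟩
  obtain ⟨D, hDs, ⟨d, hd⟩, hDc, hDn, hcl⟩ := exists_comp hD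
  obtain ⟨p, hp, q, hq, hpD, hqD, hpq⟩ :=
    hZc.exists_edge (hDs hd).1 hz0 hd (fun h' => (hDs h').2 rfl)
  have hq0 : idx q = idx z0 := by
    by_contra h'
    exact hqD (hcl p hpD q ⟨hq, h'⟩ hpq)
  obtain ⟨hqX, u, hu, hqu, hlt⟩ := hZA hq
  refine ⟨q, hqX, u, hu, hqu, hlt, D, fun z hz => (hZA (hDs hz).1).1, hDc, fun z hz => ?_,
    ⟨p, hpD, hpq.symm⟩, hDn⟩
  have h1 := hmin z (hDs hz).1
  have h2 := (hDs hz).2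
  omega

lemma exists_grading (htf : TriFree G) {X T : Set V} {rank : V → ℕ} (hinj : Set.InjOn rank T)
    (hX : ∀ x ∈ X, ∃ t ∈ T, G.Adj x t) {n : ℕ} (h : ¬ Col G X (n + 3)) :
    ∃ a b ca cb O, Grading G X T rank n a b ca cb O := by
  have hmin : ∀ x ∈ X, ∃ t ∈ T, G.Adj x t ∧ ∀ s ∈ T, G.Adj x s → rank t ≤ rank s := by
    intro x hx
    obtain ⟨t, ht, h0⟩ := exists_minimalFor_of_wellFoundedLT (fun t => t ∈ T ∧ G.Adj x t) rank
      (let ⟨t, h1, h2⟩ := hX x hx; ⟨t, h1, h2⟩)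
    exact ⟨t, ht.1, ht.2, fun s hs hxs => by
      rcases le_total (rank t) (rank s) with h | h
      · exact h
      · exact h0 ⟨hs, hxs⟩ h⟩
  choose! t ht hxt htmin using hmin
  have hne : ∀ x ∈ X, ∀ y ∈ X, G.Adj x y → rank (t x) ≠ rank (t y) := by
    intro x hx y hy hxy he
    have := hinj (ht x hx) (ht y hy) he
    exact htf (t x) x y (hxt x hx).symm hxy (this ▸ (hxt y hy).symm)
  obtain ⟨γ, hγ, u, hu, hγu, hlt, Z, hZX, hZc, hZlt, ⟨z1, hz1, hγz1⟩, hZ⟩ :=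
    exists_low_vertex hne (n := n + 1) h
  have hr : ∀ o ∈ Z, ∀ s ∈ T, G.Adj o s → rank (t u) < rank s ∧ rank (t γ) < rank s := by
    intro o ho s hs hos
    have h1 := hZlt o ho
    have h2 := htmin o (hZX ho) s hs hos
    omega
  by_cases huZ : ∃ z ∈ Z, G.Adj u z
  · obtain ⟨z2, hz2, huz2⟩ := huZ
    have h1 : ¬ Col G {z | z ∈ Z ∧ ¬ G.Adj z u} n := by
      refine not_col_of_cover hZ (htf.col_nbr u) ?_
      intro v hv
      by_cases h' : G.Adj v u
      · exact Or.inr h'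
      · exact Or.inl ⟨hv, h'⟩
    obtain ⟨Z', hZ's, ⟨d, hd⟩, hZ'c, hZ'n, hcl⟩ := exists_comp h1
    have hsub : Z' ⊆ Z := fun z hz => (hZ's hz).1
    by_cases hγZ' : ∃ z ∈ Z', G.Adj γ z
    · exact ⟨u, γ, t u, t γ, Z', hu, hγ, ht u hu, ht γ hγ, hsub.trans hZX, hγu.symm,
        hxt u hu, hxt γ hγ, hZ'c, hZ'n, hγZ', fun o ho h' => (hZ's ho).2 h'.symm,
        fun o ho => hr o (hsub ho)⟩
    · push Not at hγZ'
      obtain ⟨p, hp, q, hq, hpD, hqD, hpq⟩ :=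
        hZc.exists_edge (hZ's hd).1 hz2 hd (fun h' => (hZ's h').2 huz2.symm)
      have hqu : G.Adj q u := by
        by_contra h'
        exact hqD (hcl p hpD q ⟨hq, h'⟩ hpq)
      have hsub' : insert q Z' ⊆ Z := Set.insert_subset hq hsub
      refine ⟨γ, u, t γ, t u, insert q Z', hγ, hu, ht γ hγ, ht u hu, hsub'.trans hZX, hγu,
        hxt γ hγ, hxt u hu, conn_insert hZ'c hpD hpq.symm,
        fun h' => hZ'n (h'.mono (Set.subset_insert _ _) le_rfl), ⟨q, Or.inl rfl, hqu.symm⟩,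
        ?_, fun o ho s hs hos => (hr o (hsub' ho) s hs hos).symm⟩
      rintro o (rfl | ho)
      · exact htf γ u o hγu hqu.symm
      · exact hγZ' o ho
  · push Not at huZ
    exact ⟨u, γ, t u, t γ, Z, hu, hγ, ht u hu, ht γ hγ, hZX, hγu.symm, hxt u hu, hxt γ hγ,
      hZc, fun h' => hZ (h'.mono subset_rfl (by omega)), ⟨z1, hz1, hγz1⟩, huZ, hr⟩

end

section

variable {V : Type} {G : SimpleGraph V}

/-- `p0` is adjacent to the two ends of the list and to no other member of it. -/
def Closes (G : SimpleGraph V) (p0 : V) (L : List V) : Prop :=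
  ∃ x M y, L = x :: (M ++ [y]) ∧ G.Adj p0 x ∧ G.Adj p0 y ∧ ∀ m ∈ M, Far G p0 m

/-- For each induced cycle whose length is divisible by three, the vertices having no neighbour
on the cycle induce a `d`-colourable graph. -/
def HypC (G : SimpleGraph V) (d : ℕ) : Prop :=
  ∀ p0 L, IndPath G L → Closes G p0 L → (L.length + 1) % 3 = 0 →
    Col G {z | Far G p0 z ∧ ∀ w ∈ L, Far G w z} d

lemma IsBfs.col_nbhd {S : Set V} {a : V} {lev : V → ℕ} (h : IsBfs G S a lev)
    (htf : TriFree G) {E : List V} (hES : ∀ w ∈ E, w ∈ S)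
    (hinj : ∀ w ∈ E, ∀ w' ∈ E, lev w = lev w' → w = w') :
    Col G {z | z ∈ S ∧ ∃ w ∈ E, z = w ∨ G.Adj z w} 8 := by
  refine col_levels (n := 4) lev (fun u hu v hv huv => h.step u hu.1 v hv.1 huv) fun j => ?_
  have key : ∀ c, Col G {z | ∃ w ∈ E, lev w + c = j + 1 ∧ G.Adj z w} 1 := by
    refine fun c => col_one ?_
    rintro u ⟨w, hw, hwc, huw⟩ v ⟨w', hw', hwc', hvw⟩ huv
    obtain rfl := hinj w hw w' hw' (by omega)
    exact htf u v w huv hvw huw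
  have key' : Col G {z | z ∈ E ∧ lev z = j} 1 := by
    refine col_one ?_
    rintro u ⟨hu, hu'⟩ v ⟨hv, hv'⟩ huv
    exact huv.ne (hinj u hu v hv (hu'.trans hv'.symm))
  refine (col_union (col_union (key 0) (key 1)) (col_union (key 2) key')).mono ?_ le_rfl
  rintro z ⟨⟨hz, w, hw, rfl | hzw⟩, hzj⟩
  · exact Or.inr (Or.inr ⟨hw, hzj⟩)
  · have h1 := h.step z hz w (hES w hw) hzw
    have h2 := h.step w (hES w hw) z hz hzw.symm
    have h3 : lev w + 0 = j + 1 ∨ lev w + 1 = j + 1 ∨ lev w + 2 = j + 1 := by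
      omega
    rcases h3 with h3 | h3 | h3
    · exact Or.inl (Or.inl ⟨w, hw, h3, hzw⟩)
    · exact Or.inl (Or.inr ⟨w, hw, h3, hzw⟩)
    · exact Or.inr (Or.inl ⟨w, hw, h3, hzw⟩)

/-- The vertices of `T` have return paths `mid t` to `p0` avoiding `K`. -/
structure Returns (G : SimpleGraph V) (K T : Set V) (p0 : V) (mid : V → List V) (tau : V → V)
    (r : ℕ) : Prop where
  notMem : ∀ t ∈ T, t ∉ K
  p0_far : ∀ t ∈ T, Far G p0 t
  far_mid : ∀ x ∈ K, ∀ t ∈ T, ∀ m ∈ mid t, Far G x m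
  path : ∀ t ∈ T, IndPath G (t :: mid t)
  closes : ∀ t ∈ T, ∃ M y, mid t = M ++ [y] ∧ G.Adj p0 y ∧ ∀ m ∈ M, Far G p0 m
  length : ∀ t ∈ T, (mid t).length % 3 = r
  far_mid' : ∀ t ∈ T, ∀ t' ∈ T, ¬ G.Adj t' (tau t) → ∀ m ∈ mid t, Far G t' m

lemma Returns.mono {K T T' : Set V} {p0 : V} {mid : V → List V} {tau : V → V} {r : ℕ}
    (h : Returns G K T p0 mid tau r) (hT : T' ⊆ T) : Returns G K T' p0 mid tau r :=
  ⟨fun t ht => h.notMem t (hT ht), fun t ht => h.p0_far t (hT ht),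
    fun x hx t ht => h.far_mid x hx t (hT ht), fun t ht => h.path t (hT ht),
    fun t ht => h.closes t (hT ht), fun t ht => h.length t (hT ht),
    fun t ht t' ht' => h.far_mid' t (hT ht) t' (hT ht')⟩

/-- `A` followed by `γ` is an induced path leaving `p0`, with `A` anticomplete to `O`, `T` and
the return paths. -/
structure Stem (G : SimpleGraph V) (O T : Set V) (p0 : V) (mid : V → List V) (γ : V)
    (A : List V) : Prop where
  starts : ∃ x A', A = x :: A' ∧ G.Adj p0 x ∧ ∀ a ∈ A', Far G p0 a
  path : IndPath G (A ++ [γ])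
  far_O : ∀ a ∈ A, ∀ o ∈ O, Far G a o
  far_T : ∀ a ∈ A, ∀ t ∈ T, Far G a t
  far_mid : ∀ a ∈ A, ∀ t ∈ T, ∀ m ∈ mid t, Far G a m

section Core

variable {K O X T T' Y : Set V} {p0 γ u v cu cv e : V}
  {mid : V → List V} {tau : V → V} {rank : V → ℕ}

lemma Grading.far_Y {n : ℕ} {O : Set V} {a b ca cb : V} {rank : V → ℕ}
    (h : Grading G X T rank n a b ca cb O) (hXT : ∀ t ∈ T, t ∉ X) :
    (∀ o ∈ O, Far G o ca) ∧ (∀ o ∈ O, Far G o cb) ∧ (∀ o ∈ O, Far G a o) ∧ b ∉ O := by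
  refine ⟨fun o ho => ⟨?_, fun h' => ?_⟩, fun o ho => ⟨?_, fun h' => ?_⟩,
    fun o ho => ⟨?_, h.a_O o ho⟩, fun hb => ?_⟩
  · rintro rfl; exact hXT o h.ca_mem (h.sub ho)
  · exact lt_irrefl _ (h.rank_lt o ho _ h.ca_mem h').1
  · rintro rfl; exact hXT o h.cb_mem (h.sub ho)
  · exact lt_irrefl _ (h.rank_lt o ho _ h.cb_mem h').2
  · rintro rfl; exact lt_irrefl _ (h.rank_lt a ho _ h.ca_mem h.a_ca).1
  · exact lt_irrefl _ (h.rank_lt b hb _ h.cb_mem h.b_cb).2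

/-- The list closed up through `p0` is an induced cycle; if its length is divisible by three then
`Y` is thin. -/
lemma cycle_length_ne {d : ℕ} (htf : TriFree G) (hC : HypC G d) {A D E B : List V} {Y : Set V}
    {p0 γ e v : V}
    (hAs : ∃ x A', A = x :: A' ∧ G.Adj p0 x ∧ ∀ a ∈ A', Far G p0 a)
    (hBs : ∃ M y, B = M ++ [y] ∧ G.Adj p0 y ∧ ∀ m ∈ M, Far G p0 m)
    (hA : IndPath G (A ++ [γ])) (hD : IndPath G (γ :: (D ++ [e])))
    (hE : IndPath G (e :: (E ++ [v]))) (hB : IndPath G (v :: B))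
    (hp : ∀ z ∈ γ :: (D ++ e :: (E ++ [v])), Far G p0 z)
    (hAx : ∀ a ∈ A, ∀ z ∈ D ++ e :: (E ++ v :: B), Far G a z)
    (hDx : ∀ a ∈ γ :: D, ∀ z ∈ E ++ v :: B, Far G a z)
    (hEx : ∀ a ∈ e :: E, ∀ z ∈ B, Far G a z)
    (hYp : ∀ z ∈ Y, Far G p0 z) (hYA : ∀ a ∈ A, ∀ z ∈ Y, Far G a z)
    (hYD : ∀ a ∈ γ :: D, ∀ z ∈ Y, Far G a z) (hYB : ∀ a ∈ B, ∀ z ∈ Y, Far G a z)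
    (heY : e ∉ Y) (hvY : v ∉ Y)
    (hYE : Col G {z | z ∈ Y ∧ ∃ w ∈ E, z = w ∨ G.Adj z w} 8) (hY : ¬ Col G Y (d + 10)) :
    (A.length + D.length + E.length + B.length + 1) % 3 ≠ 0 := by
  intro hlen
  have h3 : IndPath G ((e :: E) ++ v :: B) := IndPath.glue (by simpa using hE) hB hEx
  have h2 : IndPath G ((γ :: D) ++ e :: (E ++ v :: B)) :=
    IndPath.glue (by simpa using hD) (by simpa using h3) hDx
  have h1 : IndPath G (A ++ γ :: (D ++ e :: (E ++ v :: B))) :=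
    IndPath.glue hA (by simpa using h2) hAx
  obtain ⟨x, A', rfl, hx, hA'⟩ := hAs
  obtain ⟨M, y, rfl, hy, hM⟩ := hBs
  have hcl : Closes G p0 (x :: A' ++ γ :: (D ++ e :: (E ++ v :: (M ++ [y])))) := by
    refine ⟨x, A' ++ γ :: (D ++ e :: (E ++ v :: M)), y, by simp, hx, hy, fun m hm => ?_⟩
    rcases List.mem_append.1 hm with hm | hm
    · exact hA' m hm
    · have : m ∈ γ :: (D ++ e :: (E ++ [v])) ∨ m ∈ M := by
        simp only [List.mem_cons, List.mem_append, List.not_mem_nil] at hm ⊢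
        tauto
      exact this.elim (hp m) (hM m)
  have hcol := hC p0 _ h1 hcl (by
    simp only [List.length_append, List.length_cons, List.length_nil] at hlen ⊢; omega)
  refine hY ((col_union hcol (col_union (col_union (htf.col_nbr e) (htf.col_nbr v)) hYE)).mono
    (fun z hz => ?_) (by omega))
  by_cases hze : G.Adj z e
  · exact Or.inr (Or.inl (Or.inl hze))
  by_cases hzv : G.Adj z v
  · exact Or.inr (Or.inl (Or.inr hzv))
  by_cases hzE : ∃ w ∈ E, z = w ∨ G.Adj z w
  · exact Or.inr (Or.inr ⟨hz, hzE⟩)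
  push Not at hzE
  refine Or.inl ⟨hYp z hz, fun w hw => ?_⟩
  have hw' : w ∈ x :: A' ∨ w ∈ γ :: D ∨ w = e ∨ w ∈ E ∨ w = v ∨ w ∈ M ++ [y] := by
    simp only [List.mem_cons, List.mem_append, List.not_mem_nil] at hw ⊢
    tauto
  rcases hw' with hw | hw | rfl | hw | rfl | hw
  · exact hYA w hw z hz
  · exact hYD w hw z hz
  · exact ⟨fun h => heY (h ▸ hz), fun h => hze h.symm⟩
  · exact ⟨(hzE w hw).1.symm, fun h => (hzE w hw).2 h.symm⟩
  · exact ⟨fun h => hvY (h ▸ hz), fun h => hzv h.symm⟩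
  · exact hYB w hw z hz

end Core

end

section

variable {V : Type} {G : SimpleGraph V}
variable {K O X T T' Y : Set V} {p0 γ u v cu cv e : V} {mid : V → List V} {tau : V → V}
  {rank : V → ℕ} {A0 A1 : List V}

lemma right_core {d r : ℕ} (htf : TriFree G) (hC : HypC G d) (ctx : Returns G K T p0 mid tau r)
    (hOK : O ⊆ K) (hXO : X ⊆ O) (hγK : γ ∈ K) (hp0O : ∀ o ∈ O, Far G p0 o) (hp0γ : Far G p0 γ)
    (hγX : ∀ x ∈ X, Far G γ x) (hγT : ∀ t ∈ T, Far G t γ) (hT' : T' ⊆ T)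
    (gr : Grading G X T' rank (d + 10) u v cu cv Y)
    (hA0 : Stem G O T p0 mid γ A0) (hA1 : Stem G O T p0 mid γ A1)
    (hlen : A1.length % 3 = (A0.length + 1) % 3)
    {D : List V} {e : V} (hpath : IndPath G (γ :: (D ++ [e]))) (hDO : ∀ p ∈ D, p ∈ O)
    (heOT : e ∈ O ∨ e ∈ T) (hDX : ∀ p ∈ D, ∀ x ∈ X, Far G p x)
    (hDc : ∀ p ∈ D, Far G p cu ∧ Far G p cv) (heu : Far G e u) (hev : Far G e v)
    (hecu : Far G e cu) (hecv : Far G e cv) (hemu : ∀ m ∈ mid cu, Far G e m)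
    (hemv : ∀ m ∈ mid cv, Far G e m) (heY : e ∉ Y) (heYadj : ∃ y ∈ Y, G.Adj e y) : False := by
  have hXK : X ⊆ K := hXO.trans hOK
  obtain ⟨hYcu, hYcv, huY, hvY⟩ := gr.far_Y
    (fun t ht htX => ctx.notMem t (hT' ht) (hXK htX))
  have hcuT : cu ∈ T := hT' gr.ca_mem
  have hcvT : cv ∈ T := hT' gr.cb_mem
  have huK : u ∈ K := hXK gr.a_mem
  have hvK : v ∈ K := hXK gr.b_mem
  have hYX : Y ⊆ X := gr.sub
  obtain ⟨y1, hy1, hey1⟩ := heYadj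
  obtain ⟨lev, hlev⟩ := exists_bfs (conn_insert gr.conn hy1 hey1) (Set.mem_insert e Y)
  obtain ⟨y, ⟨hyY, hvy⟩, hymin⟩ := exists_minimalFor_of_wellFoundedLT
    (fun y => y ∈ Y ∧ G.Adj v y) lev (let ⟨o, h1, h2⟩ := gr.b_O; ⟨o, h1, h2⟩)
  have hye : y ≠ e := fun h => heY (h ▸ hyY)
  obtain ⟨l, hl1, hl2, hl3, -⟩ := hlev.geo (Set.mem_insert e Y) (Set.mem_insert_of_mem e hyY) hye
  have hlY : ∀ z ∈ l, z ∈ Y := by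
    intro z hz
    rcases (hl2 z hz).1 with rfl | h
    · have := (hl2 z hz).2.1
      rw [hlev.zero] at this
      omega
    · exact h
  have hEY : ∀ z ∈ l ++ [y], z ∈ Y := by
    intro z hz
    rcases List.mem_append.1 hz with hz | hz
    · exact hlY z hz
    · rw [List.mem_singleton.1 hz]; exact hyY
  have hE : IndPath G (e :: ((l ++ [y]) ++ [v])) := by
    have : IndPath G ((e :: l) ++ [y, v]) := by
      refine IndPath.snoc (by simpa using hl1) hvy.symm fun a ha => ?_
      rcases List.mem_cons.1 ha with rfl | ha
      · exact hev
      · refine ⟨fun h => hvY (h ▸ hlY a ha), fun h => ?_⟩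
        have h1 := (hl2 a ha).2.2
        have h2 := hymin (j := a) ⟨hlY a ha, h.symm⟩ h1.le
        omega
    simpa using this
  have hYE : Col G {z | z ∈ Y ∧ ∃ w ∈ l ++ [y], z = w ∨ G.Adj z w} 8 := by
    refine (hlev.col_nbhd htf (E := l ++ [y]) (fun w hw => Or.inr (hEY w hw)) ?_).mono
      (fun z hz => ⟨Or.inr hz.1, hz.2⟩) le_rfl
    intro w hw w' hw' hww
    simp only [List.mem_append, List.mem_singleton] at hw hw'
    rcases hw with hw | rfl <;> rcases hw' with hw' | rfl
    · exact hl3 w hw w' hw' hww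
    · have := (hl2 w hw).2.2
      omega
    · have := (hl2 w' hw').2.2
      omega
    · rfl
  have hp0e : Far G p0 e := heOT.elim (hp0O e) (ctx.p0_far e)
  have hvcu : Far G v cu := by
    refine ⟨fun h => ctx.notMem cu hcuT (h ▸ hvK), fun h => ?_⟩
    exact htf v u cu gr.ab.symm gr.a_ca h
  have hucv : Far G u cv := by
    refine ⟨fun h => ctx.notMem cv hcvT (h ▸ huK), fun h => ?_⟩
    exact htf u v cv gr.ab gr.b_cb h
  have main : ∀ A, Stem G O T p0 mid γ A → ∀ c ∈ T, ∀ B', IndPath G (v :: (B' ++ c :: mid c)) →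
      (∀ b ∈ B', b = u) → (c = cu ∨ c = cv) →
      (A.length + D.length + (l ++ [y]).length + (B' ++ c :: mid c).length + 1) % 3 ≠ 0 := by
    intro A hA c hcT B' hB hB' hc
    obtain ⟨M, z0, hM, hz0, hMp⟩ := ctx.closes c hcT
    have hBmem : ∀ b ∈ B' ++ c :: mid c, b = u ∨ b = c ∨ b ∈ mid c := by
      intro b hb
      simp only [List.mem_append, List.mem_cons] at hb
      rcases hb with hb | hb
      · exact Or.inl (hB' b hb)
      · exact Or.inr hb
    have hYc : ∀ o ∈ Y, Far G o c := by rcases hc with rfl | rfl <;> assumption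
    refine cycle_length_ne (v := v) (Y := Y) htf hC hA.starts ?_ hA.path hpath hE hB ?_ ?_ ?_ ?_
      (fun z hz => hp0O z (hXO (hYX hz))) (fun a ha z hz => hA.far_O a ha z (hXO (hYX hz))) ?_ ?_
      heY hvY hYE gr.big
    · refine ⟨B' ++ c :: M, z0, by simp [hM], hz0, fun m hm => ?_⟩
      simp only [List.mem_append, List.mem_cons] at hm
      rcases hm with hm | rfl | hm
      · rw [hB' m hm]; exact hp0O u (hXO gr.a_mem)
      · exact ctx.p0_far m hcT
      · exact hMp m hm
    · intro z hz
      simp only [List.mem_append, List.mem_cons, List.not_mem_nil, or_false] at hz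
      rcases hz with rfl | hz | rfl | (hz | rfl) | rfl
      · exact hp0γ
      · exact hp0O z (hDO z hz)
      · exact hp0e
      · exact hp0O z (hXO (hYX (hlY z hz)))
      · exact hp0O z (hXO (hYX hyY))
      · exact hp0O z (hXO gr.b_mem)
    · intro a ha z hz
      have hz' : z ∈ D ∨ z = e ∨ z ∈ l ++ [y] ∨ z = v ∨ z ∈ B' ++ c :: mid c := by
        simp only [List.mem_append, List.mem_cons] at hz ⊢
        tauto
      rcases hz' with hz | rfl | hz | rfl | hz
      · exact hA.far_O a ha z (hDO z hz)
      · exact heOT.elim (hA.far_O a ha z) (hA.far_T a ha z)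
      · exact hA.far_O a ha z (hXO (hYX (hEY z hz)))
      · exact hA.far_O a ha z (hXO gr.b_mem)
      · rcases hBmem z hz with rfl | rfl | hz
        · exact hA.far_O a ha z (hXO gr.a_mem)
        · exact hA.far_T a ha z hcT
        · exact hA.far_mid a ha c hcT z hz
    · intro a ha z hz
      have hz' : z ∈ X ∨ z = c ∨ z ∈ mid c := by
        simp only [List.mem_append, List.mem_cons, List.not_mem_nil, or_false] at hz
        rcases hz with (hz | rfl) | rfl | hz | hz
        · exact Or.inl (hYX (hlY z hz))
        · exact Or.inl (hYX hyY)
        · exact Or.inl gr.b_mem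
        · rw [hB' z hz]; exact Or.inl gr.a_mem
        · exact Or.inr hz
      rcases List.mem_cons.1 ha with rfl | ha
      · rcases hz' with hz | rfl | hz
        · exact hγX z hz
        · exact (hγT z hcT).symm
        · exact ctx.far_mid a hγK c hcT z hz
      · rcases hz' with hz | rfl | hz
        · exact hDX a ha z hz
        · rcases hc with rfl | rfl
          · exact (hDc a ha).1
          · exact (hDc a ha).2
        · exact ctx.far_mid a (hOK (hDO a ha)) c hcT z hz
    · intro a ha z hz
      rcases List.mem_cons.1 ha with rfl | ha
      · rcases hBmem z hz with rfl | rfl | hz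
        · exact heu
        · rcases hc with rfl | rfl <;> assumption
        · rcases hc with rfl | rfl
          · exact hemu z hz
          · exact hemv z hz
      · rcases hBmem z hz with rfl | rfl | hz
        · exact (huY a (hEY a ha)).symm
        · exact hYc a (hEY a ha)
        · exact ctx.far_mid a (hXK (hYX (hEY a ha))) c hcT z hz
    · intro a ha z hz
      rcases List.mem_cons.1 ha with rfl | ha
      · exact hγX z (hYX hz)
      · exact hDX a ha z (hYX hz)
    · intro a ha z hz
      rcases hBmem a ha with rfl | rfl | ha
      · exact huY z hz
      · exact (hYc z hz).symm
      · exact (ctx.far_mid z (hXK (hYX hz)) c hcT a ha).symm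
  have hB0 : IndPath G (v :: ([] ++ cv :: mid cv)) :=
    ⟨gr.b_cb, ctx.far_mid v hvK cv hcvT, ctx.path cv hcvT⟩
  have hB1 : IndPath G (v :: ([u] ++ cu :: mid cu)) := by
    refine ⟨gr.ab.symm, ?_, gr.a_ca, ctx.far_mid u huK cu hcuT, ctx.path cu hcuT⟩
    intro z hz
    rcases List.mem_cons.1 hz with rfl | hz
    · exact hvcu
    · exact ctx.far_mid v hvK cu hcuT z hz
  have m00 := main A0 hA0 cv hcvT [] hB0 (by simp) (Or.inr rfl)
  have m01 := main A0 hA0 cu hcuT [u] hB1 (by simp) (Or.inl rfl)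
  have m10 := main A1 hA1 cv hcvT [] hB0 (by simp) (Or.inr rfl)
  have m11 := main A1 hA1 cu hcuT [u] hB1 (by simp) (Or.inl rfl)
  have l1 := ctx.length cu hcuT
  have l2 := ctx.length cv hcvT
  simp only [List.length_append, List.length_cons, List.length_nil] at m00 m01 m10 m11
  omega

lemma exists_injOn_nat [Finite V] : ∃ (idx : V → ℕ) (N : ℕ), Function.Injective idx ∧
    ∀ v, idx v < N := by
  obtain ⟨N, ⟨f⟩⟩ := Finite.exists_equiv_fin V
  exact ⟨fun v => f v, N, fun a b h => f.injective (Fin.ext h), fun v => (f v).2⟩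

/-- An injective refinement of a given grading. -/
lemma exists_refinement [Finite V] (lev : V → ℕ) : ∃ key : V → ℕ, Function.Injective key ∧
    ∀ a b, lev a < lev b → key a < key b := by
  obtain ⟨idx, N, h1, h2⟩ := exists_injOn_nat (V := V)
  have hlt : ∀ a b, lev a < lev b → lev a * N + idx a < lev b * N + idx b := by
    intro a b h
    have h3 := Nat.mul_le_mul_right N (show lev a + 1 ≤ lev b from h)
    have := h2 a
    rw [add_mul] at h3
    omega
  refine ⟨fun v => lev v * N + idx v, fun a b hab => ?_, hlt⟩
  rcases lt_trichotomy (lev a) (lev b) with h | h | h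
  · exact absurd hab (hlt a b h).ne
  · simp only [h] at hab
    exact h1 (by omega)
  · exact absurd hab (hlt b a h).ne'

end

section

variable {V : Type} {G : SimpleGraph V}
variable {K O X T : Set V} {p0 γ : V} {mid : V → List V} {tau : V → V}
  {A0 A1 : List V} {d r τ j : ℕ} {lev : V → ℕ}

lemma exists_antitone_refinement [Finite V] (f : V → ℕ) : ∃ rank : V → ℕ,
    Function.Injective rank ∧ ∀ a b, rank a < rank b → f b ≤ f a := by
  obtain ⟨N, hN⟩ := (Set.finite_range f).bddAbove
  obtain ⟨rank, h1, h2⟩ := exists_refinement (fun v => N - f v)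
  refine ⟨rank, h1, fun a b hab => ?_⟩
  by_contra h
  have ha : f a ≤ N := hN ⟨a, rfl⟩
  have hb : f b ≤ N := hN ⟨b, rfl⟩
  have := h2 b a (by omega)
  omega

lemma col_ball2_list (h2 : ∀ w, Col G (Ball2 G w) τ) (L : List V) :
    Col G {y | ∃ w ∈ L, y ∈ Ball2 G w} (L.length * τ) := by
  induction L with
  | nil => exact ⟨fun _ => 0, by simp, by simp⟩
  | cons a L ih =>
    refine (col_union (h2 a) ih).mono ?_ (by simp [add_mul]; omega)
    rintro y ⟨w, hw, hy⟩
    rcases List.mem_cons.1 hw with rfl | hw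
    · exact Or.inl hy
    · exact Or.inr ⟨w, hw, hy⟩

lemma exists_outside {Y : Set V} {n : ℕ} (h2 : ∀ w, Col G (Ball2 G w) τ) (L : List V)
    (hY : ¬ Col G Y (L.length * τ + n)) : ∃ y ∈ Y, ∀ w ∈ L, y ∉ Ball2 G w := by
  obtain ⟨y, hy, hn⟩ := exists_mem_notMem hY
    ((col_ball2_list h2 L).mono subset_rfl (Nat.le_add_right _ n))
  exact ⟨y, hy, fun w hw h => hn ⟨w, hw, h⟩⟩

lemma right_low [Finite V] (htf : TriFree G) (hC : HypC G d) (h2 : ∀ w, Col G (Ball2 G w) τ)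
    (ctx : Returns G K T p0 mid tau r)
    (hOK : O ⊆ K) (hXO : X ⊆ O) (hγK : γ ∈ K) (hp0O : ∀ o ∈ O, Far G p0 o) (hp0γ : Far G p0 γ)
    (hγX : ∀ x ∈ X, Far G γ x) (hγT : ∀ t ∈ T, Far G t γ)
    (hA0 : Stem G O T p0 mid γ A0) (hA1 : Stem G O T p0 mid γ A1)
    (hlen : A1.length % 3 = (A0.length + 1) % 3)
    (hlev : IsBfs G (insert γ O) γ lev) (hγO : γ ∉ O) (hXj : ∀ x ∈ X, lev x = j)
    (hX : ∀ x ∈ X, ∃ t ∈ T, G.Adj x t ∧ ∃ o ∈ O, G.Adj o t ∧ lev o + 2 ≤ j) :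
    Col G X (8 * τ + d + 10 + 3) := by
  by_contra hbig
  obtain ⟨key, hkinj, hkey⟩ := exists_refinement lev
  set T' : Set V := {t | t ∈ T ∧ ∃ o ∈ O, G.Adj o t ∧ lev o + 2 ≤ j} with hT'
  have hT'T : T' ⊆ T := fun t ht => ht.1
  have hb : ∀ t ∈ T', ∃ b ∈ O, G.Adj b t ∧ lev b + 2 ≤ j ∧
      ∀ o ∈ O, G.Adj o t → key b ≤ key o := by
    rintro t ⟨ht, o, ho, hot, hoj⟩
    obtain ⟨b, ⟨hb, hbt⟩, hmin⟩ := exists_minimalFor_of_wellFoundedLT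
      (fun o => o ∈ O ∧ G.Adj o t) key ⟨o, ho, hot⟩
    have hmin' : ∀ o ∈ O, G.Adj o t → key b ≤ key o := fun o ho hot => by
      rcases le_total (key b) (key o) with h | h
      · exact h
      · exact hmin ⟨ho, hot⟩ h
    refine ⟨b, hb, hbt, ?_, hmin'⟩
    by_contra h
    have h3 := hkey o b (by omega)
    have h4 := hmin' o ho hot
    omega
  choose! b hbO hbt hbj hbmin using hb
  obtain ⟨rank, hrinj, hrank⟩ := exists_antitone_refinement (fun t => key (b t))
  obtain ⟨u, v, cu, cv, Y, gr⟩ := exists_grading htf (T := T') hrinj.injOn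
    (n := 8 * τ + d + 10) (X := X)
    (fun x hx => let ⟨t, ht, hxt, h⟩ := hX x hx; ⟨t, ⟨ht, h⟩, hxt⟩) hbig
  have gr' : Grading G X T' rank (d + 10) u v cu cv Y :=
    { gr with big := fun h => gr.big (h.mono subset_rfl (by omega)) }
  obtain ⟨y, hyY, hy⟩ := exists_outside (n := d + 10) h2
    [u, v, cu, cv, b cu, b cv, tau cu, tau cv]
    (fun h => gr.big (h.mono subset_rfl (by simp only [List.length_cons, List.length_nil]; omega)))
  simp only [List.mem_cons, List.not_mem_nil, or_false, forall_eq_or_imp, forall_eq] at hy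
  obtain ⟨yu, yv, ycu, ycv, ybu, ybv, ytu, ytv⟩ := hy
  have hXK : X ⊆ K := hXO.trans hOK
  have hyX : y ∈ X := gr.sub hyY
  obtain ⟨t, ht, hyt, h⟩ := hX y hyX
  have htT' : t ∈ T' := ⟨ht, h⟩
  have hbK : b t ∈ K := hOK (hbO t htT')
  have hbγ : b t ≠ γ := fun h => hγO (h ▸ hbO t htT')
  have htK : t ∉ K := ctx.notMem t ht
  obtain ⟨l, hl1, hl2, -, -⟩ := hlev.geo (Set.mem_insert γ O)
    (Set.mem_insert_of_mem γ (hbO t htT')) hbγ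
  have hlO : ∀ z ∈ l, z ∈ O := by
    intro z hz
    rcases (hl2 z hz).1 with rfl | h
    · have := (hl2 z hz).2.1
      rw [hlev.zero] at this
      omega
    · exact h
  have hD : ∀ p ∈ l ++ [b t], p ∈ O ∧ key p ≤ key (b t) ∧ lev p + 2 ≤ j := by
    intro p hp
    have hbtj := hbj t htT'
    rcases List.mem_append.1 hp with hp | hp
    · have h1 := (hl2 p hp).2.2
      have := hkey p (b t) h1
      exact ⟨hlO p hp, by omega, by omega⟩
    · rw [List.mem_singleton.1 hp]
      exact ⟨hbO t htT', le_rfl, hbtj⟩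
  have hr := gr.rank_lt y hyY t htT' hyt
  have key_lt : ∀ c ∈ T', rank c < rank t → y ∉ Ball2 G (b c) → key (b t) < key (b c) := by
    intro c hc hct hyc
    refine lt_of_le_of_ne (hrank c t hct) fun h => hyc ?_
    rw [← hkinj h]
    exact ⟨t, hyt, (hbt t htT').symm⟩
  have hku := key_lt cu gr.ca_mem hr.1 ybu
  have hkv := key_lt cv gr.cb_mem hr.2 ybv
  refine right_core htf hC ctx hOK hXO hγK hp0O hp0γ hγX hγT hT'T gr' hA0 hA1 hlen
    (D := l ++ [b t]) (e := t) ?_ (fun p hp => (hD p hp).1) (Or.inr ht) ?_ ?_ ?_ ?_ ?_ ?_ ?_ ?_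
    (fun h => htK (hXK (gr.sub h))) ⟨y, hyY, hyt.symm⟩
  · have : IndPath G ((γ :: l) ++ [b t, t]) := by
      refine IndPath.snoc (by simpa using hl1) (hbt t htT') fun a ha => ?_
      rcases List.mem_cons.1 ha with rfl | ha
      · exact (hγT t ht).symm
      · refine ⟨fun h => htK (h ▸ hOK (hlO a ha)), fun h => ?_⟩
        have h1 := hkey a (b t) (hl2 a ha).2.2
        have h2 := hbmin t htT' a (hlO a ha) h
        omega
    simpa using this
  · intro p hp x hx
    have := (hD p hp).2.2
    have hxj := hXj x hx
    exact hlev.far (Or.inr (hD p hp).1) (Or.inr (hXO hx)) (by omega)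
  · intro p hp
    have h1 := (hD p hp).2.1
    have hpK := hOK (hD p hp).1
    refine ⟨⟨fun h => ctx.notMem cu (hT'T gr.ca_mem) (h ▸ hpK), fun h => ?_⟩,
      ⟨fun h => ctx.notMem cv (hT'T gr.cb_mem) (h ▸ hpK), fun h => ?_⟩⟩
    · have := hbmin cu gr.ca_mem p (hD p hp).1 h
      omega
    · have := hbmin cv gr.cb_mem p (hD p hp).1 h
      omega
  · exact ⟨fun h => htK (h ▸ hXK gr.a_mem), fun h => yu ⟨t, hyt, h⟩⟩
  · exact ⟨fun h => htK (h ▸ hXK gr.b_mem), fun h => yv ⟨t, hyt, h⟩⟩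
  · exact ⟨fun h => (h ▸ hr.1).false, fun h => ycu ⟨t, hyt, h⟩⟩
  · exact ⟨fun h => (h ▸ hr.2).false, fun h => ycv ⟨t, hyt, h⟩⟩
  · exact ctx.far_mid' cu (hT'T gr.ca_mem) t ht fun h => ytu ⟨t, hyt, h⟩
  · exact ctx.far_mid' cv (hT'T gr.cb_mem) t ht fun h => ytv ⟨t, hyt, h⟩

lemma right_high [Finite V] (htf : TriFree G) (hC : HypC G d) (h2 : ∀ w, Col G (Ball2 G w) τ)
    (ctx : Returns G K T p0 mid tau r)
    (hOK : O ⊆ K) (hXO : X ⊆ O) (hγK : γ ∈ K) (hp0O : ∀ o ∈ O, Far G p0 o) (hp0γ : Far G p0 γ)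
    (hγX : ∀ x ∈ X, Far G γ x) (hγT : ∀ t ∈ T, Far G t γ)
    (hA0 : Stem G O T p0 mid γ A0) (hA1 : Stem G O T p0 mid γ A1)
    (hlen : A1.length % 3 = (A0.length + 1) % 3)
    (hlev : IsBfs G (insert γ O) γ lev) (hγO : γ ∉ O) (hXj : ∀ x ∈ X, lev x = j) (hj : 2 ≤ j)
    (hX : ∀ x ∈ X, ∃ t ∈ T, G.Adj x t ∧ ¬ ∃ o ∈ O, G.Adj o t ∧ lev o + 2 ≤ j) :
    Col G X (8 * τ + d + 10 + 3) := by
  by_contra hbig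
  obtain ⟨rank, -, hrinj, -⟩ := exists_injOn_nat (V := V)
  set T' : Set V := {t | t ∈ T ∧ ¬ ∃ o ∈ O, G.Adj o t ∧ lev o + 2 ≤ j} with hT'
  have hT'T : T' ⊆ T := fun t ht => ht.1
  obtain ⟨u, v, cu, cv, Y, gr⟩ := exists_grading htf (T := T') hrinj.injOn
    (n := 8 * τ + d + 10) (X := X)
    (fun x hx => let ⟨t, ht, hxt, h⟩ := hX x hx; ⟨t, ⟨ht, h⟩, hxt⟩) hbig
  have gr' : Grading G X T' rank (d + 10) u v cu cv Y :=
    { gr with big := fun h => gr.big (h.mono subset_rfl (by omega)) }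
  obtain ⟨y, hyY, hy⟩ := exists_outside (n := d + 10) h2 [u, v, cu, cv]
    (fun h => gr.big (h.mono subset_rfl (by simp only [List.length_cons, List.length_nil]; omega)))
  simp only [List.mem_cons, List.not_mem_nil, or_false, forall_eq_or_imp, forall_eq] at hy
  obtain ⟨yu, yv, ycu, ycv⟩ := hy
  have hXK : X ⊆ K := hXO.trans hOK
  have hyX : y ∈ X := gr.sub hyY
  have hyj := hXj y hyX
  obtain ⟨s, hs, hys, hsl⟩ := hlev.pred y (Or.inr (hXO hyX)) (fun h => hγO (h ▸ hXO hyX))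
  have hsγ : s ≠ γ := by
    rintro rfl
    have := hlev.zero
    omega
  have hsO : s ∈ O := hs.resolve_left hsγ
  obtain ⟨l, hl1, hl2, -, -⟩ := hlev.geo (Set.mem_insert γ O) hs hsγ
  have hlO : ∀ z ∈ l, z ∈ O := by
    intro z hz
    rcases (hl2 z hz).1 with rfl | h
    · have := (hl2 z hz).2.1
      rw [hlev.zero] at this
      omega
    · exact h
  have hsX : ∀ x ∈ X, s ≠ x := by
    rintro x hx rfl
    have := hXj s hx
    omega
  have hfar : ∀ c ∈ T', ∀ p ∈ l, Far G p c := by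
    intro c hc p hp
    have h1 := (hl2 p hp).2.2
    exact ⟨fun h => ctx.notMem c hc.1 (h ▸ hOK (hlO p hp)),
      fun h => hc.2 ⟨p, hlO p hp, h, by omega⟩⟩
  have hsK : s ∈ K := hOK hsO
  refine right_core htf hC ctx hOK hXO hγK hp0O hp0γ hγX hγT hT'T gr' hA0 hA1 hlen
    (D := l) (e := s) hl1 hlO (Or.inl hsO) ?_
    (fun p hp => ⟨hfar cu gr.ca_mem p hp, hfar cv gr.cb_mem p hp⟩)
    ⟨hsX u gr.a_mem, fun h => yu ⟨s, hys, h⟩⟩ ⟨hsX v gr.b_mem, fun h => yv ⟨s, hys, h⟩⟩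
    ⟨fun h => ctx.notMem cu (hT'T gr.ca_mem) (h ▸ hsK), fun h => ycu ⟨s, hys, h⟩⟩
    ⟨fun h => ctx.notMem cv (hT'T gr.cb_mem) (h ▸ hsK), fun h => ycv ⟨s, hys, h⟩⟩
    (ctx.far_mid s hsK cu (hT'T gr.ca_mem)) (ctx.far_mid s hsK cv (hT'T gr.cb_mem))
    (fun h => hsX s (gr.sub h) rfl) ⟨y, hyY, hys.symm⟩
  intro p hp x hx
  have h1 := (hl2 p hp).2.2
  have hxj := hXj x hx
  exact hlev.far (Or.inr (hlO p hp)) (Or.inr (hXO hx)) (by omega)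

lemma right_bound [Finite V] (htf : TriFree G) (hC : HypC G d) (h2 : ∀ w, Col G (Ball2 G w) τ)
    (ctx : Returns G K T p0 mid tau r) (hOK : O ⊆ K) (hXO : X ⊆ O) (hγK : γ ∈ K) (hγO : γ ∉ O)
    (hOc : Conn G O) (hγadj : ∃ o ∈ O, G.Adj γ o)
    (hp0O : ∀ o ∈ O, Far G p0 o) (hp0γ : Far G p0 γ) (hγT : ∀ t ∈ T, Far G t γ)
    (hA0 : Stem G O T p0 mid γ A0) (hA1 : Stem G O T p0 mid γ A1)
    (hlen : A1.length % 3 = (A0.length + 1) % 3) (hX : ∀ x ∈ X, ∃ t ∈ T, G.Adj x t) :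
    Col G X (2 * (16 * τ + 2 * d + 26)) := by
  by_contra hbig
  obtain ⟨o, ho, hγo⟩ := hγadj
  obtain ⟨lev, hlev⟩ := exists_bfs (conn_insert hOc ho hγo) (Set.mem_insert γ O)
  obtain ⟨j, hj⟩ := exists_level lev
    (fun u hu v hv huv => hlev.step u (Or.inr (hXO hu)) v (Or.inr (hXO hv)) huv) hbig
  have hj2 : 2 ≤ j := by
    by_contra h
    refine hj ((htf.col_nbr γ).mono ?_ (by omega))
    rintro x ⟨hx, hxj⟩
    have hxγ : x ≠ γ := fun h => hγO (h ▸ hXO hx)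
    obtain ⟨y, hy, hxy, hl⟩ := hlev.pred x (Or.inr (hXO hx)) hxγ
    rw [← hlev.eq_of_zero y hy (by omega)]
    exact hxy
  have hγfar : ∀ x, x ∈ X ∧ lev x = j → Far G γ x := fun x hx =>
    hlev.far (Set.mem_insert γ O) (Or.inr (hXO hx.1)) (by rw [hlev.zero, hx.2]; omega)
  have c1 := right_low (X := {x | (x ∈ X ∧ lev x = j) ∧
      ∃ t ∈ T, G.Adj x t ∧ ∃ o ∈ O, G.Adj o t ∧ lev o + 2 ≤ j}) (j := j) htf hC h2 ctx hOK
    (fun x hx => hXO hx.1.1) hγK hp0O hp0γ (fun x hx => hγfar x hx.1) hγT hA0 hA1 hlen hlev hγO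
    (fun x hx => hx.1.2) (fun x hx => hx.2)
  have c2 := right_high (X := {x | (x ∈ X ∧ lev x = j) ∧
      ∃ t ∈ T, G.Adj x t ∧ ¬ ∃ o ∈ O, G.Adj o t ∧ lev o + 2 ≤ j}) (j := j) htf hC h2 ctx hOK
    (fun x hx => hXO hx.1.1) hγK hp0O hp0γ (fun x hx => hγfar x hx.1) hγT hA0 hA1 hlen hlev hγO
    (fun x hx => hx.1.2) hj2 (fun x hx => hx.2)
  refine hj ((col_union c1 c2).mono ?_ (by omega))
  rintro x ⟨hx, hxj⟩
  obtain ⟨t, ht, hxt⟩ := hX x hx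
  by_cases h : ∃ o ∈ O, G.Adj o t ∧ lev o + 2 ≤ j
  · exact Or.inl ⟨⟨hx, hxj⟩, t, ht, hxt, h⟩
  · exact Or.inr ⟨⟨hx, hxj⟩, t, ht, hxt, h⟩

end

section

variable {V : Type} {G : SimpleGraph V}
variable {K X T Cs : Set V} {p0 : V} {mid pre : V → List V} {tau : V → V} {rank : V → ℕ}
  {d r s τ n : ℕ}

/-- The stem ending in `c` is anticomplete to `t` and to the return path of `t`. -/
def Clean (G : SimpleGraph V) (pre mid : V → List V) (c t : V) : Prop :=
  ∀ a ∈ pre c ++ [c], Far G a t ∧ ∀ m ∈ mid t, Far G a m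

lemma IndPath.starts {p : V} {L : List V} (hL : L ≠ []) (h : IndPath G (p :: L)) :
    ∃ x A', L = x :: A' ∧ G.Adj p x ∧ ∀ a ∈ A', Far G p a := by
  cases L with
  | nil => exact absurd rfl hL
  | cons x A' => exact ⟨x, A', rfl, h.1, h.2.1⟩

lemma left_bound [Finite V] (htf : TriFree G) (hC : HypC G d) (h2 : ∀ w, Col G (Ball2 G w) τ)
    (ctx : Returns G K T p0 mid tau r) (hXK : X ⊆ K) (hXT : ∀ x ∈ X, ∃ t ∈ T, G.Adj x t)
    (hp0X : ∀ x ∈ X, Far G p0 x) (hrank : Set.InjOn rank Cs)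
    (hpre : ∀ c ∈ Cs, IndPath G (p0 :: (pre c ++ [c])))
    (hpreX : ∀ c ∈ Cs, ∀ a ∈ pre c, ∀ x ∈ X, Far G a x)
    (hprelen : ∀ c ∈ Cs, (pre c).length % 3 = s) (hCsX : ∀ c ∈ Cs, c ∉ X)
    (hXCs : ∀ x ∈ X, ∃ c ∈ Cs, G.Adj x c)
    (hclean : ∀ c ∈ Cs, ∀ Z ⊆ X, (∀ z ∈ Z, ∀ c' ∈ Cs, G.Adj z c' → rank c < rank c') →
      Col G {z | z ∈ Z ∧ ∃ t ∈ T, G.Adj z t ∧ ¬ Clean G pre mid c t} n) :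
    Col G X (34 * τ + 4 * d + 2 * n + 55) := by
  by_contra hbig
  obtain ⟨γ1, γ, c1, c0, O, gr⟩ := exists_grading htf hrank hXCs
    (n := 34 * τ + 4 * d + 2 * n + 52) hbig
  obtain ⟨hO1, hO0, hOγ1, hγO⟩ := gr.far_Y hCsX
  set T' : Set V := {t | t ∈ T ∧ ¬ G.Adj t γ ∧ ¬ G.Adj t γ1 ∧ Clean G pre mid c0 t ∧
    Clean G pre mid c1 t} with hT'
  have hT'T : T' ⊆ T := fun t ht => ht.1
  have hγK : γ ∈ K := hXK gr.b_mem
  have hγ1K : γ1 ∈ K := hXK gr.a_mem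
  have st0 : Stem G O T' p0 mid γ (pre c0 ++ [c0]) := by
    refine ⟨IndPath.starts (by simp) (hpre c0 gr.cb_mem), ?_, ?_, ?_, ?_⟩
    · have := IndPath.snoc (hpre c0 gr.cb_mem).tail gr.b_cb.symm
        (fun a ha => hpreX c0 gr.cb_mem a ha γ gr.b_mem)
      simpa using this
    · intro a ha o ho
      rcases List.mem_append.1 ha with ha | ha
      · exact hpreX c0 gr.cb_mem a ha o (gr.sub ho)
      · rw [List.mem_singleton.1 ha]
        exact (hO0 o ho).symm
    · exact fun a ha t ht => (ht.2.2.2.1 a ha).1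
    · exact fun a ha t ht => (ht.2.2.2.1 a ha).2
  have st1 : Stem G O T' p0 mid γ (pre c1 ++ [c1, γ1]) := by
    have hmem : ∀ a ∈ pre c1 ++ [c1, γ1], a ∈ pre c1 ++ [c1] ∨ a = γ1 := by
      intro a ha
      simp only [List.mem_append, List.mem_cons, List.not_mem_nil, or_false] at ha ⊢
      tauto
    refine ⟨?_, ?_, ?_, ?_, ?_⟩
    · obtain ⟨x, A', h, hx, hA'⟩ := IndPath.starts (by simp) (hpre c1 gr.ca_mem)
      refine ⟨x, A' ++ [γ1], ?_, hx, fun a ha => ?_⟩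
      · rw [← List.cons_append, ← h]; simp
      · rcases List.mem_append.1 ha with ha | ha
        · exact hA' a ha
        · rw [List.mem_singleton.1 ha]
          exact hp0X γ1 gr.a_mem
    · have h1 := IndPath.snoc (hpre c1 gr.ca_mem).tail gr.a_ca.symm
        (fun a ha => hpreX c1 gr.ca_mem a ha γ1 gr.a_mem)
      have h2 := IndPath.snoc (A := pre c1 ++ [c1]) (x := γ1) (y := γ) (by simpa using h1)
        gr.ab ?_
      · simpa using h2
      · intro a ha
        rcases List.mem_append.1 ha with ha | ha
        · exact hpreX c1 gr.ca_mem a ha γ gr.b_mem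
        · rw [List.mem_singleton.1 ha]
          exact ⟨fun h => hCsX c1 gr.ca_mem (h ▸ gr.b_mem), htf c1 γ1 γ gr.a_ca.symm gr.ab⟩
    · intro a ha o ho
      rcases hmem a ha with ha | rfl
      · rcases List.mem_append.1 ha with ha | ha
        · exact hpreX c1 gr.ca_mem a ha o (gr.sub ho)
        · rw [List.mem_singleton.1 ha]
          exact (hO1 o ho).symm
      · exact hOγ1 o ho
    · intro a ha t ht
      rcases hmem a ha with ha | rfl
      · exact (ht.2.2.2.2 a ha).1
      · exact ⟨fun h => ctx.notMem t ht.1 (h ▸ hγ1K), fun h => ht.2.2.1 h.symm⟩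
    · intro a ha t ht
      rcases hmem a ha with ha | rfl
      · exact (ht.2.2.2.2 a ha).2
      · exact ctx.far_mid a hγ1K t ht.1
  have hc := right_bound (X := {x | x ∈ O ∧ ∃ t ∈ T', G.Adj x t}) htf hC h2 (ctx.mono hT'T)
    (gr.sub.trans hXK) (fun x hx => hx.1) hγK hγO gr.conn gr.b_O (fun o ho => hp0X o (gr.sub ho))
    (hp0X γ gr.b_mem)
    (fun t ht => ⟨fun h => ctx.notMem t ht.1 (h ▸ hγK), ht.2.1⟩) st0 st1
    (by
      have e0 := hprelen c0 gr.cb_mem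
      have e1 := hprelen c1 gr.ca_mem
      simp only [List.length_append, List.length_cons, List.length_nil]
      omega)
    (fun x hx => hx.2)
  have d0 := hclean c0 gr.cb_mem O gr.sub (fun z hz c' hc' h => (gr.rank_lt z hz c' hc' h).2)
  have d1 := hclean c1 gr.ca_mem O gr.sub (fun z hz c' hc' h => (gr.rank_lt z hz c' hc' h).1)
  refine gr.big ((col_union hc (col_union (col_union (h2 γ) (h2 γ1)) (col_union d0 d1))).mono
    (fun x hx => ?_) (by omega))
  obtain ⟨t, ht, hxt⟩ := hXT x (gr.sub hx)
  by_cases e1 : G.Adj t γ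
  · exact Or.inr (Or.inl (Or.inl ⟨t, hxt, e1⟩))
  by_cases e2 : G.Adj t γ1
  · exact Or.inr (Or.inl (Or.inr ⟨t, hxt, e2⟩))
  by_cases e3 : Clean G pre mid c0 t
  · by_cases e4 : Clean G pre mid c1 t
    · exact Or.inl ⟨hx, t, ⟨ht, e1, e2, e3, e4⟩, hxt⟩
    · exact Or.inr (Or.inr (Or.inr ⟨hx, t, ht, hxt, e4⟩))
  · exact Or.inr (Or.inr (Or.inl ⟨hx, t, ht, hxt, e3⟩))

end

section

variable {V : Type} {G : SimpleGraph V}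
variable {K X T : Set V} {p0 : V} {mid : V → List V} {tau : V → V} {lev : V → ℕ}
  {d r τ n j : ℕ}

lemma IsBfs.geo_insert (hlev : IsBfs G (insert p0 K) p0 lev) {q : V} (hq : q ∈ K)
    (hqp : q ≠ p0) : ∃ l : List V, IndPath G (p0 :: (l ++ [q])) ∧
      (∀ a ∈ l, a ∈ K ∧ lev a < lev q) ∧ l.length + 1 = lev q := by
  obtain ⟨l, h1, h2, -, h4⟩ := hlev.geo (Set.mem_insert p0 K) (Or.inr hq) hqp
  refine ⟨l, h1, fun a ha => ⟨?_, (h2 a ha).2.2⟩, h4⟩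
  refine (h2 a ha).1.resolve_left ?_
  rintro rfl
  have := (h2 a ha).2.1
  rw [hlev.zero] at this
  omega

lemma left_layer [Finite V] (htf : TriFree G) (hC : HypC G d) (h2 : ∀ w, Col G (Ball2 G w) τ)
    (ctx : Returns G K T p0 mid tau r) (hXK : X ⊆ K) (hXT : ∀ x ∈ X, ∃ t ∈ T, G.Adj x t)
    (hp0K : p0 ∉ K) (hlev : IsBfs G (insert p0 K) p0 lev) (hXj : ∀ x ∈ X, lev x = j) (hj : 2 ≤ j)
    (hclean : ∀ c ∈ K, lev c + 1 = j → ∀ l : List V, (∀ a ∈ l, a ∈ K ∧ lev a < lev c) →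
      l.length + 1 = lev c →
      Col G {z | ∃ t ∈ T, G.Adj z t ∧ ∃ a ∈ l ++ [c], G.Adj a t} n) :
    Col G X (34 * τ + 4 * d + 2 * n + 55) := by
  obtain ⟨rank, -, hrinj, -⟩ := exists_injOn_nat (V := V)
  have hne : ∀ q ∈ K, q ≠ p0 := fun q hq h => hp0K (h ▸ hq)
  have hpre : ∀ q ∈ {q | q ∈ K ∧ lev q + 1 = j}, ∃ l : List V, IndPath G (p0 :: (l ++ [q])) ∧
      (∀ a ∈ l, a ∈ K ∧ lev a < lev q) ∧ l.length + 1 = lev q :=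
    fun q hq => hlev.geo_insert hq.1 (hne q hq.1)
  choose! pre pre1 pre2 pre3 using hpre
  refine left_bound (Cs := {q | q ∈ K ∧ lev q + 1 = j}) (s := (j - 2) % 3) (pre := pre)
    (rank := rank) htf hC h2 ctx hXK hXT ?_ hrinj.injOn pre1 ?_ ?_ ?_ ?_ ?_
  · intro x hx
    exact hlev.far (Set.mem_insert p0 K) (Or.inr (hXK hx)) (by rw [hlev.zero, hXj x hx]; omega)
  · intro c hc a ha x hx
    have h := pre2 c hc a ha
    have := hXj x hx
    have := hc.2
    exact hlev.far (Or.inr h.1) (Or.inr (hXK hx)) (by omega)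
  · intro c hc
    have := pre3 c hc
    have := hc.2
    congr 1
    omega
  · intro c hc hcX
    have := hXj c hcX
    have := hc.2
    omega
  · intro x hx
    obtain ⟨y, hy, hxy, hl⟩ := hlev.pred x (Or.inr (hXK hx)) (hne x (hXK hx))
    have hxj := hXj x hx
    refine ⟨y, ⟨hy.resolve_left ?_, by omega⟩, hxy⟩
    rintro rfl
    have := hlev.zero
    omega
  · intro c hc Z hZ _
    refine (hclean c hc.1 hc.2 (pre c) (pre2 c hc) (pre3 c hc)).mono ?_ le_rfl
    rintro z ⟨hz, t, ht, hzt, hcl⟩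
    refine ⟨t, ht, hzt, ?_⟩
    by_contra hno
    push Not at hno
    refine hcl fun a ha => ?_
    have haK : a ∈ K := by
      rcases List.mem_append.1 ha with ha | ha
      · exact (pre2 c hc a ha).1
      · rw [List.mem_singleton.1 ha]; exact hc.1
    exact ⟨⟨fun h => ctx.notMem t ht (h ▸ haK), hno a ha⟩, ctx.far_mid a haK t ht⟩

lemma left_high [Finite V] (htf : TriFree G) (hC : HypC G d) (h2 : ∀ w, Col G (Ball2 G w) τ)
    (ctx : Returns G K T p0 mid tau r) (hXK : X ⊆ K) (hXT : ∀ x ∈ X, ∃ t ∈ T, G.Adj x t)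
    (hp0K : p0 ∉ K) (hlev : IsBfs G (insert p0 K) p0 lev) (hXj : ∀ x ∈ X, lev x = j) (hj : 2 ≤ j)
    (hT : ∀ t ∈ T, ∀ y ∈ K, G.Adj y t → j ≤ lev y + 1) :
    Col G X (40 * τ + 4 * d + 55) := by
  refine (left_layer (n := τ) htf hC h2 ctx hXK hXT hp0K hlev hXj hj ?_).mono subset_rfl (by omega)
  intro c hc hcj l hl hlen
  refine (h2 c).mono ?_ le_rfl
  rintro z ⟨t, ht, hzt, a, ha, hat⟩
  rcases List.mem_append.1 ha with ha | ha
  · have h := hl a ha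
    have := hT t ht a h.1 hat
    omega
  · rw [List.mem_singleton.1 ha] at hat
    exact ⟨t, hzt, hat.symm⟩

lemma left_near [Finite V] (htf : TriFree G) (hC : HypC G d) (h2 : ∀ w, Col G (Ball2 G w) τ)
    (ctx : Returns G K T p0 mid tau r) (hXK : X ⊆ K) (hXT : ∀ x ∈ X, ∃ t ∈ T, G.Adj x t)
    (hp0K : p0 ∉ K) (hlev : IsBfs G (insert p0 K) p0 lev) (hXj : ∀ x ∈ X, lev x = j) (hj : 2 ≤ j)
    (hj4 : j ≤ 4) :
    Col G X (40 * τ + 4 * d + 55) := by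
  refine (left_layer (n := 3 * τ) htf hC h2 ctx hXK hXT hp0K hlev hXj hj ?_).mono subset_rfl
    (by omega)
  intro c hc hcj l hl hlen
  refine (col_ball2_list h2 (l ++ [c])).mono ?_ (Nat.mul_le_mul_right _ (by simp; omega))
  rintro z ⟨t, ht, hzt, a, ha, hat⟩
  exact ⟨a, ha, t, hzt, hat.symm⟩

lemma left_low [Finite V] (htf : TriFree G) (hC : HypC G d) (h2 : ∀ w, Col G (Ball2 G w) τ)
    (h3 : ∀ w, Col G (Ball3 G w) τ)
    (ctx : Returns G K T p0 mid tau r) (hXK : X ⊆ K) (hXT : ∀ x ∈ X, ∃ t ∈ T, G.Adj x t)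
    (hp0K : p0 ∉ K) (hlev : IsBfs G (insert p0 K) p0 lev) (hXj : ∀ x ∈ X, lev x = j) (hj : 2 ≤ j)
    (hT : ∀ t ∈ T, ∃ y ∈ K, G.Adj y t ∧ lev y + 2 ≤ j) (htau : ∀ t ∈ T, G.Adj t (tau t)) :
    Col G X (3 * (40 * τ + 4 * d + 55)) := by
  have hne : ∀ q ∈ K, q ≠ p0 := fun q hq h => hp0K (h ▸ hq)
  have hb : ∀ t ∈ T, ∃ b ∈ K, G.Adj b t ∧ lev b + 2 ≤ j ∧
      ∀ y ∈ K, G.Adj y t → lev b ≤ lev y := by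
    intro t ht
    obtain ⟨y, hy, hyt, hyj⟩ := hT t ht
    obtain ⟨b, ⟨hb, hbt⟩, hmin⟩ := exists_minimalFor_of_wellFoundedLT
      (fun o => o ∈ K ∧ G.Adj o t) lev ⟨y, hy, hyt⟩
    have hmin' : ∀ o ∈ K, G.Adj o t → lev b ≤ lev o := fun o ho hot => by
      rcases le_total (lev b) (lev o) with h | h
      · exact h
      · exact hmin ⟨ho, hot⟩ h
    have := hmin' y hy hyt
    exact ⟨b, hb, hbt, by omega, hmin'⟩
  choose! b hbK hbt hbj hbmin using hb
  have hl : ∀ t ∈ T, ∃ l : List V, IndPath G (p0 :: (l ++ [b t])) ∧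
      (∀ a ∈ l, a ∈ K ∧ lev a < lev (b t)) ∧ l.length + 1 = lev (b t) :=
    fun t ht => hlev.geo_insert (hbK t ht) (hne _ (hbK t ht))
  choose! l hl1 hl2 hl3 using hl
  have hlb : ∀ t ∈ T, ∀ a ∈ l t ++ [b t], a ∈ K ∧ (a = b t ∨ lev a < lev (b t)) := by
    intro t ht a ha
    rcases List.mem_append.1 ha with ha | ha
    · exact ⟨(hl2 t ht a ha).1, Or.inr (hl2 t ht a ha).2⟩
    · rw [List.mem_singleton.1 ha]
      exact ⟨hbK t ht, Or.inl rfl⟩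
  choose! p hpT hxp using hXT
  obtain ⟨rank, hrinj, hrank⟩ := exists_refinement (fun t => lev (b t))
  refine col_classes (fun x => (lev (b (p x))) % 3) (fun x _ => Nat.mod_lt _ (by norm_num))
    fun s _ => ?_
  set T' : Set V := {t | t ∈ T ∧ lev (b t) % 3 = s} with hT'
  have hT'T : T' ⊆ T := fun t ht => ht.1
  refine (left_bound (n := 3 * τ) (X := {x | x ∈ X ∧ (fun x => (lev (b (p x))) % 3) x = s})
    (Cs := T') (T := T') (s := s)
    (pre := fun t => l t ++ [b t]) (rank := rank) htf hC h2 (ctx.mono hT'T)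
    (fun x hx => hXK hx.1) (fun x hx => ⟨p x, ⟨hpT x hx.1, hx.2⟩, hxp x hx.1⟩) ?_ hrinj.injOn
    ?_ ?_ ?_ (fun c hc hcX => ctx.notMem c hc.1 (hXK hcX.1))
    (fun x hx => ⟨p x, ⟨hpT x hx.1, hx.2⟩, hxp x hx.1⟩) ?_).mono subset_rfl (by omega)
  · intro x hx
    exact hlev.far (Set.mem_insert p0 K) (Or.inr (hXK hx.1)) (by rw [hlev.zero, hXj x hx.1]; omega)
  · rintro c ⟨hc, -⟩
    have : IndPath G ((p0 :: l c) ++ [b c, c]) := by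
      refine IndPath.snoc (by simpa using hl1 c hc) (hbt c hc) fun a ha => ?_
      rcases List.mem_cons.1 ha with rfl | ha
      · exact ctx.p0_far c hc
      · have h := hl2 c hc a ha
        refine ⟨fun e => ctx.notMem c hc (e ▸ h.1), fun e => ?_⟩
        have := hbmin c hc a h.1 e
        omega
    simpa using this
  · rintro c ⟨hc, -⟩ a ha x ⟨hx, -⟩
    have h := hlb c hc a ha
    have hbc := hbj c hc
    have hxj := hXj x hx
    refine hlev.far (Or.inr h.1) (Or.inr (hXK hx)) ?_
    rcases h.2 with rfl | h
    · omega
    · omega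
  · rintro c ⟨hc, hcs⟩
    have := hl3 c hc
    simp only [List.length_append, List.length_cons, List.length_nil]
    omega
  · rintro c ⟨hc, -⟩ Z hZ hZr
    refine (col_union (h2 (b c)) (col_union (h2 c) (h3 c))).mono ?_ (by omega)
    rintro z ⟨hz, t, ht, hzt, hcl⟩
    have hr := hZr z hz t ht hzt
    by_cases e1 : G.Adj t (b c)
    · exact Or.inl ⟨t, hzt, e1⟩
    by_cases e2 : G.Adj t c
    · exact Or.inr (Or.inl ⟨t, hzt, e2⟩)
    by_cases e3 : G.Adj (tau t) c
    · exact Or.inr (Or.inr ⟨t, tau t, hzt, htau t ht.1, e3⟩)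
    exfalso
    refine hcl fun a ha => ?_
    rcases List.mem_append.1 ha with ha | ha
    · have h := hlb c hc a ha
      refine ⟨⟨fun e => ctx.notMem t ht.1 (e ▸ h.1), fun e => ?_⟩, ctx.far_mid a h.1 t ht.1⟩
      rcases h.2 with rfl | h'
      · exact e1 e.symm
      · have h4 := hbmin t ht.1 a h.1 e
        have h5 := hrank t c (by omega)
        omega
    · rw [List.mem_singleton.1 ha]
      refine ⟨⟨?_, fun e => e2 e.symm⟩, ctx.far_mid' t ht.1 c hc fun e => e3 e.symm⟩
      rintro rfl
      exact lt_irrefl _ hr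

end

section

variable {V : Type} {G : SimpleGraph V}
variable {S K X T C : Set V} {p0 : V} {tau : V → V} {d τ n m : ℕ}

section Restriction

lemma Far.of_restr {a b : V} (ha : a ∈ S) (hb : b ∈ S) (h : Far (restr G S) a b) : Far G a b :=
  ⟨h.1, fun h' => h.2 ⟨h', ha, hb⟩⟩

lemma IndPath.mem_of_restr {a : V} {l : List V} (ha : a ∈ S)
    (h : IndPath (restr G S) (a :: l)) : ∀ x ∈ a :: l, x ∈ S := by
  induction l generalizing a with
  | nil => simpa using ha
  | cons b l ih =>
    intro x hx
    rcases List.mem_cons.1 hx with rfl | hx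
    · exact ha
    · exact ih h.1.2.2 h.2.2 x hx

lemma IndPath.of_restr {l : List V} (hl : ∀ x ∈ l, x ∈ S) (h : IndPath (restr G S) l) :
    IndPath G l := by
  induction l with
  | nil => trivial
  | cons a l ih =>
    have ih' := ih (fun x hx => hl x (List.mem_cons_of_mem _ hx)) h.tail
    cases l with
    | nil => trivial
    | cons b l =>
      exact ⟨h.1.1, fun x hx => (h.2.1 x hx).of_restr (hl a (by simp)) (hl x (by simp [hx])), ih'⟩

lemma Col.restr {A : Set V} (h : Col G A n) : Col (restr G S) A n := by
  obtain ⟨f, h1, h2⟩ := h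
  exact ⟨f, h1, fun u hu v hv huv => h2 u hu v hv huv.1⟩

lemma Col.of_restr {A : Set V} (hA : A ⊆ S) (h : Col (Balanced.restr G S) A n) : Col G A n := by
  obtain ⟨f, h1, h2⟩ := h
  exact ⟨f, h1, fun u hu v hv huv => h2 u hu v hv ⟨huv, hA hu, hA hv⟩⟩

lemma TriFree.restr (h : TriFree G) : TriFree (restr G S) :=
  fun a b c hab hbc hac => h a b c hab.1 hbc.1 hac.1

lemma HypC.restr (hd : 0 < d) (h : HypC G d) : HypC (restr G S) d := by
  classical
  rintro p L hL ⟨x, M, y, rfl, hx, hy, hM⟩ hlen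
  have hmem := IndPath.mem_of_restr hx.2.2 hL
  have hp : p ∈ S := hx.2.1
  obtain ⟨f, h1, h2⟩ := h p _ (hL.of_restr hmem)
    ⟨x, M, y, rfl, hx.1, hy.1, fun m hm => (hM m hm).of_restr hp (hmem m (by simp [hm]))⟩ hlen
  refine ⟨fun z => if z ∈ S then f z else 0, ?_, ?_⟩
  · rintro z ⟨hz, hzL⟩
    by_cases hzS : z ∈ S
    · simp only [hzS, if_true]
      exact h1 z ⟨hz.of_restr hp hzS, fun w hw => (hzL w hw).of_restr (hmem w hw) hzS⟩
    · simpa only [hzS, if_false] using hd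
  · rintro u ⟨hu, huL⟩ v ⟨hv, hvL⟩ ⟨huv, huS, hvS⟩
    simp only [huS, hvS, if_true]
    exact h2 u ⟨hu.of_restr hp huS, fun w hw => (huL w hw).of_restr (hmem w hw) huS⟩ v
      ⟨hv.of_restr hp hvS, fun w hw => (hvL w hw).of_restr (hmem w hw) hvS⟩ huv

lemma ball2_restr_subset (w : V) : Ball2 (restr G S) w ⊆ Ball2 G w :=
  fun _ ⟨t, h1, h2⟩ => ⟨t, h1.1, h2.1⟩

end Restriction

lemma IndPath.ends {M : List V} {y p : V} (h : IndPath G (M ++ [y, p])) :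
    G.Adj y p ∧ (∀ m ∈ M, Far G m p) ∧ IndPath G (M ++ [y]) := by
  induction M with
  | nil => exact ⟨h.1, by simp, trivial⟩
  | cons a M ih =>
    obtain ⟨h1, h2, h3⟩ := ih h.tail
    cases M with
    | nil =>
      refine ⟨h1, ?_, h.1, by simp, trivial⟩
      intro m hm
      rw [List.mem_singleton.1 hm]
      exact h.2.1 p (by simp)
    | cons b M =>
      refine ⟨h1, ?_, h.1, fun x hx => h.2.1 x ?_, h3⟩
      · intro m hm
        rcases List.mem_cons.1 hm with rfl | hm
        · exact h.2.1 p (by simp)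
        · exact h2 m hm
      · have hx' : x ∈ M ++ [y] := hx
        have : x ∈ M ++ [y, p] := by
          simp only [List.mem_append, List.mem_cons, List.not_mem_nil, or_false] at hx' ⊢
          tauto
        exact this

/-- `K` is connected and dominated by `C`, and any two vertices of `C` are linked by an induced
path avoiding the neighbourhood of `K`. -/
structure Shell (G : SimpleGraph V) (K C : Set V) (tau : V → V) : Prop where
  conn : Conn G K
  notMem : ∀ t ∈ C, t ∉ K
  nbr : ∀ x ∈ K, ∃ t ∈ C, G.Adj x t
  adj_tau : ∀ t ∈ C, G.Adj t (tau t)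
  path : ∀ t ∈ C, ∀ p ∈ C, t ≠ p → ∃ l : List V, IndPath G (t :: (l ++ [p])) ∧
    ∀ m ∈ l, (∀ x ∈ K, Far G x m) ∧ ∀ t' ∈ C, t' ≠ m ∧ (G.Adj t' m → m = tau t ∨ m = tau p)

lemma exists_shell (htf : TriFree G) (hn : 0 < n) (h : ¬ Col G S (2 * n)) :
    ∃ K C tau, Shell G K C tau ∧ ¬ Col G K n := by
  obtain ⟨Z, -, ⟨r, hr⟩, hZc, hZ, -⟩ := exists_comp h
  obtain ⟨lev, hlev⟩ := exists_bfs hZc hr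
  obtain ⟨j, hj⟩ := exists_level lev hlev.step hZ
  obtain ⟨K, hKs, -, hKc, hK, -⟩ := exists_comp hj
  have hj2 : 2 ≤ j := by
    by_contra hlt
    have hcases : j = 0 ∨ j = 1 := by omega
    rcases hcases with rfl | rfl
    · refine hj ((col_singleton r).mono ?_ hn)
      rintro x ⟨hx, hx0⟩
      exact hlev.eq_of_zero x hx hx0
    · refine hj ((htf.col_nbr r).mono ?_ hn)
      rintro x ⟨hx, hx1⟩
      have hxr : x ≠ r := by
        rintro rfl
        have := hlev.zero
        omega
      obtain ⟨y, hy, hxy, hl⟩ := hlev.pred x hx hxr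
      rw [← hlev.eq_of_zero y hy (by omega)]
      exact hxy
  have hpred : ∀ t ∈ Z, lev t ≠ 0 → ∃ y ∈ Z, G.Adj t y ∧ lev t = lev y + 1 := by
    intro t ht h0
    refine hlev.pred t ht ?_
    rintro rfl
    exact h0 hlev.zero
  choose! tau htauZ htau htaul using hpred
  have h0 : ∀ t, t ∈ Z ∧ lev t + 1 = j → lev t ≠ 0 := by
    rintro t ⟨-, ht⟩; omega
  refine ⟨K, {t | t ∈ Z ∧ lev t + 1 = j}, tau, ⟨hKc, ?_, ?_, ?_, ?_⟩, hK⟩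
  · rintro t ⟨-, ht⟩ htK
    have := (hKs htK).2
    omega
  · intro x hx
    have h1 := hKs hx
    have hx0 : lev x ≠ 0 := by have := h1.2; omega
    have := htaul x h1.1 hx0
    exact ⟨tau x, ⟨htauZ x h1.1 hx0, by have := h1.2; omega⟩, htau x h1.1 hx0⟩
  · exact fun t ht => htau t ht.1 (h0 t ht)
  · intro t ht p hp htp
    set W : Set V := {y | y ∈ Z ∧ (lev y + 2 < j ∨ y = tau t ∨ y = tau p ∨ y = t ∨ y = p)} with hW
    have ht' := htaul t ht.1 (h0 t ht)
    have hp' := htaul p hp.1 (h0 p hp)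
    have hlt := ht.2
    have hlp := hp.2
    have hreach : ∀ k, ∀ y ∈ W, lev y = k → (restr G W).Reachable y r := by
      intro k
      induction k with
      | zero =>
        intro y hy hy0
        rw [hlev.eq_of_zero y hy.1 hy0]
      | succ k ih =>
        intro y hy hyk
        have hy0 : lev y ≠ 0 := by omega
        have hl := htaul y hy.1 hy0
        have hyW : tau y ∈ W := by
          refine ⟨htauZ y hy.1 hy0, ?_⟩
          rcases hy.2 with h | h | h | h | h
          · left; omega
          · left; rw [h] at hl hyk hy0 ⊢; omega
          · left; rw [h] at hl hyk hy0 ⊢; omega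
          · rw [h]; tauto
          · rw [h]; tauto
        have hadj : (restr G W).Adj y (tau y) := ⟨htau y hy.1 hy0, hy, hyW⟩
        exact hadj.reachable.trans (ih (tau y) hyW (by omega))
    have hWc : Conn G W := fun x hx y hy => (hreach _ x hx rfl).trans (hreach _ y hy rfl).symm
    have htW : t ∈ W := ⟨ht.1, by tauto⟩
    have hpW : p ∈ W := ⟨hp.1, by tauto⟩
    obtain ⟨lev', hlev'⟩ := exists_bfs hWc htW
    obtain ⟨l, hl1, hl2, -, -⟩ := hlev'.geo htW hpW htp.symm
    refine ⟨l, hl1, fun m hm => ?_⟩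
    obtain ⟨⟨hmZ, hmW⟩, hm0, hmp⟩ := hl2 m hm
    have hmW' : lev m + 2 < j ∨ ((m = tau t ∨ m = tau p) ∧ lev m + 2 = j) := by
      rcases hmW with h | h | h | h | h
      · exact Or.inl h
      · right; exact ⟨Or.inl h, by rw [h]; omega⟩
      · right; exact ⟨Or.inr h, by rw [h]; omega⟩
      · rw [h, hlev'.zero] at hm0; omega
      · rw [h] at hmp; omega
    have hmj : lev m + 2 ≤ j := by omega
    refine ⟨fun x hx => ?_, fun t' ht' => ⟨?_, fun hadj => ?_⟩⟩
    · have hxj := (hKs hx).2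
      exact (hlev.far hmZ (hKs hx).1 (by omega)).symm
    · rintro rfl
      have := ht'.2
      omega
    · rcases hmW' with h | h
      · have h3 := hlev.step m hmZ t' ht'.1 hadj.symm
        have h4 := ht'.2
        omega
      · exact h.1

lemma Shell.bound (sh : Shell G K C tau) (hp0 : p0 ∈ C) (h2 : ∀ w, Col G (Ball2 G w) τ)
    (hXK : X ⊆ K) (hXp : ∀ x ∈ X, ¬ G.Adj x p0)
    (H : ∀ (r : ℕ) (mid : V → List V) (T : Set V), Returns G K T p0 mid tau r → T ⊆ C →
      ∀ X' ⊆ X, (∀ x ∈ X', ∃ t ∈ T, G.Adj x t) → Col G X' m) :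
    Col G X (3 * m + 2 * τ) := by
  have hq := fun x (hx : x ∈ X) => sh.nbr x (hXK hx)
  choose! q hqC hxq using hq
  have hmid := fun t (ht : t ∈ C ∧ t ≠ p0) => sh.path t ht.1 p0 hp0 ht.2
  choose! mid hmid1 hmid2 using hmid
  have hrest : Col G {x | x ∈ X ∧ ¬ G.Adj (q x) p0 ∧ ¬ G.Adj (q x) (tau p0)} (3 * m) := by
    refine col_classes (fun x => (mid (q x)).length % 3) (fun _ _ => Nat.mod_lt _ (by norm_num))
      fun r _ => ?_
    refine H r mid {t | t ∈ C ∧ t ≠ p0 ∧ ¬ G.Adj t p0 ∧ ¬ G.Adj t (tau p0) ∧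
      (mid t).length % 3 = r} ?_ (fun t ht => ht.1) _ (fun x hx => hx.1.1) ?_
    · refine ⟨fun t ht => sh.notMem t ht.1, fun t ht => ⟨ht.2.1.symm, fun h => ht.2.2.1 h.symm⟩,
        fun x hx t ht m' hm' => (hmid2 t ⟨ht.1, ht.2.1⟩ m' hm').1 x hx, ?_, ?_,
        fun t ht => ht.2.2.2.2, ?_⟩
      · rintro t ⟨ht, htp, -⟩
        have h := hmid1 t ⟨ht, htp⟩
        rcases List.eq_nil_or_concat (mid t) with h0 | ⟨M, y, h0⟩
        · rw [h0]; trivial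
        · rw [h0, List.concat_eq_append] at h ⊢
          exact (IndPath.ends (M := t :: M) (by simpa using h)).2.2
      · rintro t ⟨ht, htp, htp', -⟩
        have h := hmid1 t ⟨ht, htp⟩
        rcases List.eq_nil_or_concat (mid t) with h0 | ⟨M, y, h0⟩
        · rw [h0] at h
          exact absurd h.1 htp'
        · rw [h0, List.concat_eq_append] at h
          obtain ⟨e1, e2, -⟩ := IndPath.ends (M := t :: M) (by simpa using h)
          exact ⟨M, y, by rw [h0, List.concat_eq_append], e1.symm,
            fun m' hm' => (e2 m' (List.mem_cons_of_mem _ hm')).symm⟩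
      · rintro t ⟨ht, htp, -⟩ t' ⟨ht', -, -, htw, -⟩ hn m' hm'
        obtain ⟨e1, e2⟩ := (hmid2 t ⟨ht, htp⟩ m' hm').2 t' ht'
        refine ⟨e1, fun h => ?_⟩
        rcases e2 h with rfl | rfl
        · exact hn h
        · exact htw h
    · rintro x ⟨⟨hx, hx1, hx2⟩, hxr⟩
      exact ⟨q x, ⟨hqC x hx, fun h => hXp x hx (h ▸ hxq x hx), hx1, hx2, hxr⟩, hxq x hx⟩
  refine (col_union hrest (col_union (h2 p0) (h2 (tau p0)))).mono (fun x hx => ?_) (by omega)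
  by_cases e1 : G.Adj (q x) p0
  · exact Or.inr (Or.inl ⟨q x, hxq x hx, e1⟩)
  by_cases e2 : G.Adj (q x) (tau p0)
  · exact Or.inr (Or.inr ⟨q x, hxq x hx, e2⟩)
  exact Or.inl ⟨hx, e1, e2⟩

lemma two_le_level (htf : TriFree G) {lev : V → ℕ} (hlev : IsBfs G (insert p0 K) p0 lev)
    (hp0 : p0 ∉ K) (hXK : X ⊆ K) {j : ℕ} (h : ¬ Col G {x | x ∈ X ∧ lev x = j} (n + 1)) :
    2 ≤ j := by
  by_contra hlt
  refine h ((htf.col_nbr p0).mono ?_ (by omega))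
  rintro x ⟨hx, hxj⟩
  have hxp : x ≠ p0 := fun e => hp0 (e ▸ hXK hx)
  obtain ⟨y, hy, hxy, hl⟩ := hlev.pred x (Or.inr (hXK hx)) hxp
  rw [← hlev.eq_of_zero y hy (by omega)]
  exact hxy

/-- Bound for a single level, for return paths of a fixed residue. -/
def levelBound (τ d : ℕ) : ℕ := 40 * τ + 4 * d + 55

/-- Bound when balls of radius two and three are `τ`-colourable. -/
def bound3 (τ d : ℕ) : ℕ := 2 * (2 * (3 * (4 * levelBound τ d) + 2 * τ + 1))

theorem col_of_ball3 [Finite V] (htf : TriFree G) (hC : HypC G d)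
    (h2 : ∀ w, Col G (Ball2 G w) τ) (h3 : ∀ w, Col G (Ball3 G w) τ) :
    Col G S (bound3 τ d) := by
  by_contra hbig
  obtain ⟨K, C, tau, sh, hK⟩ := exists_shell htf (by omega) hbig
  obtain ⟨x0, hx0⟩ := nonempty_of_not_col hK
  obtain ⟨p0, hp0, hxp⟩ := sh.nbr x0 hx0
  have hp0K := sh.notMem p0 hp0
  obtain ⟨lev, hlev⟩ := exists_bfs (conn_insert sh.conn hx0 hxp.symm) (Set.mem_insert p0 K)
  obtain ⟨j, hj⟩ := exists_level lev
    (fun u hu v hv => hlev.step u (Or.inr hu) v (Or.inr hv)) hK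
  have hj2 := two_le_level htf hlev hp0K subset_rfl hj
  refine hj ((sh.bound (m := 4 * levelBound τ d) hp0 h2 (fun x hx => hx.1) ?_ ?_).mono subset_rfl
    (by omega))
  · rintro x ⟨hx, hxj⟩ hadj
    have h1 := hlev.step p0 (Set.mem_insert p0 K) x (Or.inr hx) hadj.symm
    have := hlev.zero
    omega
  · intro r mid T ctx hTC X' hX' hXT
    have c1 := left_low (X := {x | x ∈ X' ∧ ∃ t ∈ T, G.Adj x t ∧
        ∃ y ∈ K, G.Adj y t ∧ lev y + 2 ≤ j})
      (T := {t | t ∈ T ∧ ∃ y ∈ K, G.Adj y t ∧ lev y + 2 ≤ j}) htf hC h2 h3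
      (ctx.mono fun t ht => ht.1) (fun x hx => (hX' hx.1).1)
      (fun x ⟨_, t, ht, hxt, h⟩ => ⟨t, ⟨ht, h⟩, hxt⟩) hp0K hlev (fun x hx => (hX' hx.1).2) hj2
      (fun t ht => ht.2) (fun t ht => sh.adj_tau t (hTC ht.1))
    have c2 := left_high (X := {x | x ∈ X' ∧ ∃ t ∈ T, G.Adj x t ∧
        ¬ ∃ y ∈ K, G.Adj y t ∧ lev y + 2 ≤ j})
      (T := {t | t ∈ T ∧ ¬ ∃ y ∈ K, G.Adj y t ∧ lev y + 2 ≤ j}) htf hC h2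
      (ctx.mono fun t ht => ht.1) (fun x hx => (hX' hx.1).1)
      (fun x ⟨_, t, ht, hxt, h⟩ => ⟨t, ⟨ht, h⟩, hxt⟩) hp0K hlev (fun x hx => (hX' hx.1).2) hj2
      (fun t ht y hy hyt => by
        by_contra h
        exact ht.2 ⟨y, hy, hyt, by omega⟩)
    refine (col_union c1 c2).mono (fun x hx => ?_) (by unfold levelBound; omega)
    obtain ⟨t, ht, hxt⟩ := hXT x hx
    by_cases h : ∃ y ∈ K, G.Adj y t ∧ lev y + 2 ≤ j
    · exact Or.inl ⟨hx, t, ht, hxt, h⟩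
    · exact Or.inr ⟨hx, t, ht, hxt, h⟩

/-- Bound for balls of radius three inside a shell. -/
def ball3Bound (τ d : ℕ) : ℕ := 5 * (3 * levelBound τ d + 2 * τ + 1)

/-- Bound when balls of radius two are `τ`-colourable. -/
def bound2 (τ d : ℕ) : ℕ := 2 * bound3 (τ + ball3Bound τ d) d

theorem col_of_ball2 [Finite V] (hd : 0 < d) (htf : TriFree G) (hC : HypC G d)
    (h2 : ∀ w, Col G (Ball2 G w) τ) : Col G S (bound2 τ d) := by
  by_contra hbig
  obtain ⟨K, C, tau, sh, hK⟩ := exists_shell htf (by unfold bound3; omega) hbig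
  have hw : ∃ w, ¬ Col G (Ball3 (restr G K) w) (ball3Bound τ d) := by
    by_contra! hall
    refine hK (Col.of_restr subset_rfl (col_of_ball3 htf.restr (hC.restr hd) (fun w => ?_)
      fun w => ?_))
    · exact (h2 w).restr.mono (ball2_restr_subset w) (by omega)
    · exact (hall w).restr.mono subset_rfl (by omega)
  obtain ⟨w, hw⟩ := hw
  obtain ⟨_, _, _, _, _, hwK⟩ := nonempty_of_not_col hw
  have hwK : w ∈ K := hwK.2.2
  obtain ⟨p0, hp0, hwp⟩ := sh.nbr w hwK
  have hp0K := sh.notMem p0 hp0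
  obtain ⟨lev, hlev⟩ := exists_bfs (conn_insert sh.conn hwK hwp.symm) (Set.mem_insert p0 K)
  have hstep : ∀ x y, (restr G K).Adj x y → lev x ≤ lev y + 1 := fun x y h =>
    hlev.step y (Or.inr h.2.2) x (Or.inr h.2.1) h.1.symm
  have hXK : Ball3 (restr G K) w ⊆ K := fun x ⟨_, _, h, _⟩ => h.2.1
  obtain ⟨j, hj5, hj⟩ := exists_class (k := 5) lev (by
    rintro x ⟨t, s, hxt, hts, hsw⟩
    have h1 := hstep _ _ hxt
    have h2 := hstep _ _ hts
    have h3 := hstep _ _ hsw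
    have h4 := hlev.step p0 (Set.mem_insert p0 K) w (Or.inr hwK) hwp.symm
    have := hlev.zero
    omega) hw
  have hj2 := two_le_level htf hlev hp0K hXK hj
  refine hj ((sh.bound (m := levelBound τ d) hp0 h2 (fun x hx => hXK hx.1) ?_ ?_).mono subset_rfl
    (by omega))
  · rintro x ⟨hx, hxj⟩ hadj
    have h1 := hlev.step p0 (Set.mem_insert p0 K) x (Or.inr (hXK hx)) hadj.symm
    have := hlev.zero
    omega
  · intro r mid T ctx hTC X' hX' hXT
    exact left_near htf hC h2 ctx (fun x hx => hXK (hX' hx).1) hXT hp0K hlev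
      (fun x hx => (hX' hx).2) hj2 (by omega)

end

section

variable {V : Type} {G : SimpleGraph V}
variable {d m : ℕ}

lemma col_nbhd_list (L : List V) (h : ∀ w ∈ L, Col G {x | G.Adj x w} m) :
    Col G {z | ∃ w ∈ L, z = w ∨ G.Adj z w} ((m + 1) * L.length) := by
  induction L with
  | nil => exact ⟨fun _ => 0, by simp, by simp⟩
  | cons a L ih =>
    refine (col_union (ih fun w hw => h w (List.mem_cons_of_mem _ hw))
      (col_union (h a (List.mem_cons_self ..)) (col_singleton a))).mono ?_ ?_
    · rintro z ⟨w, hw, hzw⟩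
      rcases List.mem_cons.1 hw with rfl | hw
      · exact Or.inr (hzw.elim Or.inr Or.inl)
      · exact Or.inl ⟨w, hw, hzw⟩
    · rw [List.length_cons]
      ring_nf
      exact le_rfl

/-- Two nonneighbours of `u` with a common nonneighbour of `u` as neighbour have nested
neighbourhoods inside the neighbourhood of `u`. -/
lemma nested_nbr (htf : TriFree G) (hC : HypC G d) (hbig : ¬ Col G Set.univ (d + 12))
    {u x y z : V} (hx : Far G u x) (hy : Far G u y) (hz : Far G u z) (hxy : G.Adj x y)
    (hyz : G.Adj y z) : (∀ p, G.Adj p u → G.Adj p x → G.Adj p z) ∨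
      (∀ p, G.Adj p u → G.Adj p z → G.Adj p x) := by
  by_contra! hc
  obtain ⟨⟨p, hpu, hpx, hpz⟩, r, hru, hrz, hrx⟩ := hc
  have hpath : IndPath G [p, x, y, z, r] := by
    refine ⟨hpx, ?_, hxy, ?_, hyz, ?_, hrz.symm, by simp, trivial⟩
    · simp only [List.mem_cons, List.not_mem_nil, or_false, forall_eq_or_imp, forall_eq]
      refine ⟨⟨?_, fun h => htf p x y hpx hxy h⟩, ⟨?_, hpz⟩, ?_, fun h => htf p r u h hru hpu⟩
      · rintro rfl; exact hy.2 hpu.symm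
      · rintro rfl; exact hz.2 hpu.symm
      · rintro rfl; exact hpz hrz
    · simp only [List.mem_cons, List.not_mem_nil, or_false, forall_eq_or_imp, forall_eq]
      refine ⟨⟨?_, fun h => htf x y z hxy hyz h⟩, ?_, fun h => hrx h.symm⟩
      · rintro rfl; exact hpz hpx
      · rintro rfl; exact hx.2 hru.symm
    · simp only [List.mem_singleton, forall_eq]
      refine ⟨?_, fun h => htf y z r hyz hrz.symm h⟩
      rintro rfl; exact hy.2 hru.symm
  have hcol := hC u _ hpath ⟨p, [x, y, z], r, rfl, hpu.symm, hru.symm, by simp [hx, hy, hz]⟩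
    (by simp)
  refine hbig ((col_union hcol (col_nbhd_list [u, p, x, y, z, r]
    fun w _ => htf.col_nbr w)).mono (fun v _ => ?_) (by simp))
  by_cases h : ∃ w ∈ [u, p, x, y, z, r], v = w ∨ G.Adj v w
  · exact Or.inr h
  · push Not at h
    have hfar : ∀ w ∈ [u, p, x, y, z, r], Far G w v := fun w hw =>
      ⟨(h w hw).1.symm, fun h' => (h w hw).2 h'.symm⟩
    exact Or.inl ⟨hfar u (List.mem_cons_self ..), fun w hw => hfar w (List.mem_cons_of_mem _ hw)⟩

/-- The bound for triangle-free graphs. -/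
def triFreeBound (d : ℕ) : ℕ := bound2 (bound2 2 d + 1) d + (d + 12)

theorem col_of_triFree [Finite V] (hd : 0 < d) (htf : TriFree G) (hC : HypC G d) :
    Col G Set.univ (triFreeBound d) := by
  by_contra hbig
  have hsix : ¬ Col G Set.univ (d + 12) := fun h =>
    hbig (h.mono subset_rfl (by unfold triFreeBound; omega))
  obtain ⟨u, hu⟩ : ∃ u, ¬ Col G (Ball2 G u) (bound2 2 d + 1) := by
    by_contra! hall
    exact hbig ((col_of_ball2 hd htf hC hall).mono subset_rfl (by unfold triFreeBound; omega))
  set K : Set V := {x | x ∈ Ball2 G u ∧ x ≠ u} with hK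
  have hKcol : ¬ Col G K (bound2 2 d) := by
    refine not_col_of_cover hu (col_singleton u) fun x hx => ?_
    by_cases h : x = u
    · exact Or.inr h
    · exact Or.inl ⟨hx, h⟩
  have hKfar : ∀ x ∈ K, Far G u x := by
    rintro x ⟨⟨t, hxt, htu⟩, hxu⟩
    exact ⟨hxu.symm, fun h => htf x t u hxt htu h.symm⟩
  obtain ⟨w, hw⟩ : ∃ w, ¬ Col (restr G K) (Ball2 (restr G K) w) 2 := by
    by_contra! hall
    exact hKcol (Col.of_restr subset_rfl (col_of_ball2 hd htf.restr (hC.restr hd) hall))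
  obtain ⟨_, _, _, hw'⟩ := nonempty_of_not_col hw
  have hwK : w ∈ K := hw'.2.2
  obtain ⟨⟨p, hwp, hpu⟩, -⟩ := hwK
  obtain ⟨a, ⟨⟨q, haq, hqw⟩, hap⟩, b, ⟨⟨q', hbq', hqw'⟩, hbp⟩, hab, haK, hbK⟩ :
      ∃ a ∈ {x | x ∈ Ball2 (restr G K) w ∧ ¬ G.Adj x p},
      ∃ b ∈ {x | x ∈ Ball2 (restr G K) w ∧ ¬ G.Adj x p}, (restr G K).Adj a b := by
    by_contra! hc
    refine not_col_of_cover hw (htf.col_nbr p).restr (fun x hx => ?_) (col_one hc)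
    by_cases h : G.Adj x p
    · exact Or.inr h
    · exact Or.inl ⟨hx, h⟩
  have hwF := hKfar w hqw.2.2
  have hqF := hKfar q hqw.2.1
  have key : ∀ b q, Far G u b → Far G u q → G.Adj b q → G.Adj q w → ¬ G.Adj b p →
      ∀ s, G.Adj s u → G.Adj s b → G.Adj s w := by
    intro b q hb hq hbq hqw hbp
    refine (nested_nbr htf hC hsix hb hq hwF hbq hqw).resolve_right fun h => ?_
    exact hbp (h p hpu hwp.symm).symm
  have hbw := key b q' (hKfar b hbK) (hKfar q' hqw'.2.1) hbq'.1 hqw'.1 hbp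
  obtain ⟨⟨s, hqs, hsu⟩, -⟩ := hqw.2.1
  have hbF := hKfar b hbK
  obtain ⟨⟨s', hbs', hsu'⟩, -⟩ := hbK
  rcases nested_nbr htf hC hsix hqF (hKfar a haK) hbF haq.1.symm hab with h | h
  · exact htf s q w hqs.symm hqw.1 (hbw s hsu (h s hsu hqs.symm))
  · exact htf s' q w (h s' hsu' hbs'.symm) hqw.1 (hbw s' hsu' hbs'.symm)

end

section

variable {V : Type} {G : SimpleGraph V}

section Index

open Classical in
/-- The signed count of the stable subsets of `F`, even ones being positive. -/
noncomputable def index (G : SimpleGraph V) (F : Finset V) : ℤ :=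
  ∑ s ∈ F.powerset, if ∀ u ∈ s, ∀ v ∈ s, ¬ G.Adj u v then (-1) ^ s.card else 0

lemma index_empty : index G ∅ = 1 := by simp [index]

open Classical in
lemma index_insert [DecidableEq V] {F : Finset V} {v : V} (hv : v ∉ F) :
    index G (insert v F) = index G F - index G (F.filter fun x => ¬ G.Adj v x) := by
  rw [index, Finset.sum_powerset_insert hv, sub_eq_add_neg]
  refine congrArg₂ (· + ·) rfl ?_
  rw [index, ← Finset.sum_neg_distrib]
  symm
  have hsub : (F.filter fun x => ¬ G.Adj v x) ⊆ F := Finset.filter_subset _ _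
  rw [← Finset.sum_subset (Finset.powerset_mono.2 hsub)]
  · refine Finset.sum_congr rfl fun t ht => ?_
    have ht' : ∀ x ∈ t, x ∈ F ∧ ¬ G.Adj v x := fun x hx =>
      Finset.mem_filter.1 (Finset.mem_powerset.1 ht hx)
    have hvt : v ∉ t := fun h => hv (ht' v h).1
    have hiff : (∀ x ∈ insert v t, ∀ y ∈ insert v t, ¬ G.Adj x y) ↔
        ∀ x ∈ t, ∀ y ∈ t, ¬ G.Adj x y := by
      refine ⟨fun h x hx y hy => h x (Finset.mem_insert_of_mem hx) y (Finset.mem_insert_of_mem hy),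
        fun h x hx y hy => ?_⟩
      rcases Finset.mem_insert.1 hx with ex | ex <;> rcases Finset.mem_insert.1 hy with ey | ey
      · rw [ex, ey]; exact G.loopless.irrefl _
      · rw [ex]; exact (ht' y ey).2
      · rw [ey]; exact fun h' => (ht' x ex).2 h'.symm
      · exact h x ex y ey
    simp only [hiff, Finset.card_insert_of_notMem hvt, pow_succ]
    split_ifs <;> simp
  · intro t ht htn
    rw [if_neg]
    intro h
    refine htn (Finset.mem_powerset.2 fun x hx => Finset.mem_filter.2
      ⟨Finset.mem_powerset.1 ht hx, ?_⟩)
    exact h v (Finset.mem_insert_self ..) x (Finset.mem_insert_of_mem hx)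

lemma index_insert_complete {F : Finset V} [DecidableEq V] {v : V} (h : ∀ x ∈ F, G.Adj v x) :
    index G (insert v F) = index G F - 1 := by
  classical
  have hv : v ∉ F := fun hv => G.loopless.irrefl v (h v hv)
  have he : (F.filter fun x => ¬ G.Adj v x) = ∅ :=
    Finset.filter_eq_empty_iff.2 fun x hx => not_not.2 (h x hx)
  rw [index_insert hv, he, index_empty]

lemma index_union [DecidableEq V] {A B : Finset V} (h : ∀ a ∈ A, ∀ b ∈ B, Far G a b) :
    index G (A ∪ B) = index G A * index G B := by
  classical
  induction A using Finset.strongInduction with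
  | H A ih =>
    rcases A.eq_empty_or_nonempty with rfl | ⟨v, hv⟩
    · simp [index_empty]
    · have hvB : v ∉ B := fun hb => (h v hv v hb).1 rfl
      have hA : insert v (A.erase v) = A := Finset.insert_erase hv
      have h1 := ih (A.erase v) (Finset.erase_ssubset hv)
        fun a ha => h a (Finset.mem_of_mem_erase ha)
      have h2 := ih ((A.erase v).filter fun x => ¬ G.Adj v x)
        ((Finset.filter_subset _ _).trans_ssubset (Finset.erase_ssubset hv))
        fun a ha => h a (Finset.mem_of_mem_erase (Finset.mem_filter.1 ha).1)
      have e1 : A ∪ B = insert v (A.erase v ∪ B) := by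
        rw [← Finset.insert_union, hA]
      have e2 : ((A.erase v ∪ B).filter fun x => ¬ G.Adj v x) =
          ((A.erase v).filter fun x => ¬ G.Adj v x) ∪ B := by
        rw [Finset.filter_union, Finset.filter_true_of_mem fun b hb => (h v hv b hb).2]
      have e3 := index_insert (G := G) (F := A.erase v ∪ B) (v := v) (by simp [hvB])
      have e4 := index_insert (G := G) (F := A.erase v) (v := v) (by simp)
      rw [e2] at e3
      rw [hA] at e4
      rw [e1, e3, e4, h1, h2]
      ring

/-- The signed count of the stable sets of a path on `n` vertices. -/
def pathIndex : ℕ → ℤ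
  | 0 => 1
  | 1 => 0
  | n + 2 => pathIndex (n + 1) - pathIndex n

lemma pathIndex_three_mul (n : ℕ) :
    (pathIndex (3 * n) = 1 ∨ pathIndex (3 * n) = -1) ∧ pathIndex (3 * n + 1) = 0 := by
  induction n with
  | zero => simp [pathIndex]
  | succ n ih =>
    have h2 : pathIndex (3 * n + 2) = pathIndex (3 * n + 1) - pathIndex (3 * n) := rfl
    have h3 : pathIndex (3 * n + 3) = pathIndex (3 * n + 2) - pathIndex (3 * n + 1) := rfl
    have h4 : pathIndex (3 * n + 4) = pathIndex (3 * n + 3) - pathIndex (3 * n + 2) := rfl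
    rw [show 3 * (n + 1) = 3 * n + 3 by ring, show 3 * n + 3 + 1 = 3 * n + 4 by ring]
    omega

lemma IndPath.notMem {a : V} {l : List V} (h : IndPath G (a :: l)) : a ∉ l := by
  cases l with
  | nil => simp
  | cons b l =>
    intro ha
    rcases List.mem_cons.1 ha with rfl | ha
    · exact G.loopless.irrefl _ h.1
    · exact (h.2.1 a ha).1 rfl

lemma IndPath.left {A B : List V} (h : IndPath G (A ++ B)) : IndPath G A := by
  induction A with
  | nil => trivial
  | cons a A ih =>
    have ih' := ih h.tail
    cases A with
    | nil => trivial
    | cons b A => exact ⟨h.1, fun x hx => h.2.1 x (List.mem_append_left _ hx), ih'⟩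

lemma IndPath.index_eq [DecidableEq V] {l : List V} (h : IndPath G l) :
    index G l.toFinset = pathIndex l.length := by
  classical
  obtain ⟨n, hn⟩ : ∃ n, l.length = n := ⟨_, rfl⟩
  induction n using Nat.strong_induction_on generalizing l with
  | _ n ih =>
    match l, h with
    | [], _ => exact index_empty
    | [a], _ => simpa [index_empty, pathIndex] using
        index_insert_complete (G := G) (F := ∅) (v := a) (by simp)
    | a :: b :: l, h =>
      have h1 := ih _ (by rw [← hn]; simp) h.2.2 rfl
      have h2 := ih _ (by rw [← hn]; simp) h.2.2.tail rfl
      have e := index_insert (G := G) (F := (b :: l).toFinset) (v := a)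
        (by rw [List.mem_toFinset]; exact h.notMem)
      have e' : ((b :: l).toFinset.filter fun x => ¬ G.Adj a x) = l.toFinset := by
        ext x
        simp only [Finset.mem_filter, List.mem_toFinset, List.mem_cons]
        refine ⟨fun ⟨hx, hxa⟩ => hx.resolve_left ?_, fun hx => ⟨Or.inr hx, (h.2.1 x hx).2⟩⟩
        rintro rfl
        exact hxa h.1
      rw [List.toFinset_cons, e, e', h1, h2]
      rfl

lemma Closes.abs_index [DecidableEq V] {p : V} {L : List V} (hL : IndPath G L)
    (h : Closes G p L) (hlen : (L.length + 1) % 3 = 0) :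
    |index G (insert p L.toFinset)| = 2 := by
  classical
  obtain ⟨x, M, y, rfl, hx, hy, hM⟩ := h
  have hp : p ∉ (x :: (M ++ [y])).toFinset := by
    simp only [List.mem_toFinset, List.mem_cons, List.mem_append, List.not_mem_nil, or_false]
    rintro (rfl | h | rfl)
    · exact G.loopless.irrefl _ hx
    · exact (hM p h).1 rfl
    · exact G.loopless.irrefl _ hy
  have e := index_insert (G := G) hp
  have e' : ((x :: (M ++ [y])).toFinset.filter fun z => ¬ G.Adj p z) = M.toFinset := by
    ext z
    simp only [Finset.mem_filter, List.mem_toFinset, List.mem_cons, List.mem_append,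
      List.not_mem_nil, or_false]
    refine ⟨?_, fun hz => ⟨Or.inr (Or.inl hz), (hM z hz).2⟩⟩
    rintro ⟨rfl | h | rfl, hz⟩
    · exact absurd hx hz
    · exact h
    · exact absurd hy hz
  rw [e, e', hL.index_eq, hL.tail.left.index_eq]
  simp only [List.length_cons, List.length_append, List.length_nil] at hlen ⊢
  obtain ⟨n, hn⟩ : ∃ n, M.length = 3 * n := ⟨M.length / 3, by omega⟩
  obtain ⟨h1, h2⟩ := pathIndex_three_mul n
  have h3 : pathIndex (3 * n + 2) = pathIndex (3 * n + 1) - pathIndex (3 * n) := rfl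
  rw [hn, show 3 * n + (0 + 1) + 1 = 3 * n + 2 by ring, h3, h2]
  rcases h1 with h1 | h1 <;> rw [h1] <;> norm_num

lemma abs_index_triangle [DecidableEq V] {a b c : V} (hab : G.Adj a b) (hbc : G.Adj b c)
    (hac : G.Adj a c) : |index G {a, b, c}| = 2 := by
  rw [index_insert_complete (by simp [hab, hac]), index_insert_complete (by simp [hbc]),
    ← insert_empty_eq, index_insert_complete (by simp), index_empty]
  norm_num

end Index

/-- Signed counts inside `S` lie between `-l` and `k`. -/
def IndexBounds (G : SimpleGraph V) (S : Set V) (l k : ℕ) : Prop :=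
  ∀ X : Finset V, ↑X ⊆ S → -(l : ℤ) ≤ index G X ∧ index G X ≤ k

lemma IndexBounds.far {S : Set V} {l k : ℕ} (h : IndexBounds G S l k) (hlk : l ≤ k)
    {H : Finset V} (hHS : ↑H ⊆ S) (hH : |index G H| = 2) :
    IndexBounds G {z | z ∈ S ∧ ∀ w ∈ H, Far G w z} (k / 2) (k / 2) := by
  classical
  intro X hX
  have h1 := h (H ∪ X) (by
    rw [Finset.coe_union]
    exact Set.union_subset hHS fun x hx => (hX hx).1)
  rw [index_union fun a ha b hb => (hX hb).2 a ha] at h1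
  have h2 : index G H = 2 ∨ index G H = -2 := by
    rcases abs_choice (index G H) with h | h <;> omega
  rcases h2 with h2 | h2 <;> rw [h2] at h1 <;> omega

lemma IndexBounds.nbr {S : Set V} {l k : ℕ} (h : IndexBounds G S (l + 1) k) {v : V}
    (hv : v ∈ S) : IndexBounds G {x | x ∈ S ∧ G.Adj x v} l k := by
  classical
  intro X hX
  have h1 := h (insert v X) (by
    rw [Finset.coe_insert]
    exact Set.insert_subset hv fun x hx => (hX hx).1)
  rw [index_insert_complete fun x hx => (hX hx).2.symm] at h1
  have h2 := h X fun x hx => (hX hx).1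
  push_cast at h1
  exact ⟨by omega, h2.2⟩

lemma IndexBounds.col_zero {S : Set V} {k : ℕ} (h : IndexBounds G S 0 k) : Col G S 1 := by
  classical
  refine col_one fun u hu v hv huv => ?_
  have h1 := h {u, v} (by
    intro x hx
    simp only [Finset.coe_insert, Finset.coe_singleton, Set.mem_insert_iff,
      Set.mem_singleton_iff] at hx
    rcases hx with rfl | rfl
    · exact hu
    · exact hv)
  rw [index_insert_complete (by simp [huv]), ← insert_empty_eq, index_insert_complete (by simp),
    index_empty] at h1
  norm_num at h1

lemma col_of_nbr [Finite V] {S : Set V} {l k d m : ℕ} (h : IndexBounds G S l k) (hlk : l ≤ k)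
    (hd : ∀ T : Set V, IndexBounds G T (k / 2) (k / 2) → Col G T d)
    (hm : ∀ v ∈ S, Col G {x | x ∈ S ∧ G.Adj x v} m) :
    Col G S (d + (m + 1) * 3 + triFreeBound (d + 1)) := by
  classical
  by_cases htf : TriFree (restr G S)
  · refine Col.of_restr subset_rfl ((col_of_triFree (d := d + 1) (by omega) htf ?_).mono (Set.subset_univ S)
      (by omega))
    intro p L hL hcl hlen
    have hmem : ∀ x ∈ p :: L, x ∈ S := by
      obtain ⟨x, M, y, rfl, hx, -⟩ := hcl
      intro z hz
      rcases List.mem_cons.1 hz with rfl | hz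
      · exact hx.2.1
      · exact hL.mem_of_restr hx.2.2 z hz
    have hcl' : Closes G p L := by
      obtain ⟨x, M, y, rfl, hx, hy, hM⟩ := hcl
      exact ⟨x, M, y, rfl, hx.1, hy.1, fun m hm =>
        (hM m hm).of_restr (hmem p (by simp)) (hmem m (by simp [hm]))⟩
    have hL' := hL.of_restr fun x hx => hmem x (List.mem_cons_of_mem _ hx)
    have hcol := hd _ (h.far hlk (H := insert p L.toFinset)
      (fun x hx => hmem x (by simpa using hx)) (hcl'.abs_index hL' hlen))
    have hout : Col (restr G S) Sᶜ 1 := col_one fun u hu v _ huv => hu huv.2.1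
    refine (col_union hcol.restr hout).mono ?_ le_rfl
    rintro z ⟨hz, hzL⟩
    by_cases hzS : z ∈ S
    · refine Or.inl ⟨hzS, fun w hw => ?_⟩
      rcases Finset.mem_insert.1 hw with rfl | hw
      · exact hz.of_restr (hmem w (by simp)) hzS
      · exact (hzL w (List.mem_toFinset.1 hw)).of_restr
          (hmem w (List.mem_cons_of_mem _ (List.mem_toFinset.1 hw))) hzS
    · exact Or.inr hzS
  · unfold TriFree at htf
    push Not at htf
    obtain ⟨a, b, c, hab, hbc, hac⟩ := htf
    have hmem : ∀ w ∈ [a, b, c], w ∈ S := by simp [hab.2.1, hab.2.2, hbc.2.2]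
    have hcol := hd _ (h.far hlk (H := {a, b, c})
      (fun x hx => hmem x (by simpa using hx)) (abs_index_triangle hab.1 hbc.1 hac.1))
    have hnb := col_nbhd_list (G := restr G S) (m := m) [a, b, c] fun w hw =>
      (hm w (hmem w hw)).restr.mono (fun x hx => ⟨hx.2.1, hx.1⟩) le_rfl
    refine Col.of_restr subset_rfl ((col_union hcol.restr hnb).mono (fun z hz => ?_)
      (by simp))
    by_cases hzn : ∃ w ∈ [a, b, c], z = w ∨ (restr G S).Adj z w
    · exact Or.inr hzn
    · push Not at hzn
      refine Or.inl ⟨hz, fun w hw => ?_⟩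
      have hw' : w ∈ [a, b, c] := by simpa using hw
      exact ⟨(hzn w hw').1.symm, fun h' => (hzn w hw').2 ⟨h'.symm, hz, hmem w hw'⟩⟩

theorem exists_col_bound (k : ℕ) :
    ∃ c, ∀ (V : Type) [Finite V] (G : SimpleGraph V) (S : Set V), IndexBounds G S k k → Col G S c := by
  induction k using Nat.strong_induction_on with
  | _ k ih =>
    rcases Nat.eq_zero_or_pos k with rfl | hk
    · refine ⟨1, fun V _ G S h => h.col_zero⟩
    · obtain ⟨d, hd⟩ := ih (k / 2) (Nat.div_lt_self hk one_lt_two)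
      have key : ∀ l ≤ k, ∃ c, ∀ (V : Type) [Finite V] (G : SimpleGraph V) (S : Set V),
          IndexBounds G S l k → Col G S c := by
        intro l
        induction l with
        | zero => exact fun _ => ⟨1, fun V _ G S h => h.col_zero⟩
        | succ l ihl =>
          intro hl
          obtain ⟨m, hm⟩ := ihl (by omega)
          exact ⟨_, fun V _ G S h => col_of_nbr h hl (hd V G) fun v hv => hm V G _ (h.nbr hv)⟩
      exact key k le_rfl

lemma index_eq_sub [DecidableEq V] [DecidableRel G.Adj] (X : Finset V) : index G X =
    ((X.powerset.filter fun s => (∀ u ∈ s, ∀ v ∈ s, ¬ G.Adj u v) ∧ Even s.card).card : ℤ) -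
      ((X.powerset.filter fun s => (∀ u ∈ s, ∀ v ∈ s, ¬ G.Adj u v) ∧ Odd s.card).card : ℤ) := by
  rw [index, Finset.card_filter, Finset.card_filter]
  push_cast
  rw [← Finset.sum_sub_distrib]
  refine Finset.sum_congr rfl fun s _ => ?_
  by_cases hs : ∀ u ∈ s, ∀ v ∈ s, ¬ G.Adj u v
  · rcases Nat.even_or_odd s.card with he | ho
    · simp only [if_pos hs, he.neg_one_pow, if_pos (And.intro hs he),
        if_neg (fun h : _ ∧ _ => Nat.not_odd_iff_even.2 he h.2), sub_zero]
    · simp only [if_pos hs, ho.neg_one_pow, if_pos (And.intro hs ho),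
        if_neg (fun h : _ ∧ _ => Nat.not_even_iff_odd.2 ho h.2), zero_sub]
  · simp [hs]

lemma Col.colorable {n : ℕ} (h : Col G Set.univ n) : G.Colorable n := by
  obtain ⟨f, h1, h2⟩ := h
  exact ⟨SimpleGraph.Coloring.mk (fun v => (⟨f v, h1 v trivial⟩ : Fin n))
    fun {u v} huv heq => h2 u trivial v trivial huv (congrArg Fin.val heq)⟩

end

end Balanced

theorem stmt19 (k : ℕ) :
    ∃ c : ℕ, ∀ (V : Type) [Fintype V] [DecidableEq V] (G : SimpleGraph V)
      [DecidableRel G.Adj],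
      KBalanced G k → G.chromaticNumber ≤ (c : ℕ∞) := by
  obtain ⟨c, hc⟩ := Balanced.exists_col_bound k
  refine ⟨c, fun V _ _ G _ h => ?_⟩
  rw [SimpleGraph.chromaticNumber_le_iff_colorable]
  refine (hc V G Set.univ fun X _ => ?_).colorable
  rw [Balanced.index_eq_sub X]
  exact abs_le.1 (h X)
end
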